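/- arXiv:2207.00114 — 2 statements merged into one kernel-verified Lean document; each statement's English description precedes it below -/
import Mathlib

section
/- Let m(x) ∈ ℤ[x] be an irreducible polynomial of degree ≥ 1, and for each prime p let r_p(m) be the number of roots of m modulo p. Then lim_{X→∞} (1/π(X)) · ∑_{p ≤ X, p prime} r_p(m) = 1. -/
section

open MeasureTheory Module

theorem lattice_card_le {E : Type*} [NormedAddCommGroup E] [NormedSpace ℝ E]
    [FiniteDimensional ℝ E] [MeasurableSpace E] [BorelSpace E] (L : Submodule ℤ E)
    [DiscreteTopology L] [IsZLattice ℝ L] :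
    ∃ C : ℝ, 0 ≤ C ∧ ∀ R : ℝ, 1 ≤ R → ∀ s : Finset L, (∀ x ∈ s, ‖(x : E)‖ ≤ R) →
      (s.card : ℝ) ≤ C * R ^ finrank ℝ E := by
  set μ : Measure E := Measure.addHaar
  let b := Module.Free.chooseBasis ℤ L
  set D := ZSpan.fundamentalDomain (b.ofZLatticeBasis ℝ) with hD
  have hF : IsAddFundamentalDomain L D μ := ZLattice.isAddFundamentalDomain b μ
  obtain ⟨M, hM⟩ := (ZSpan.fundamentalDomain_isBounded (b.ofZLatticeBasis ℝ)).exists_norm_le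
  have hV0 : μ D ≠ 0 := ZSpan.measure_fundamentalDomain_ne_zero _
  have hVtop : μ D ≠ ⊤ :=
    (ZSpan.fundamentalDomain_isBounded (b.ofZLatticeBasis ℝ)).measure_lt_top.ne
  have hV : 0 < μ.real D := ENNReal.toReal_pos hV0 hVtop
  have : VAddInvariantMeasure L E μ :=
    inferInstanceAs <| VAddInvariantMeasure L.toAddSubgroup E μ
  refine ⟨μ.real (Metric.ball (0 : E) 1) * (1 + |M|) ^ finrank ℝ E / μ.real D, by positivity,
    fun R hR s hs ↦ ?_⟩
  have key : (s.card : ENNReal) * μ D ≤ μ (Metric.closedBall (0 : E) (R * (1 + |M|))) := by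
    rw [hF.measure_eq_tsum' (Metric.closedBall (0 : E) (R * (1 + |M|))), ← nsmul_eq_mul,
      ← Finset.sum_const]
    refine (Finset.sum_le_sum fun x hx ↦ ?_).trans (ENNReal.sum_le_tsum s)
    rw [Set.inter_eq_self_of_subset_right, measure_vadd]
    rintro _ ⟨y, hy, rfl⟩
    rw [mem_closedBall_zero_iff]
    calc ‖(x : E) + y‖ ≤ ‖(x : E)‖ + ‖y‖ := norm_add_le _ _
      _ ≤ R + |M| := add_le_add (hs x hx) ((hM y hy).trans (le_abs_self M))
      _ ≤ R * (1 + |M|) := by nlinarith [abs_nonneg M]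
  have key' := ENNReal.toReal_mono (measure_closedBall_lt_top).ne key
  rw [ENNReal.toReal_mul, ENNReal.toReal_natCast, ← measureReal_def, ← measureReal_def,
    Measure.addHaar_real_closedBall _ _ (by positivity), mul_pow] at key'
  rw [div_mul_eq_mul_div, le_div_iff₀ hV]
  linarith

theorem lattice_sum_isBigO {E : Type*} [NormedAddCommGroup E] [NormedSpace ℝ E]
    [FiniteDimensional ℝ E] [MeasurableSpace E] [BorelSpace E] (L : Submodule ℤ E)
    [DiscreteTopology L] [IsZLattice ℝ L] {F : E → ℝ} {K : NNReal} (hF : LipschitzWith K F)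
    (hs : HasCompactSupport F) (h0 : 0 ≤ F) {x₀ : E} (hx₀ : F x₀ ≠ 0) :
    ∃ c C : ℝ, 0 < c ∧ ∀ ε : ℝ, 0 < ε → ε ≤ 1 →
      |ε ^ finrank ℝ E * (∑' x : L, F (ε • (x : E))) - c| ≤ C * ε := by
  set μ : Measure E := Measure.addHaar
  let b := Module.Free.chooseBasis ℤ L
  set D := ZSpan.fundamentalDomain (b.ofZLatticeBasis ℝ) with hD
  have hFD : IsAddFundamentalDomain L D μ := ZLattice.isAddFundamentalDomain b μ
  have hDb : Bornology.IsBounded D := ZSpan.fundamentalDomain_isBounded (b.ofZLatticeBasis ℝ)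
  have hDm : MeasurableSet D := ZSpan.fundamentalDomain_measurableSet _
  obtain ⟨M, hM0, hM⟩ := hDb.exists_pos_norm_le
  have hV0 : μ D ≠ 0 := ZSpan.measure_fundamentalDomain_ne_zero _
  have hVtop : μ D ≠ ⊤ := hDb.measure_lt_top.ne
  have hV : 0 < μ.real D := ENNReal.toReal_pos hV0 hVtop
  have : VAddInvariantMeasure L E μ :=
    inferInstanceAs <| VAddInvariantMeasure L.toAddSubgroup E μ
  obtain ⟨C, hC0, hC⟩ := lattice_card_le L
  obtain ⟨R, hR0, hR⟩ := hs.isCompact.isBounded.exists_pos_norm_le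
  have hsupp : ∀ x, R < ‖x‖ → F x = 0 := fun x hx ↦ by
    by_contra h
    exact absurd (hR x (subset_tsupport _ h)) (not_le.mpr hx)
  refine ⟨(∫ x, F x ∂μ) / μ.real D, C * (1 + R + M) ^ finrank ℝ E * K * M,
    div_pos (hF.continuous.integral_pos_of_hasCompactSupport_nonneg_nonzero hs h0 hx₀) hV,
    fun ε hε hε1 ↦ ?_⟩
  have hfin : {x : L | ‖(x : E)‖ ≤ (R + M) / ε}.Finite := by
    have : ((Metric.closedBall (0 : E) ((R + M) / ε)) ∩ (L : Set E)).Finite :=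
      Metric.finite_isBounded_inter_isClosed ⟨inferInstanceAs (DiscreteTopology L)⟩
        Metric.isBounded_closedBall (AddSubgroup.isClosed_of_discrete (H := L.toAddSubgroup))
    refine Set.Finite.of_finite_image (f := ((↑) : L → E)) (this.subset ?_)
      Subtype.val_injective.injOn
    rintro _ ⟨x, hx, rfl⟩
    exact ⟨by simpa using hx, x.2⟩
  set N := hfin.toFinset with hN
  have hNC : (N.card : ℝ) * ε ^ finrank ℝ E ≤ C * (1 + R + M) ^ finrank ℝ E := by
    have h1 : 1 ≤ (1 + R + M) / ε := by rw [le_div_iff₀ hε]; linarith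
    have := hC _ h1 N fun x hx ↦ by
      rw [hN, Set.Finite.mem_toFinset] at hx
      refine le_trans hx ?_
      gcongr; linarith
    rwa [div_pow, ← mul_div_assoc, le_div_iff₀ (by positivity)] at this
  have hzero : ∀ x : L, x ∉ N → ∀ y, ‖y‖ ≤ M → F (ε • ((x : E) + y)) = 0 := fun x hx y hy ↦ by
    apply hsupp
    simp only [hN, Set.Finite.mem_toFinset, Set.mem_ofPred_eq, not_le, div_lt_iff₀ hε] at hx
    rw [norm_smul, Real.norm_of_nonneg hε.le]
    have h2 : ‖(x : E)‖ ≤ ‖(x : E) + y‖ + ‖y‖ := by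
      simpa using norm_sub_le ((x : E) + y) y
    nlinarith [norm_nonneg y, norm_nonneg (x : E)]
  have h1 : ∑' x : L, F (ε • (x : E)) = ∑ x ∈ N, F (ε • (x : E)) :=
    tsum_eq_sum fun x hx ↦ by simpa using hzero x hx 0 (by simpa using hM0.le)
  have hcont : Continuous fun x ↦ F (ε • x) := hF.continuous.comp (continuous_const_smul ε)
  have hint : Integrable (fun x ↦ F (ε • x)) μ :=
    (hF.continuous.integrable_of_hasCompactSupport hs).comp_smul hε.ne'
  have h2 : ∫ x, F x ∂μ = ε ^ finrank ℝ E * ∑ x ∈ N, ∫ y in D, F (ε • ((x : E) + y)) ∂μ := by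
    have := Measure.integral_comp_smul μ F ε
    rw [abs_of_pos (by positivity), hFD.integral_eq_tsum'' _ hint,
      tsum_eq_sum (s := N) fun x hx ↦ ?_] at this
    · rw [smul_eq_mul, inv_mul_eq_div, eq_div_iff (by positivity)] at this
      rw [← this, mul_comm]
      rfl
    · exact setIntegral_eq_zero_of_forall_eq_zero fun y hy ↦ hzero x hx y (hM y hy)
  have h3 : ∀ x : L, |μ.real D * F (ε • (x : E)) - ∫ y in D, F (ε • ((x : E) + y)) ∂μ| ≤
      K * (ε * M) * μ.real D := fun x ↦ by
    have hi : IntegrableOn (fun y ↦ F (ε • ((x : E) + y))) D μ :=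
      (hint.comp_add_left (x : E)).integrableOn
    have hc : IntegrableOn (fun _ : E ↦ F (ε • (x : E))) D μ := integrableOn_const hVtop
    rw [← smul_eq_mul, ← setIntegral_const, ← integral_sub hc hi,
      ← Real.norm_eq_abs]
    refine norm_setIntegral_le_of_norm_le_const hDb.measure_lt_top fun y hy ↦ ?_
    rw [← dist_eq_norm]
    refine (hF.dist_le_mul _ _).trans ?_
    gcongr
    rw [dist_eq_norm, ← smul_sub, norm_smul, Real.norm_of_nonneg hε.le]
    gcongr
    simpa using hM y hy
  rw [h1, h2, mul_div_assoc, ← mul_sub, Finset.sum_div, ← Finset.sum_sub_distrib, abs_mul,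
    abs_of_pos (by positivity)]
  calc ε ^ finrank ℝ E *
        |∑ x ∈ N, (F (ε • (x : E)) - (∫ y in D, F (ε • ((x : E) + y)) ∂μ) / μ.real D)|
      ≤ ε ^ finrank ℝ E * ∑ x ∈ N, K * (ε * M) := by
        gcongr
        refine (Finset.abs_sum_le_sum_abs _ _).trans (Finset.sum_le_sum fun x _ ↦ ?_)
        rw [← mul_le_mul_iff_left₀ hV]
        refine le_trans (le_of_eq ?_) (h3 x)
        conv_lhs => rw [← abs_of_pos hV, ← abs_mul, abs_of_pos hV]
        congr 1
        field_simp
    _ = (N.card * ε ^ finrank ℝ E) * (K * (ε * M)) := by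
        rw [Finset.sum_const, nsmul_eq_mul]; ring
    _ ≤ C * (1 + R + M) ^ finrank ℝ E * (K * (ε * M)) := by gcongr
    _ = _ := by ring

end

section

open NumberField NumberField.InfinitePlace NumberField.mixedEmbedding NumberField.Units
  NumberField.Units.dirichletUnitTheorem Module

/-- The tent function supported on `[-1, 1]`. -/
noncomputable def tent (t : ℝ) : ℝ := max 0 (1 - |t|)

theorem tent_nonneg (t : ℝ) : 0 ≤ tent t := le_max_left _ _

theorem tent_le_one (t : ℝ) : tent t ≤ 1 :=
  max_le zero_le_one (by linarith [abs_nonneg t])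

theorem tent_eq_zero {t : ℝ} (ht : 1 ≤ |t|) : tent t = 0 :=
  max_eq_left (by linarith)

theorem abs_lt_one_of_tent_ne_zero {t : ℝ} (ht : tent t ≠ 0) : |t| < 1 := by
  contrapose! ht
  exact tent_eq_zero ht

theorem lipschitzWith_tent : LipschitzWith 1 tent := by
  have h : LipschitzWith 1 fun t : ℝ ↦ 1 - |t| := by
    refine LipschitzWith.of_dist_le_mul fun x y ↦ ?_
    rw [Real.dist_eq, Real.dist_eq, NNReal.coe_one, one_mul, sub_sub_sub_cancel_left,
      abs_sub_comm x]
    exact abs_abs_sub_abs_le_abs_sub _ _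
  exact h.const_max 0

theorem exists_lipschitzWith_prod {ι X : Type*} [PseudoMetricSpace X] (s : Finset ι)
    (f : ι → X → ℝ) (h0 : ∀ i x, 0 ≤ f i x) (h1 : ∀ i x, f i x ≤ 1)
    (hf : ∀ i, ∃ C, LipschitzWith C (f i)) :
    ∃ C, LipschitzWith C fun x ↦ ∏ i ∈ s, f i x := by
  classical
  induction s using Finset.induction_on with
  | empty => exact ⟨0, by simp⟩
  | insert i s hi ih =>
    obtain ⟨C, hC⟩ := ih
    obtain ⟨D, hD⟩ := hf i
    refine ⟨D + C, LipschitzWith.of_dist_le_mul fun x y ↦ ?_⟩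
    simp only [Finset.prod_insert hi]
    have e1 := hC.dist_le_mul x y
    have e2 := hD.dist_le_mul x y
    set a := ∏ j ∈ s, f j x
    set b := ∏ j ∈ s, f j y with hb
    have hb0 : 0 ≤ b := Finset.prod_nonneg fun j _ ↦ h0 j y
    have hb1 : b ≤ 1 := Finset.prod_le_one (fun j _ ↦ h0 j y) fun j _ ↦ h1 j y
    rw [Real.dist_eq] at e1 e2 ⊢
    calc |f i x * a - f i y * b| = |f i x * (a - b) + (f i x - f i y) * b| := by ring_nf
      _ ≤ |f i x| * |a - b| + |f i x - f i y| * |b| := by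
        rw [← abs_mul, ← abs_mul]; exact abs_add_le _ _
      _ ≤ 1 * (C * dist x y) + (D * dist x y) * 1 := by
        rw [abs_of_nonneg (h0 i x), abs_of_nonneg hb0]
        gcongr
        exact h1 i x
      _ = _ := by push_cast; ring

theorem lipschitzWith_log_max {δ : ℝ} (hδ : 0 < δ) :
    LipschitzWith (Real.toNNReal δ⁻¹) fun t ↦ Real.log (max t δ) := by
  refine LipschitzWith.of_dist_le_mul fun x y ↦ ?_
  have key : ∀ a b : ℝ, δ ≤ a → a ≤ b → Real.log b - Real.log a ≤ δ⁻¹ * (b - a) := by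
    intro a b ha hab
    have ha0 : 0 < a := hδ.trans_le ha
    rw [← Real.log_div (by linarith) ha0.ne']
    refine (Real.log_le_sub_one_of_pos (div_pos (ha0.trans_le hab) ha0)).trans ?_
    rw [div_sub_one ha0.ne', div_eq_inv_mul]
    gcongr
  rw [Real.coe_toNNReal _ (by positivity)]
  have h2 : dist (max x δ) (max y δ) ≤ dist x y := by
    simpa [Real.dist_eq] using abs_max_sub_max_le_abs x y δ
  refine le_trans ?_ (mul_le_mul_of_nonneg_left h2 (by positivity))
  rw [Real.dist_eq, Real.dist_eq]
  rcases le_total (max x δ) (max y δ) with h | h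
  · rw [abs_sub_comm, abs_sub_comm (max x δ), abs_of_nonneg (sub_nonneg.2 h), abs_of_nonneg
      (sub_nonneg.2 (Real.log_le_log (lt_max_of_lt_right hδ) h))]
    exact key _ _ (le_max_right _ _) h
  · rw [abs_of_nonneg (sub_nonneg.2 h), abs_of_nonneg
      (sub_nonneg.2 (Real.log_le_log (lt_max_of_lt_right hδ) h))]
    exact key _ _ (le_max_right _ _) h

section

open scoped Classical

variable (K : Type*) [Field K] [NumberField K]

/-- The linear map sending logarithmic absolute values to the coordinates of the logarithmic
embedding in a basis of the unit lattice, together with the logarithm of the norm. -/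
noncomputable def logCoord : (InfinitePlace K → ℝ) →ₗ[ℝ] (Fin (rank K) → ℝ) × ℝ :=
  let S : (InfinitePlace K → ℝ) →ₗ[ℝ] ℝ := ∑ w, (mult w : ℝ) • LinearMap.proj w
  let l : (InfinitePlace K → ℝ) →ₗ[ℝ] logSpace K :=
    LinearMap.pi fun w ↦ (mult w.1 : ℝ) • (LinearMap.proj w.1 - (finrank ℚ K : ℝ)⁻¹ • S)
  LinearMap.prod
    (((basisUnitLattice K).ofZLatticeBasis ℝ (unitLattice K)).equivFun.toLinearMap ∘ₗ l) S

theorem logCoord_snd (l : InfinitePlace K → ℝ) : (logCoord K l).2 = ∑ w, (mult w : ℝ) * l w := by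
  simp [logCoord]

theorem logCoord_fst (l : InfinitePlace K → ℝ) : (logCoord K l).1 =
    ((basisUnitLattice K).ofZLatticeBasis ℝ (unitLattice K)).equivFun
      fun w : {w : InfinitePlace K // w ≠ w₀} ↦
        mult w.1 * (l w.1 - (logCoord K l).2 * (finrank ℚ K : ℝ)⁻¹) := by
  rw [logCoord_snd]
  refine congrArg ((basisUnitLattice K).ofZLatticeBasis ℝ (unitLattice K)).equivFun ?_
  ext w
  simp [mul_comm]

theorem logCoord_injective : Function.Injective (logCoord K) := by
  classical
  refine (injective_iff_map_eq_zero _).2 fun l hl ↦ ?_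
  have h1 := logCoord_fst K l
  have h2 := logCoord_snd K l
  rw [hl] at h1 h2
  simp only [Prod.fst_zero, Prod.snd_zero, zero_mul, sub_zero] at h1 h2
  have h3 := (LinearEquiv.map_eq_zero_iff _).1 h1.symm
  have h4 : ∀ w, w ≠ w₀ → l w = 0 := fun w hw ↦ by
    have := congrFun h3 ⟨w, hw⟩
    simpa [mult_ne_zero] using this
  ext w
  by_cases hw : w = w₀
  · rw [Finset.sum_eq_single w (fun b _ hb ↦ by rw [h4 b (hw ▸ hb), mul_zero]) (by simp)] at h2
    simpa [mult_ne_zero] using h2.symm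
  · exact h4 w hw

theorem logCoord_log {x : mixedSpace K} (hx : mixedEmbedding.norm x ≠ 0) :
    logCoord K (fun w ↦ Real.log (normAtPlace w x)) =
      (((basisUnitLattice K).ofZLatticeBasis ℝ (unitLattice K)).equivFun (logMap x),
        Real.log (mixedEmbedding.norm x)) := by
  have h2 : (logCoord K (fun w ↦ Real.log (normAtPlace w x))).2 =
      Real.log (mixedEmbedding.norm x) := by
    rw [logCoord_snd, mixedEmbedding.norm_apply, Real.log_prod]
    · simp
    · exact fun w _ ↦ pow_ne_zero _ (mixedEmbedding.norm_ne_zero_iff.1 hx w)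
  refine Prod.ext ?_ h2
  rw [logCoord_fst, h2]
  rfl

theorem lipschitzWith_normAtPlace (w : InfinitePlace K) :
    LipschitzWith 1 (fun x : mixedSpace K ↦ normAtPlace w x) := by
  refine LipschitzWith.of_dist_le_mul fun x y ↦ ?_
  have h : ∀ x y : mixedSpace K, normAtPlace w x - normAtPlace w y ≤ ‖x - y‖ := fun x y ↦ by
    have h1 := normAtPlace_add_le w (x - y) y
    rw [sub_add_cancel] at h1
    have h2 : normAtPlace w (x - y) ≤ ‖x - y‖ := by
      rw [norm_eq_sup'_normAtPlace]
      exact Finset.le_sup' (fun w ↦ normAtPlace w (x - y)) (Finset.mem_univ w)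
    linarith
  rw [Real.dist_eq, dist_eq_norm, NNReal.coe_one, one_mul, abs_le]
  constructor
  · have := h y x
    rw [norm_sub_rev] at this
    linarith
  · exact h x y

theorem exists_lipschitz_cutoff : ∃ F : mixedSpace K → ℝ, (∃ C, LipschitzWith C F) ∧
    HasCompactSupport F ∧ (∀ x, mixedEmbedding.norm x = 0 → F x = 0) ∧
    ∀ x, mixedEmbedding.norm x ≠ 0 → F x =
      (∏ i, tent (((basisUnitLattice K).ofZLatticeBasis ℝ (unitLattice K)).equivFun (logMap x) i)) *
        tent (Real.log (mixedEmbedding.norm x)) := by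
  classical
  let A := logCoord K
  let ψ : (Fin (rank K) → ℝ) × ℝ → ℝ := fun p ↦ (∏ i, tent (p.1 i)) * tent p.2
  have hψ1 : ∀ p, ψ p ≠ 0 → ‖p‖ ≤ 1 := fun p hp ↦ by
    obtain ⟨h1, h2⟩ := mul_ne_zero_iff.1 hp
    refine max_le ((pi_norm_le_iff_of_nonneg zero_le_one).2 fun i ↦ ?_) ?_
    · exact (abs_lt_one_of_tent_ne_zero (Finset.prod_ne_zero_iff.1 h1 i (Finset.mem_univ i))).le
    · exact (abs_lt_one_of_tent_ne_zero h2).le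
  have hψ2 : ∃ C, LipschitzWith C ψ := by
    obtain ⟨C, hC⟩ := exists_lipschitzWith_prod (X := (Fin (rank K) → ℝ) × ℝ)
      (Finset.univ : Finset (Option (Fin (rank K))))
      (fun i p ↦ tent (i.elim p.2 p.1)) (fun i p ↦ tent_nonneg _) (fun i p ↦ tent_le_one _)
      (fun i ↦ by
        cases i with
        | none => exact ⟨_, lipschitzWith_tent.comp LipschitzWith.prod_snd⟩
        | some i =>
          exact ⟨_, lipschitzWith_tent.comp ((LipschitzWith.eval i).comp LipschitzWith.prod_fst)⟩)
    have e : ψ = fun p ↦ ∏ i : Option (Fin (rank K)), tent (i.elim p.2 p.1) := by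
      ext p
      rw [Fintype.prod_option, mul_comm]
      rfl
    exact ⟨C, e ▸ hC⟩
  obtain ⟨c, -, hc⟩ := A.exists_antilipschitzWith (LinearMap.ker_eq_bot.2 (logCoord_injective K))
  have hM : ∀ l, ψ (A l) ≠ 0 → ‖l‖ ≤ c := fun l hl ↦ by
    have := hc.le_mul_dist l 0
    rw [map_zero, dist_zero_right, dist_zero_right] at this
    exact this.trans (mul_le_of_le_one_right c.2 (hψ1 _ hl))
  set δ := Real.exp (-(c + 1)) with hδ
  have hδ0 : 0 < δ := Real.exp_pos _
  let ℓ : mixedSpace K → InfinitePlace K → ℝ := fun x w ↦ Real.log (max (normAtPlace w x) δ)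
  have hℓ : ∀ x, ψ (A (ℓ x)) ≠ 0 → ∀ w, δ < normAtPlace w x ∧ normAtPlace w x ≤ Real.exp c := by
    intro x hx w
    have h1 := (norm_le_pi_norm (ℓ x) w).trans (hM _ hx)
    rw [Real.norm_eq_abs, abs_le] at h1
    have h2 : δ < normAtPlace w x := by
      by_contra! h
      have : ℓ x w = -(c + 1) := by
        change Real.log (max (normAtPlace w x) δ) = _
        rw [max_eq_right h, Real.log_exp]
      linarith
    refine ⟨h2, ?_⟩
    simp only [ℓ, max_eq_left h2.le] at h1
    exact (Real.log_le_iff_le_exp (hδ0.trans h2)).1 h1.2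
  refine ⟨fun x ↦ ψ (A (ℓ x)), ?_, ?_, fun x hx ↦ ?_, fun x hx ↦ ?_⟩
  · obtain ⟨C, hC⟩ := hψ2
    have h3 : LipschitzWith (Real.toNNReal δ⁻¹ * 1) ℓ := LipschitzWith.of_dist_le_mul fun x y ↦
      (dist_pi_le_iff (by positivity)).2 fun w ↦
        ((lipschitzWith_log_max hδ0).comp (lipschitzWith_normAtPlace K w)).dist_le_mul x y
    exact ⟨_, hC.comp ((LinearMap.toContinuousLinearMap A).lipschitz.comp h3)⟩
  · refine HasCompactSupport.of_support_subset_isCompact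
      (isCompact_closedBall (0 : mixedSpace K) (Real.exp c)) fun x hx ↦ ?_
    rw [mem_closedBall_zero_iff, norm_eq_sup'_normAtPlace]
    exact Finset.sup'_le _ _ fun w _ ↦ (hℓ x hx w).2
  · by_contra h
    obtain ⟨w, hw⟩ := mixedEmbedding.norm_eq_zero_iff.1 hx
    have := (hℓ x h w).1
    linarith
  · change ψ (A (ℓ x)) =
      ψ (((basisUnitLattice K).ofZLatticeBasis ℝ (unitLattice K)).equivFun (logMap x),
      Real.log (mixedEmbedding.norm x))
    rw [← logCoord_log K hx]
    by_cases h : ∀ w, δ ≤ normAtPlace w x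
    · have e : ℓ x = fun w ↦ Real.log (normAtPlace w x) :=
        funext fun w ↦ congrArg Real.log (max_eq_left (h w))
      rw [e]
    · push Not at h
      obtain ⟨w, hw⟩ := h
      have h1 : ψ (A (ℓ x)) = 0 := by
        by_contra h
        have := (hℓ x h w).1
        linarith
      rw [h1]
      by_contra! h
      have h2 := (norm_le_pi_norm _ w).trans (hM _ h.symm)
      rw [Real.norm_eq_abs, abs_le] at h2
      have h3 : 0 < normAtPlace w x :=
        (normAtPlace_nonneg w x).lt_of_ne' (mixedEmbedding.norm_ne_zero_iff.1 hx w)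
      have := (Real.log_lt_iff_lt_exp h3).2 hw
      linarith [h2.1]

end

end

section

open NumberField NumberField.InfinitePlace NumberField.mixedEmbedding NumberField.Units
  NumberField.Units.dirichletUnitTheorem Module

theorem tsum_ofReal_tent (y : ℝ) : ∑' k : ℤ, ENNReal.ofReal (tent (k + y)) = 1 := by
  have h0 := Int.floor_le y
  have h1 := Int.lt_floor_add_one y
  rw [tsum_eq_sum (s := {-⌊y⌋, -⌊y⌋ - 1}), Finset.sum_pair (by lia),
    ← ENNReal.ofReal_add (tent_nonneg _) (tent_nonneg _), ENNReal.ofReal_eq_one]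
  · push_cast
    unfold tent
    rw [abs_of_nonneg (by linarith), abs_of_nonpos (by linarith), max_eq_right (by linarith),
      max_eq_right (by linarith)]
    ring
  · intro k hk
    rw [tent_eq_zero, ENNReal.ofReal_zero]
    simp only [Finset.mem_insert, Finset.mem_singleton, not_or] at hk
    rcases lt_or_gt_of_ne hk.1 with h | h
    · have : k ≤ -⌊y⌋ - 2 := by lia
      have : (k : ℝ) ≤ -⌊y⌋ - 2 := by exact_mod_cast this
      rw [abs_of_nonpos (by linarith)]
      linarith
    · have : -⌊y⌋ + 1 ≤ k := by lia
      have : -⌊y⌋ + 1 ≤ (k : ℝ) := by exact_mod_cast this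
      rw [abs_of_nonneg (by linarith)]
      linarith

theorem tsum_pi_prod (r : ℕ) (f : Fin r → ℤ → ENNReal) :
    ∑' k : Fin r → ℤ, ∏ i, f i (k i) = ∏ i, ∑' k : ℤ, f i k := by
  induction r with
  | zero => simp
  | succ r ih =>
    rw [← (Fin.consEquiv fun _ ↦ ℤ).tsum_eq, ENNReal.tsum_prod', Fin.prod_univ_succ, ← ih,
      ← ENNReal.tsum_mul_right]
    refine tsum_congr fun k ↦ ?_
    rw [← ENNReal.tsum_mul_left]
    refine tsum_congr fun l ↦ ?_
    rw [Fin.prod_univ_succ]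
    simp [Fin.consEquiv]

section

open scoped Classical

variable (K : Type*) [Field K] [NumberField K]

theorem bijective_torsion_mul_prod : Function.Bijective
    fun p : torsion K × (Fin (rank K) → ℤ) ↦ (p.1 : (𝓞 K)ˣ) * ∏ i, fundSystem K i ^ p.2 i := by
  refine ⟨fun p q h ↦ ?_, fun x ↦ ?_⟩
  · exact (exist_unique_eq_mul_prod K _).unique rfl h
  · obtain ⟨p, hp, -⟩ := exist_unique_eq_mul_prod K x
    exact ⟨p, hp.symm⟩

theorem equivFun_logEmbedding (ζ : torsion K) (e : Fin (rank K) → ℤ) (i : Fin (rank K)) :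
    ((basisUnitLattice K).ofZLatticeBasis ℝ (unitLattice K)).equivFun
      (logEmbedding K (Additive.ofMul ((ζ : (𝓞 K)ˣ) * ∏ i, fundSystem K i ^ e i))) i = e i := by
  have h1 : logEmbedding K (Additive.ofMul (ζ : (𝓞 K)ˣ)) = 0 :=
    logEmbedding_eq_zero_iff.2 ζ.2
  have h2 : logEmbedding K (Additive.ofMul ((ζ : (𝓞 K)ˣ) * ∏ i, fundSystem K i ^ e i)) =
      ∑ i, (e i : ℝ) • ((basisUnitLattice K).ofZLatticeBasis ℝ (unitLattice K)) i := by
    rw [ofMul_mul, map_add, h1, zero_add, ofMul_prod, map_sum]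
    refine Finset.sum_congr rfl fun i _ ↦ ?_
    rw [ofMul_zpow, map_zsmul, logEmbedding_fundSystem, Basis.ofZLatticeBasis_apply,
      Int.cast_smul_eq_zsmul]
  rw [h2, Basis.equivFun_apply, Basis.repr_sum_self]

theorem tsum_units_tent (y : logSpace K) :
    ∑' u : (𝓞 K)ˣ, ENNReal.ofReal (∏ i, tent
      (((basisUnitLattice K).ofZLatticeBasis ℝ (unitLattice K)).equivFun
        (logEmbedding K (Additive.ofMul u) + y) i)) = torsionOrder K := by
  rw [← (Equiv.ofBijective _ (bijective_torsion_mul_prod K)).tsum_eq, ENNReal.tsum_prod']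
  have h : ∀ ζ : torsion K, ∑' e : Fin (rank K) → ℤ, ENNReal.ofReal (∏ i, tent
      (((basisUnitLattice K).ofZLatticeBasis ℝ (unitLattice K)).equivFun
        (logEmbedding K (Additive.ofMul (Equiv.ofBijective _ (bijective_torsion_mul_prod K)
          (ζ, e))) + y) i)) = 1 := fun ζ ↦ by
    simp_rw [map_add, Pi.add_apply, Equiv.ofBijective_apply, equivFun_logEmbedding,
      ENNReal.ofReal_prod_of_nonneg (fun i _ ↦ tent_nonneg _)]
    rw [tsum_pi_prod (rank K) fun i k ↦ ENNReal.ofReal (tent (k +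
      ((basisUnitLattice K).ofZLatticeBasis ℝ (unitLattice K)).equivFun y i))]
    simp_rw [tsum_ofReal_tent, Finset.prod_const_one]
  let := Fintype.ofFinite (torsion K)
  simp_rw [h]
  rw [tsum_fintype, Finset.sum_const, Finset.card_univ, nsmul_one, torsionOrder,
    Nat.card_eq_fintype_card]

end

end

section

open NumberField NumberField.InfinitePlace NumberField.mixedEmbedding NumberField.Units
  NumberField.Units.dirichletUnitTheorem Module nonZeroDivisors

section

open scoped Classical

variable (K : Type*) [Field K] [NumberField K]

theorem tsum_idealLattice {C : ClassGroup (𝓞 K)} {J : (Ideal (𝓞 K))⁰}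
    (hJ : ClassGroup.mk0 J = C⁻¹) (f : mixedSpace K → ENNReal) (hf : f 0 = 0) :
    ∃ g : {I : (Ideal (𝓞 K))⁰ // ClassGroup.mk0 I = C} → 𝓞 K,
      (∀ I, Ideal.span {g I} = (I : Ideal (𝓞 K)) * J) ∧
      ∑' x : idealLattice K (FractionalIdeal.mk0 K J), f x =
        ∑' (I) (u : (𝓞 K)ˣ), f (u • mixedEmbedding K (g I)) := by
  have h1 : ∀ I : {I : (Ideal (𝓞 K))⁰ // ClassGroup.mk0 I = C}, ∃ g : 𝓞 K,
      Ideal.span {g} = (I : Ideal (𝓞 K)) * J := fun I ↦ by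
    have h : ClassGroup.mk0 (I.1 * J) = 1 := by rw [map_mul, I.2, hJ, mul_inv_cancel]
    obtain ⟨⟨g, hg⟩⟩ := (ClassGroup.mk0_eq_one_iff (I.1 * J).2).1 h
    exact ⟨g, hg.symm⟩
  choose g hg using h1
  refine ⟨g, hg, ?_⟩
  have hJ0 : (J : Ideal (𝓞 K)) ≠ 0 := nonZeroDivisors.ne_zero J.2
  have hg0 : ∀ I, g I ≠ 0 := fun I h ↦ by
    have := hg I
    rw [h, Set.singleton_zero, Ideal.span_zero] at this
    exact mul_ne_zero (nonZeroDivisors.ne_zero I.1.2) hJ0 this.symm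
  have hmem : ∀ I, ∀ u : (𝓞 K)ˣ, u • mixedEmbedding K (g I) ∈
      idealLattice K (FractionalIdeal.mk0 K J) := fun I u ↦ by
    refine (mem_idealLattice K _).2 ⟨((u * g I : 𝓞 K) : K), ?_, ?_⟩
    · rw [FractionalIdeal.coe_mk0]
      refine (FractionalIdeal.mem_coeIdeal _).2 ⟨_, ?_, rfl⟩
      refine Ideal.mul_mem_left _ _ (Ideal.mul_le_right (I := (I : Ideal (𝓞 K))) ?_)
      rw [← hg]
      exact Ideal.mem_span_singleton_self _
    · rw [unitSMul_smul, ← map_mul]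
      simp
  let Φ : {I : (Ideal (𝓞 K))⁰ // ClassGroup.mk0 I = C} × (𝓞 K)ˣ →
      idealLattice K (FractionalIdeal.mk0 K J) := fun p ↦ ⟨_, hmem p.1 p.2⟩
  have hspan : ∀ I, ∀ u : (𝓞 K)ˣ, Ideal.span {(u : 𝓞 K) * g I} = (I : Ideal (𝓞 K)) * J :=
    fun I u ↦ by
      rw [Ideal.span_singleton_mul_left_unit u.isUnit, hg]
  have hΦ : Function.Injective Φ := fun p q h ↦ by
    have h2 := congrArg Subtype.val h
    simp only [Φ, unitSMul_smul, ← map_mul] at h2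
    have h3 : (p.2 : 𝓞 K) * g p.1 = q.2 * g q.1 := by
      have := mixedEmbedding_injective K h2
      exact RingOfIntegers.ext (by simpa using this)
    have h4 : p.1 = q.1 := by
      have := hspan p.1 p.2
      rw [h3, hspan] at this
      exact Subtype.ext (Subtype.ext (mul_right_cancel₀ hJ0 this.symm))
    refine Prod.ext h4 (Units.ext ?_)
    rw [h4] at h3
    exact mul_right_cancel₀ (hg0 _) h3
  rw [← hΦ.tsum_eq, ENNReal.tsum_prod']
  intro x hx
  obtain ⟨a, ha, hax⟩ := (mem_idealLattice K _).1 x.2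
  rw [FractionalIdeal.coe_mk0] at ha
  obtain ⟨b, hb, rfl⟩ := (FractionalIdeal.mem_coeIdeal _).1 ha
  have hb0 : b ≠ 0 := by
    rintro rfl
    rw [map_zero, map_zero] at hax
    exact hx (by change f x = 0; rw [← hax, hf])
  obtain ⟨I, hI⟩ := Ideal.dvd_span_singleton.2 hb
  have hI0 : I ≠ 0 := by
    rintro rfl
    rw [mul_zero] at hI
    exact hb0 (Ideal.span_singleton_eq_bot.1 hI)
  let I' : (Ideal (𝓞 K))⁰ := ⟨I, mem_nonZeroDivisors_of_ne_zero hI0⟩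
  have hIC : ClassGroup.mk0 I' = C := by
    have h : ClassGroup.mk0 (I' * J) = 1 := by
      refine (ClassGroup.mk0_eq_one_iff (I' * J).2).2 ⟨⟨b, ?_⟩⟩
      rw [Ideal.submodule_span_eq, hI, mul_comm]
      rfl
    rw [map_mul, hJ] at h
    exact mul_inv_eq_one.1 h
  have h5 : Ideal.span {g ⟨I', hIC⟩} = Ideal.span {b} := by
    rw [hg, hI, mul_comm]
  obtain ⟨u, hu⟩ := Ideal.span_singleton_eq_span_singleton.1 h5
  refine ⟨(⟨I', hIC⟩, u), Subtype.ext ?_⟩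
  simp only [Φ, unitSMul_smul, ← map_mul, ← hax, ← hu]
  simp [mul_comm]

theorem tsum_ideal_class (C : ClassGroup (𝓞 K)) :
    ∃ c D δ : ℝ, 0 < c ∧ 0 < δ ∧ ∀ T : ℝ, 0 < T → T ≤ δ →
    |T * ∑' I : {I : (Ideal (𝓞 K))⁰ // ClassGroup.mk0 I = C},
      tent (Real.log (Ideal.absNorm (I : Ideal (𝓞 K)) * T)) - c| ≤
      D * T ^ (finrank ℚ K : ℝ)⁻¹ := by
  obtain ⟨J, hJ⟩ := ClassGroup.mk0_surjective C⁻¹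
  obtain ⟨F, ⟨L, hFL⟩, hFc, hF0, hF⟩ := exists_lipschitz_cutoff K
  have hFnn : ∀ x, 0 ≤ F x := fun x ↦ by
    by_cases h : mixedEmbedding.norm x = 0
    · rw [hF0 x h]
    · rw [hF x h]
      exact mul_nonneg (Finset.prod_nonneg fun i _ ↦ tent_nonneg _) (tent_nonneg _)
  have hF1 : F 1 ≠ 0 := by
    rw [hF 1 (by simp), map_one, logMap_one, map_zero, Real.log_one]
    simp [tent]
  obtain ⟨c, D, hc, hcD⟩ := lattice_sum_isBigO (idealLattice K (FractionalIdeal.mk0 K J)) hFL hFc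
    hFnn hF1
  obtain ⟨N, hN⟩ : ∃ N : ℝ, N = Ideal.absNorm (J : Ideal (𝓞 K)) := ⟨_, rfl⟩
  have hN0 : 0 < N := hN ▸ Nat.cast_pos.2 (Ideal.absNorm_pos_of_nonZeroDivisors J)
  set n := finrank ℚ K with hn
  have hn0 : (n : ℝ) ≠ 0 := Nat.cast_ne_zero.2 finrank_pos.ne'
  have hw : (0 : ℝ) < torsionOrder K := Nat.cast_pos.2 (torsionOrder_pos K)
  refine ⟨N * c / torsionOrder K, N * (D * N⁻¹ ^ (n : ℝ)⁻¹) / torsionOrder K, N,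
    by positivity, hN0,
    fun T hT0 hT ↦ ?_⟩
  set ε : ℝ := (T / N) ^ (n : ℝ)⁻¹ with hε
  have hTN : 0 < T / N := by positivity
  have hε0 : 0 < ε := Real.rpow_pos_of_pos hTN _
  have hε1 : ε ≤ 1 := Real.rpow_le_one hTN.le ((div_le_one hN0).2 hT) (by positivity)
  have hεn : ε ^ n = T / N := by
    rw [hε, ← Real.rpow_natCast, ← Real.rpow_mul hTN.le, inv_mul_cancel₀ hn0, Real.rpow_one]
  obtain ⟨g, hg, hsum⟩ := tsum_idealLattice K hJ (fun x ↦ ENNReal.ofReal (F (ε • x)))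
    (by rw [smul_zero, hF0 _ (by simp), ENNReal.ofReal_zero])
  have hnorm : ∀ I, mixedEmbedding.norm (ε • mixedEmbedding K (g I)) =
      Ideal.absNorm (I : Ideal (𝓞 K)) * T := fun I ↦ by
    have h1 := congrArg Ideal.absNorm (hg I)
    rw [Ideal.absNorm_span_singleton, map_mul] at h1
    rw [mixedEmbedding.norm_smul, norm_eq_norm, abs_of_pos hε0, ← hn, hεn,
      ← Algebra.coe_norm_int]
    have h2 : ((|((Algebra.norm ℤ (g I) : ℤ) : ℚ)| : ℚ) : ℝ) =
        Ideal.absNorm (I : Ideal (𝓞 K)) * N := by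
      rw [hN, ← Nat.cast_mul, ← h1]
      simp [Nat.cast_natAbs]
    rw [h2]
    field_simp
  have hnorm0 : ∀ I, mixedEmbedding.norm (ε • mixedEmbedding K (g I)) ≠ 0 := fun I ↦ by
    rw [hnorm]
    exact (mul_pos (Nat.cast_pos.2 (Ideal.absNorm_pos_of_nonZeroDivisors I.1)) hT0).ne'
  have hval : ∀ I, ∑' u : (𝓞 K)ˣ, ENNReal.ofReal (F (ε • u • mixedEmbedding K (g I))) =
      torsionOrder K * ENNReal.ofReal (tent (Real.log (Ideal.absNorm (I : Ideal (𝓞 K)) * T))) :=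
    fun I ↦ by
      rw [← tsum_units_tent K (logMap (ε • mixedEmbedding K (g I))), ← ENNReal.tsum_mul_right]
      refine tsum_congr fun u ↦ ?_
      have e : ε • u • mixedEmbedding K (g I) = u • ε • mixedEmbedding K (g I) := by
        simp_rw [unitSMul_smul]
        exact (mul_smul_comm _ _ _).symm
      rw [e, hF _ (by rw [norm_unit_smul]; exact hnorm0 I), norm_unit_smul,
        logMap_unit_smul _ (hnorm0 I), hnorm,
        ENNReal.ofReal_mul (Finset.prod_nonneg fun i _ ↦ tent_nonneg _)]
  simp_rw [hval, ENNReal.tsum_mul_left] at hsum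
  have hreal : ∑' x : idealLattice K (FractionalIdeal.mk0 K J), F (ε • (x : mixedSpace K)) =
      torsionOrder K * ∑' I : {I : (Ideal (𝓞 K))⁰ // ClassGroup.mk0 I = C},
        tent (Real.log (Ideal.absNorm (I : Ideal (𝓞 K)) * T)) := by
    have := congrArg ENNReal.toReal hsum
    rw [ENNReal.toReal_mul, ENNReal.tsum_toReal_eq (fun _ ↦ ENNReal.ofReal_ne_top),
      ENNReal.tsum_toReal_eq (fun _ ↦ ENNReal.ofReal_ne_top)] at this
    simpa [ENNReal.toReal_ofReal, hFnn, tent_nonneg] using this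
  have hfin := hcD ε hε0 hε1
  rw [hreal, mixedEmbedding.finrank, ← hn, hεn] at hfin
  set S := ∑' I : {I : (Ideal (𝓞 K))⁰ // ClassGroup.mk0 I = C},
        tent (Real.log (Ideal.absNorm (I : Ideal (𝓞 K)) * T))
  have h1 : T * S - N * c / torsionOrder K =
      (N / torsionOrder K) * (T / N * (torsionOrder K * S) - c) := by
    field_simp
  rw [h1, abs_mul, abs_of_pos (by positivity)]
  refine (mul_le_mul_of_nonneg_left hfin (by positivity)).trans (le_of_eq ?_)
  rw [hε, div_eq_inv_mul T N, Real.mul_rpow (by positivity) hT0.le]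
  ring

end

end

section

open NumberField Module nonZeroDivisors

section

variable (K : Type*) [Field K] [NumberField K]

theorem finite_absNorm_le (x : ℝ) :
    {I : (Ideal (𝓞 K))⁰ | (Ideal.absNorm (I : Ideal (𝓞 K)) : ℝ) ≤ x}.Finite := by
  refine (Ideal.finite_setOfPred_absNorm_le₀ (S := 𝓞 K) ⌊x⌋₊).subset fun I hI ↦ ?_
  exact Nat.le_floor hI

theorem tsum_ideal : ∃ c D δ : ℝ, 0 < c ∧ 0 < δ ∧ ∀ T : ℝ, 0 < T → T ≤ δ →
    |T * ∑' I : (Ideal (𝓞 K))⁰, tent (Real.log (Ideal.absNorm (I : Ideal (𝓞 K)) * T)) - c| ≤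
      D * T ^ (finrank ℚ K : ℝ)⁻¹ := by
  choose c D δ hc hδ h using tsum_ideal_class K
  refine ⟨∑ C, c C, ∑ C, D C, Finset.univ.inf' Finset.univ_nonempty δ,
    Finset.sum_pos (fun C _ ↦ hc C) Finset.univ_nonempty, (Finset.lt_inf'_iff _).2 fun C _ ↦ hδ C,
    fun T hT0 hT ↦ ?_⟩
  have hs : Summable fun I : (Ideal (𝓞 K))⁰ ↦
      tent (Real.log (Ideal.absNorm (I : Ideal (𝓞 K)) * T)) := by
    refine summable_of_hasFiniteSupport ((finite_absNorm_le K (Real.exp 1 / T)).subset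
      fun I hI ↦ ?_)
    have h1 := (abs_lt.1 (abs_lt_one_of_tent_ne_zero hI)).2
    have h2 : (0 : ℝ) < Ideal.absNorm (I : Ideal (𝓞 K)) :=
      Nat.cast_pos.2 (Ideal.absNorm_pos_of_nonZeroDivisors I)
    exact (le_div_iff₀ hT0).2 ((Real.log_lt_iff_lt_exp (by positivity)).1 h1).le
  have e := (((Equiv.sigmaFiberEquiv
    (ClassGroup.mk0 : (Ideal (𝓞 K))⁰ → _)).summable_iff).2 hs).tsum_sigma
  rw [← (Equiv.sigmaFiberEquiv (ClassGroup.mk0 : (Ideal (𝓞 K))⁰ → _)).tsum_eq]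
  refine (congrArg (fun x ↦ |T * x - ∑ C, c C|) e).le.trans ?_
  rw [tsum_fintype, Finset.mul_sum, ← Finset.sum_sub_distrib, Finset.sum_mul]
  refine (Finset.abs_sum_le_sum_abs _ _).trans (Finset.sum_le_sum fun C _ ↦ ?_)
  exact h C T hT0 (hT.trans (Finset.inf'_le _ (Finset.mem_univ C)))

end

end

section

open MeasureTheory Set Filter Topology Asymptotics

theorem continuous_tent : Continuous tent := lipschitzWith_tent.continuous

theorem continuousOn_tent_log : ContinuousOn (fun t ↦ tent (Real.log t)) (Ioi 0) :=
  continuous_tent.comp_continuousOn (Real.continuousOn_log.mono fun _ h ↦ (ne_of_gt h))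

theorem tent_log_eq_zero_of_exp_le {t : ℝ} (ht : Real.exp 1 ≤ t) : tent (Real.log t) = 0 :=
  tent_eq_zero ((le_abs_self _).trans' <|
    (Real.le_log_iff_exp_le ((Real.exp_pos 1).trans_le ht)).2 ht)

theorem tent_log_eq_zero_of_le {t : ℝ} (h0 : 0 < t) (ht : t ≤ Real.exp (-1)) :
    tent (Real.log t) = 0 := by
  have := (Real.log_le_iff_le_exp h0).2 ht
  exact tent_eq_zero ((neg_le_abs _).trans' (by linarith))

theorem locallyIntegrableOn_tent_log :
    LocallyIntegrableOn (fun t ↦ (tent (Real.log t) : ℂ)) (Ioi 0) :=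
  (Complex.continuous_ofReal.comp_continuousOn continuousOn_tent_log).locallyIntegrableOn
    measurableSet_Ioi

theorem tent_log_isBigO_atTop (a : ℝ) :
    (fun t ↦ (tent (Real.log t) : ℂ)) =O[atTop] (fun t : ℝ ↦ t ^ a) := by
  refine (EventuallyEq.isBigO ?_).trans (isBigO_zero (E' := ℂ) _ _)
  filter_upwards [eventually_ge_atTop (Real.exp 1)] with t ht
  simp [tent_log_eq_zero_of_exp_le ht]

theorem tent_log_isBigO_nhdsGT (a : ℝ) :
    (fun t ↦ (tent (Real.log t) : ℂ)) =O[𝓝[>] 0] (fun t : ℝ ↦ t ^ a) := by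
  refine (EventuallyEq.isBigO ?_).trans (isBigO_zero (E' := ℂ) _ _)
  filter_upwards [Ioo_mem_nhdsGT (Real.exp_pos (-1))] with t ht
  simp [tent_log_eq_zero_of_le ht.1 ht.2.le]

theorem mellinConvergent_tent_log (s : ℂ) :
    MellinConvergent (fun t ↦ (tent (Real.log t) : ℂ)) s :=
  mellinConvergent_of_isBigO_rpow locallyIntegrableOn_tent_log (tent_log_isBigO_atTop _)
    (lt_add_one _) (tent_log_isBigO_nhdsGT _) (sub_one_lt _)

theorem differentiable_mellin_tent_log :
    Differentiable ℂ (mellin fun t ↦ (tent (Real.log t) : ℂ)) := fun s ↦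
  mellin_differentiableAt_of_isBigO_rpow locallyIntegrableOn_tent_log (tent_log_isBigO_atTop _)
    (lt_add_one s.re) (tent_log_isBigO_nhdsGT _) (sub_one_lt s.re)

theorem mellin_tent_log {s : ℂ} (hs : s ≠ 0) :
    mellin (fun t ↦ (tent (Real.log t) : ℂ)) s =
      (Complex.exp s + Complex.exp (-s) - 2) / s ^ 2 := by
  have he : Real.exp (-1) ≤ 1 := by simp
  have he' : 1 ≤ Real.exp 1 := by simp
  have hpow (x : ℝ) : ((Real.exp x : ℝ) : ℂ) ^ s = Complex.exp (x * s) := by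
    rw [Complex.cpow_def_of_ne_zero (by simp), ← Complex.ofReal_log (Real.exp_pos x).le,
      Real.log_exp]
  have hd (t : ℝ) (ht : 0 < t) :
      HasDerivAt (fun t : ℝ ↦ (t : ℂ) ^ s) (s * (t : ℂ) ^ (s - 1)) t := by
    have := (HasDerivAt.cpow_const (c := s) (hasDerivAt_id (t : ℂ)) (by simp [ht])).comp_ofReal
    simpa using this
  have hl (t : ℝ) (ht : 0 < t) : HasDerivAt (fun t : ℝ ↦ (Real.log t : ℂ)) ((t : ℂ)⁻¹) t := by
    simpa using (Real.hasDerivAt_log ht.ne').ofReal_comp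
  have hmul (t : ℝ) (ht : 0 < t) : (t : ℂ) ^ s * (t : ℂ)⁻¹ = (t : ℂ) ^ (s - 1) := by
    rw [Complex.cpow_sub _ _ (by simp [ht.ne']), Complex.cpow_one, div_eq_mul_inv]
  have hint : IntegrableOn (fun t : ℝ ↦ (t : ℂ) ^ (s - 1) • (tent (Real.log t) : ℂ)) (Ioi 0) :=
    mellinConvergent_tent_log s
  have hI (a b : ℝ) (ha : 0 < a) (hab : a ≤ b) :
      IntervalIntegrable (fun t : ℝ ↦ (t : ℂ) ^ (s - 1) • (tent (Real.log t) : ℂ)) volume a b :=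
    (intervalIntegrable_iff_integrableOn_Ioc_of_le hab).2
      (hint.mono_set fun t ht ↦ ha.trans ht.1)
  have h1 : mellin (fun t ↦ (tent (Real.log t) : ℂ)) s =
      ∫ t in Real.exp (-1)..Real.exp 1, (t : ℂ) ^ (s - 1) • (tent (Real.log t) : ℂ) := by
    rw [mellin, intervalIntegral.integral_of_le (he.trans he')]
    refine (setIntegral_eq_of_subset_of_forall_sdiff_eq_zero measurableSet_Ioi
      (fun t ht ↦ (Real.exp_pos _).trans ht.1) fun t ht ↦ ?_)
    have h0 : 0 < t := ht.1
    by_cases h : t ≤ Real.exp (-1)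
    · simp [tent_log_eq_zero_of_le h0 h]
    · have : ¬ t ≤ Real.exp 1 := fun h' ↦ ht.2 ⟨not_le.1 h, h'⟩
      simp [tent_log_eq_zero_of_exp_le (not_le.1 this).le]
  have e1 : ∫ t in Real.exp (-1)..1, (t : ℂ) ^ (s - 1) • (tent (Real.log t) : ℂ) =
      1 / s - 1 / s ^ 2 + Complex.exp (-s) / s ^ 2 := by
    rw [intervalIntegral.integral_eq_sub_of_hasDerivAt
      (f := fun t : ℝ ↦ (t : ℂ) ^ s * (1 + (Real.log t : ℂ)) / s - (t : ℂ) ^ s / s ^ 2) ?_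
      (hI _ _ (Real.exp_pos _) he)]
    · rw [hpow]
      simp
    · intro t ht
      rw [uIcc_of_le he] at ht
      have h0 : 0 < t := (Real.exp_pos _).trans_le ht.1
      have hlog : Real.log t ≤ 0 := Real.log_nonpos h0.le ht.2
      have hlog' : -1 ≤ Real.log t := (Real.le_log_iff_exp_le h0).2 ht.1
      have ht' : tent (Real.log t) = 1 + Real.log t := by
        rw [tent, abs_of_nonpos hlog, max_eq_right (by linarith)]; ring
      refine ((((hd t h0).mul ((hl t h0).const_add 1)).div_const s).sub
        ((hd t h0).div_const (s ^ 2))).congr_deriv ?_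
      rw [ht', hmul t h0]
      push_cast
      simp only [smul_eq_mul]
      field_simp
      ring
  have e2 : ∫ t in 1..Real.exp 1, (t : ℂ) ^ (s - 1) • (tent (Real.log t) : ℂ) =
      Complex.exp s / s ^ 2 - 1 / s - 1 / s ^ 2 := by
    rw [intervalIntegral.integral_eq_sub_of_hasDerivAt
      (f := fun t : ℝ ↦ (t : ℂ) ^ s * (1 - (Real.log t : ℂ)) / s + (t : ℂ) ^ s / s ^ 2) ?_
      (hI _ _ one_pos he')]
    · rw [hpow]
      simp
      ring
    · intro t ht
      rw [uIcc_of_le he'] at ht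
      have h0 : 0 < t := one_pos.trans_le ht.1
      have hlog : 0 ≤ Real.log t := Real.log_nonneg ht.1
      have hlog' : Real.log t ≤ 1 := (Real.log_le_iff_le_exp h0).2 ht.2
      have ht' : tent (Real.log t) = 1 - Real.log t := by
        rw [tent, abs_of_nonneg hlog, max_eq_right (by linarith)]
      refine ((((hd t h0).mul ((hl t h0).const_sub 1)).div_const s).add
        ((hd t h0).div_const (s ^ 2))).congr_deriv ?_
      rw [ht', mul_neg, hmul t h0]
      push_cast
      simp only [smul_eq_mul]
      field_simp
      ring
  rw [h1, ← intervalIntegral.integral_add_adjacent_intervals (hI _ 1 (Real.exp_pos _) he)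
    (hI 1 _ one_pos he'), e1, e2]
  field_simp
  ring

theorem mellin_tent_log_ne_zero {s : ℂ} (hs : 0 < s.re) :
    mellin (fun t ↦ (tent (Real.log t) : ℂ)) s ≠ 0 := by
  have hs0 : s ≠ 0 := fun h ↦ by simp [h] at hs
  rw [mellin_tent_log hs0]
  refine div_ne_zero (fun h ↦ ?_) (pow_ne_zero 2 hs0)
  have h1 : Complex.exp s * Complex.exp (-s) = 1 := by rw [← Complex.exp_add]; simp
  have h2 : (Complex.exp s - 1) ^ 2 = 0 := by linear_combination (Complex.exp s) * h - h1
  have h3 : Complex.exp s = 1 := sub_eq_zero.1 (pow_eq_zero_iff two_ne_zero |>.1 h2)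
  have := congrArg (‖·‖) h3
  simp only [Complex.norm_exp, norm_one, Real.exp_eq_one_iff] at this
  exact hs.ne' this

section

variable {ι : Type*} {N : ι → ℝ}

theorem tsum_tent_eq_sum (hN : ∀ i, 1 ≤ N i) (hfin : ∀ x, {i | N i ≤ x}.Finite) {ε T : ℝ}
    (hε : 0 < ε) (hT : ε ≤ T) (f : ι → ℝ) :
    HasSum (fun i ↦ f i * tent (Real.log (N i * T)))
      (∑ i ∈ (hfin (Real.exp 1 / ε)).toFinset, f i * tent (Real.log (N i * T))) := by
  refine hasSum_sum_of_ne_finset_zero fun i hi ↦ ?_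
  simp only [Finite.mem_toFinset, mem_ofPred_eq, not_le] at hi
  rw [tent_log_eq_zero_of_exp_le, mul_zero]
  rw [div_lt_iff₀ hε] at hi
  exact hi.le.trans (mul_le_mul_of_nonneg_left hT (zero_le_one.trans (hN i)))

theorem summable_tent (hN : ∀ i, 1 ≤ N i) (hfin : ∀ x, {i | N i ≤ x}.Finite) {T : ℝ}
    (hT : 0 < T) : Summable fun i ↦ tent (Real.log (N i * T)) := by
  simpa using (tsum_tent_eq_sum hN hfin hT le_rfl fun _ ↦ 1).summable

theorem continuousOn_tsum_tent (hN : ∀ i, 1 ≤ N i) (hfin : ∀ x, {i | N i ≤ x}.Finite) :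
    ContinuousOn (fun T ↦ ∑' i, tent (Real.log (N i * T))) (Ioi 0) := by
  intro T (hT : 0 < T)
  refine ContinuousAt.continuousWithinAt ?_
  have hc : ContinuousAt (fun t ↦ ∑ i ∈ (hfin (Real.exp 1 / (T / 2))).toFinset,
      tent (Real.log (N i * t))) T := by
    refine tendsto_finsetSum _ fun i _ ↦ ?_
    refine continuous_tent.continuousAt.comp ?_
    refine (Real.continuousAt_log ?_).comp (f := fun t ↦ N i * t) (by fun_prop)
    exact (mul_pos (one_pos.trans_le (hN i)) hT).ne'
  refine hc.congr ?_
  filter_upwards [Ioi_mem_nhds (half_lt_self hT)] with t ht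
  have := (tsum_tent_eq_sum hN hfin (half_pos hT) (le_of_lt ht) fun _ ↦ 1).tsum_eq
  simp only [one_mul] at this
  exact this.symm

theorem tsum_tent_eq_zero (hN : ∀ i, 1 ≤ N i) {T : ℝ} (hT : Real.exp 1 ≤ T) :
    ∑' i, tent (Real.log (N i * T)) = 0 := by
  have : ∀ i, tent (Real.log (N i * T)) = 0 := fun i ↦ by
    refine tent_log_eq_zero_of_exp_le (hT.trans ?_)
    nlinarith [hN i, Real.exp_pos 1]
  simp [this]

theorem exists_continuation_tsum_cpow [Countable ι] (hN : ∀ i, 1 ≤ N i)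
    (hfin : ∀ x, {i | N i ≤ x}.Finite) {a c D δ : ℝ} (ha : 0 < a) (ha1 : a ≤ 1) (hc : 0 < c)
    (hδ : 0 < δ)
    (h : ∀ T, 0 < T → T ≤ δ → |T * ∑' i, tent (Real.log (N i * T)) - c| ≤ D * T ^ a) :
    ∃ G : ℂ → ℂ, DifferentiableOn ℂ G {s | 1 - a < s.re} ∧ G 1 ≠ 0 ∧
      ∀ s : ℂ, 1 < s.re → HasSum (fun i ↦ (N i : ℂ) ^ (-s)) (G s / (s - 1)) := by
  set g : ℝ → ℝ := fun T ↦ ∑' i, tent (Real.log (N i * T)) with hg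
  set W := mellin fun t ↦ (tent (Real.log t) : ℂ) with hW
  set I : ℝ → ℂ := indicator (Ioc 0 1) (fun t ↦ (t : ℂ) ^ (-1 : ℂ)) with hI
  have hI_bot : ∀ t ∈ Ioc (0 : ℝ) 1, I t = ((t⁻¹ : ℝ) : ℂ) := fun t ht ↦ by
    rw [hI, indicator_of_mem ht, Complex.cpow_neg_one, Complex.ofReal_inv]
  have hI_top : ∀ t, 1 < t → I t = 0 := fun t ht ↦
    indicator_of_notMem (fun h ↦ h.2.not_gt ht) _
  have hg_loc : LocallyIntegrableOn (fun t ↦ (g t : ℂ)) (Ioi 0) :=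
    (Complex.continuous_ofReal.comp_continuousOn
      (continuousOn_tsum_tent hN hfin)).locallyIntegrableOn measurableSet_Ioi
  have hI_loc : LocallyIntegrableOn I (Ioi 0) := by
    have hc : ContinuousOn (fun t : ℝ ↦ ((t⁻¹ : ℝ) : ℂ)) (Ioi 0) :=
      Complex.continuous_ofReal.comp_continuousOn
        (continuousOn_inv₀.mono fun t (ht : 0 < t) ↦ ht.ne')
    refine (hc.locallyIntegrableOn measurableSet_Ioi).mono ?_ ?_
    · refine AEStronglyMeasurable.indicator ?_ measurableSet_Ioc
      exact (Measurable.pow_const (by fun_prop) _).aestronglyMeasurable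
    · filter_upwards with t
      by_cases ht : t ∈ Ioc (0 : ℝ) 1
      · rw [hI_bot t ht]
      · rw [hI, indicator_of_notMem ht, norm_zero]; positivity
  have hg_top (b : ℝ) : (fun t ↦ (g t : ℂ)) =O[atTop] (fun t : ℝ ↦ t ^ b) := by
    refine (EventuallyEq.isBigO ?_).trans (isBigO_zero (E' := ℂ) _ _)
    filter_upwards [eventually_ge_atTop (Real.exp 1)] with t ht
    simp [hg, tsum_tent_eq_zero hN ht]
  have hh_top (b : ℝ) : (fun t ↦ (g t : ℂ) - c * I t) =O[atTop] (fun t : ℝ ↦ t ^ b) := by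
    refine (EventuallyEq.isBigO ?_).trans (isBigO_zero (E' := ℂ) _ _)
    filter_upwards [eventually_ge_atTop (Real.exp 1), eventually_gt_atTop 1] with t ht ht1
    simp [hg, tsum_tent_eq_zero hN ht, hI_top t ht1]
  have hh_bot : (fun t ↦ (g t : ℂ) - c * I t) =O[𝓝[>] 0] (fun t : ℝ ↦ t ^ (-(1 - a))) := by
    refine IsBigO.of_bound D ?_
    filter_upwards [Ioo_mem_nhdsGT (lt_min one_pos hδ)] with t ht
    have h0 : 0 < t := ht.1
    have h1 : t ≤ 1 := (ht.2.trans_le (min_le_left _ _)).le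
    rw [hI_bot t ⟨h0, h1⟩, ← Complex.ofReal_mul, ← Complex.ofReal_sub, Complex.norm_real,
      Real.norm_eq_abs, Real.norm_eq_abs, abs_of_pos (Real.rpow_pos_of_pos h0 _)]
    have e := h t h0 (ht.2.trans_le (min_le_right _ _)).le
    have e2 : g t - c * t⁻¹ = (t * g t - c) * t⁻¹ := by field_simp
    rw [e2, abs_mul, abs_of_pos (inv_pos.2 h0), neg_sub, Real.rpow_sub_one h0.ne', div_eq_mul_inv,
      ← mul_assoc]
    gcongr
  have hI_O : I =O[𝓝[>] 0] (fun t : ℝ ↦ t ^ (-1 : ℝ)) := by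
    refine (EventuallyEq.isBigO ?_).trans
      (isBigO_of_le (g := fun t : ℝ ↦ t ^ (-1 : ℝ)) (f := fun t : ℝ ↦ ((t⁻¹ : ℝ) : ℂ)) _
        fun t ↦ by simp [Real.rpow_neg_one])
    filter_upwards [Ioo_mem_nhdsGT one_pos] with t ht
    exact hI_bot t ⟨ht.1, ht.2.le⟩
  have hh_loc : LocallyIntegrableOn (fun t ↦ (g t : ℂ) - c * I t) (Ioi 0) := by
    refine hg_loc.sub ?_
    exact hI_loc.smul (c : ℂ)
  have hg_bot : (fun t ↦ (g t : ℂ)) =O[𝓝[>] 0] (fun t : ℝ ↦ t ^ (-1 : ℝ)) := by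
    have e1 : (fun t : ℝ ↦ t ^ (-(1 - a))) =O[𝓝[>] 0] (fun t : ℝ ↦ t ^ (-1 : ℝ)) := by
      refine IsBigO.of_bound 1 ?_
      filter_upwards [Ioo_mem_nhdsGT one_pos] with t ht
      have h0 : 0 < t := ht.1
      rw [one_mul, Real.norm_eq_abs, Real.norm_eq_abs, abs_of_pos (Real.rpow_pos_of_pos h0 _),
        abs_of_pos (Real.rpow_pos_of_pos h0 _)]
      exact Real.rpow_le_rpow_of_exponent_ge h0 ht.2.le (by linarith)
    simpa using (hh_bot.trans e1).add (hI_O.const_mul_left (c : ℂ))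
  refine ⟨fun s ↦ ((s - 1) * mellin (fun t ↦ (g t : ℂ) - c * I t) s + c) / W s, ?_, ?_, ?_⟩
  · intro s (hs : 1 - a < s.re)
    refine DifferentiableAt.differentiableWithinAt ?_
    refine DifferentiableAt.div ?_ (differentiable_mellin_tent_log s)
      (mellin_tent_log_ne_zero (by linarith))
    exact (((differentiableAt_id).sub_const 1).mul (mellin_differentiableAt_of_isBigO_rpow hh_loc
      (hh_top _) (lt_add_one s.re) hh_bot hs)).add_const _
  · simpa using ⟨hc.ne', mellin_tent_log_ne_zero (s := 1) (by simp)⟩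
  · intro s hs
    have hWs : W s ≠ 0 := mellin_tent_log_ne_zero (by linarith)
    have hs1 : s - 1 ≠ 0 := fun h ↦ by
      have := congrArg Complex.re h
      simp at this
      linarith
    have hgM : MellinConvergent (fun t ↦ (g t : ℂ)) s :=
      mellinConvergent_of_isBigO_rpow hg_loc (hg_top _) (lt_add_one s.re) hg_bot hs
    obtain ⟨hIM, hIM'⟩ := hasMellin_cpow_Ioc (-1) (s := s) (by simpa using hs)
    have hcI := hasMellin_const_smul hIM (c : ℂ)
    have hsub := (hasMellin_sub hgM hcI.1).2
    rw [hcI.2, hIM'] at hsub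
    have key : HasSum (fun i ↦ mellin (fun t ↦ (tent (Real.log (N i * t)) : ℂ)) s)
        (mellin (fun t ↦ (g t : ℂ)) s) := by
      have hsum : ∀ t : ℝ, 0 < t → HasSum (fun i ↦ tent (Real.log (N i * t))) (g t) :=
        fun t ht ↦ (summable_tent hN hfin ht).hasSum
      have hnorm (i : ι) (t : ℝ) : ‖(t : ℂ) ^ (s - 1) • (tent (Real.log (N i * t)) : ℂ)‖ =
          ‖(t : ℂ) ^ (s - 1)‖ * tent (Real.log (N i * t)) := by
        rw [norm_smul, Complex.norm_real, Real.norm_of_nonneg (tent_nonneg _)]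
      refine hasSum_integral_of_dominated_convergence
        (fun i t ↦ ‖(t : ℂ) ^ (s - 1) • (tent (Real.log (N i * t)) : ℂ)‖) ?_
        (fun i ↦ Eventually.of_forall fun t ↦ le_rfl) ?_ ?_ ?_
      · intro i
        refine ContinuousOn.aestronglyMeasurable ?_ measurableSet_Ioi
        refine ContinuousOn.smul (f := fun t : ℝ ↦ (t : ℂ) ^ (s - 1)) ?_ ?_
        · intro t (ht : 0 < t)
          exact ((Complex.continuousAt_ofReal_cpow_const _ _ (Or.inr ht.ne'))).continuousWithinAt
        · exact Complex.continuous_ofReal.comp_continuousOn (continuousOn_tent_log.comp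
            (by fun_prop) fun t ht ↦ mul_pos (one_pos.trans_le (hN i)) ht)
      · filter_upwards [ae_restrict_mem measurableSet_Ioi] with t ht
        simp_rw [hnorm]
        exact (hsum t ht).summable.mul_left _
      · refine (Integrable.norm hgM).congr ?_
        filter_upwards [ae_restrict_mem measurableSet_Ioi] with t ht
        simp_rw [hnorm, tsum_mul_left]
        rw [norm_smul, Complex.norm_real,
          Real.norm_of_nonneg (tsum_nonneg fun _ ↦ tent_nonneg _)]
      · filter_upwards [ae_restrict_mem measurableSet_Ioi] with t ht
        exact ((Complex.hasSum_ofReal.2 (hsum t ht))).const_smul _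
    have hcomp (i : ι) : mellin (fun t ↦ (tent (Real.log (N i * t)) : ℂ)) s =
        (N i : ℂ) ^ (-s) * W s :=
      mellin_comp_mul_left (fun t ↦ (tent (Real.log t) : ℂ)) s (one_pos.trans_le (hN i))
    simp_rw [hcomp] at key
    have key2 := key.div_const (W s)
    simp_rw [mul_div_cancel_right₀ _ hWs] at key2
    have : mellin (fun t ↦ (g t : ℂ) - c * I t) s =
        mellin (fun t ↦ (g t : ℂ)) s - c * (1 / (s + -1)) := hsub
    have e : ((s - 1) * mellin (fun t ↦ (g t : ℂ) - c * I t) s + c) / W s / (s - 1) =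
        mellin (fun t ↦ (g t : ℂ)) s / W s := by
      rw [this, ← sub_eq_add_neg]
      field_simp
      ring
    rw [e]
    exact key2

end

end

section

open NumberField nonZeroDivisors IsDedekindDomain

section

variable {P : Type*}

/-- The number whose prime factors are the `e`-images of the elements of a multiset. -/
def primeCode (e : P → ℕ) (M : Multiset P) : ℕ := (M.map e).prod

theorem coe_primeFactorsList_primeCode {e : P → ℕ} (he : ∀ x, (e x).Prime) (M : Multiset P) :
    ((primeCode e M).primeFactorsList : Multiset ℕ) = M.map e := by
  induction M using Quotient.inductionOn with
  | _ l =>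
    refine Multiset.coe_eq_coe.2 (Nat.primeFactorsList_unique ?_ ?_).symm
    · simp [primeCode]
    · simpa using fun x _ ↦ he x

theorem primeCode_ne_zero {e : P → ℕ} (he : ∀ x, (e x).Prime) (M : Multiset P) :
    primeCode e M ≠ 0 := by
  simpa [primeCode] using fun x _ ↦ (he x).ne_zero

/-- The completely multiplicative function on `ℕ` with prescribed values at primes. -/
noncomputable def multiplicativeExtension (f : ℕ → ℂ) : ℕ →*₀ ℂ where
  toFun n := if n = 0 then 0 else ((n.primeFactorsList : Multiset ℕ).map f).prod
  map_zero' := by simp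
  map_one' := by simp
  map_mul' a b := by
    rcases eq_or_ne a 0 with rfl | ha
    · simp
    rcases eq_or_ne b 0 with rfl | hb
    · simp
    have h : ((a * b).primeFactorsList : Multiset ℕ) = a.primeFactorsList + b.primeFactorsList :=
      Multiset.coe_eq_coe.2 (Nat.perm_primeFactorsList_mul ha hb)
    simp only [mul_eq_zero, ha, hb, or_self, if_false]
    rw [h, Multiset.map_add, Multiset.prod_add]

theorem multiplicativeExtension_apply (f : ℕ → ℂ) {n : ℕ} (hn : n ≠ 0) :
    multiplicativeExtension f n = ((n.primeFactorsList : Multiset ℕ).map f).prod := by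
  simp [multiplicativeExtension, hn]

theorem exp_tsum_log_eq_tsum_multiset [Countable P] (w : P → ℂ)
    (hs : Summable fun M : Multiset P ↦ ‖(M.map w).prod‖) :
    Complex.exp (∑' x, -Complex.log (1 - w x)) = ∑' M : Multiset P, (M.map w).prod := by
  obtain ⟨i, hi⟩ := Countable.exists_injective_nat P
  set e : P → ℕ := fun x ↦ Nat.nth Nat.Prime (i x) with he_def
  have he : Function.Injective e :=
    (Nat.nth_injective Nat.infinite_setOfPred_prime).comp hi
  have hp : ∀ x, (e x).Prime := fun x ↦ Nat.prime_nth_prime _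
  set f₀ : ℕ → ℂ := Function.extend e w 0
  have hf₀ : f₀ ∘ e = w := funext fun x ↦ he.extend_apply _ _ _
  have hf₀' : ∀ n, f₀ n ≠ 0 → ∃ x, e x = n := fun n hn ↦ by
    by_contra h
    exact hn (Function.extend_apply' _ _ _ h)
  set F := multiplicativeExtension f₀
  have hF (M : Multiset P) : F (primeCode e M) = (M.map w).prod := by
    rw [multiplicativeExtension_apply _ (primeCode_ne_zero hp M),
      coe_primeFactorsList_primeCode hp, Multiset.map_map, hf₀]
  have hinj : Function.Injective (primeCode e) := fun M M' h ↦ by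
    have := coe_primeFactorsList_primeCode hp M
    rw [h, coe_primeFactorsList_primeCode hp M'] at this
    exact (Multiset.map_injective he this).symm
  have hsupp : ∀ n ∉ Set.range (primeCode e), F n = 0 := by
    intro n hn
    by_contra h
    have hn0 : n ≠ 0 := fun h0 ↦ h (by rw [h0, map_zero])
    rw [multiplicativeExtension_apply _ hn0, Multiset.prod_eq_zero_iff] at h
    have hall : ∀ q ∈ (n.primeFactorsList : Multiset ℕ), ∃ x, e x = q := fun q hq ↦
      hf₀' q fun h0 ↦ h (Multiset.mem_map.2 ⟨q, hq, h0⟩)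
    choose g hg using hall
    refine hn ⟨(n.primeFactorsList : Multiset ℕ).pmap (fun q hq ↦ g q hq) fun _ h ↦ h, ?_⟩
    rw [primeCode, Multiset.map_pmap]
    simp only [hg, Multiset.pmap_eq_map, Multiset.map_id', Multiset.prod_coe]
    exact Nat.prod_primeFactorsList hn0
  have hsF : Summable (‖F ·‖) := by
    refine (hinj.summable_iff (f := fun n ↦ ‖F n‖) fun n hn ↦ by simp [hsupp n hn]).1 ?_
    simpa [Function.comp_def, hF] using hs
  have h1 : ∑' n, F n = ∑' M : Multiset P, (M.map w).prod := by
    rw [← hinj.tsum_eq (f := F) fun n hn ↦ by_contra fun h ↦ hn (hsupp n h)]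
    simp [hF]
  have hFe (x : P) : F (e x) = w x := by simpa [primeCode] using hF {x}
  rw [← h1, ← EulerProduct.exp_tsum_primes_log_eq_tsum hsF]
  set e' : P → Nat.Primes := fun x ↦ ⟨e x, hp x⟩
  have he' : Function.Injective e' := fun x y h ↦ he (congrArg Subtype.val h)
  rw [← he'.tsum_eq (f := fun p : Nat.Primes ↦ -Complex.log (1 - F p))]
  · simp [e', hFe]
  · intro p hp'
    by_contra h
    have : F p = 0 := by
      rw [multiplicativeExtension_apply _ p.2.ne_zero, Nat.primeFactorsList_prime p.2]
      by_contra h0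
      obtain ⟨x, hx⟩ := hf₀' p (by simpa using h0)
      exact h ⟨x, Subtype.ext hx⟩
    simp [this] at hp'

end

theorem injective_heightOneSpectrum (R : Type*) [CommRing R] [IsDedekindDomain R] :
    Function.Injective fun P : HeightOneSpectrum R ↦
      (⟨P.asIdeal, mem_nonZeroDivisors_of_ne_zero P.ne_bot⟩ : (Ideal R)⁰) :=
  fun _ _ h ↦ HeightOneSpectrum.ext (congrArg Subtype.val h)

section

variable (K : Type*) [Field K] [NumberField K]

instance : Countable (Ideal (𝓞 K))⁰ := by
  rw [← Set.countable_univ_iff]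
  have : (Set.univ : Set (Ideal (𝓞 K))⁰) =
      ⋃ n : ℕ, {I : (Ideal (𝓞 K))⁰ | (Ideal.absNorm (I : Ideal (𝓞 K)) : ℝ) ≤ n} := by
    refine (Set.eq_univ_of_forall fun I ↦ Set.mem_iUnion.2 ?_).symm
    exact ⟨Ideal.absNorm (I : Ideal (𝓞 K)),
      Set.mem_ofPred.2 (le_refl (Ideal.absNorm (I : Ideal (𝓞 K)) : ℝ))⟩
  rw [this]
  exact Set.countable_iUnion fun n ↦ (finite_absNorm_le K n).countable

theorem one_le_absNorm (I : (Ideal (𝓞 K))⁰) : (1 : ℝ) ≤ Ideal.absNorm (I : Ideal (𝓞 K)) := by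
  have : Ideal.absNorm (I : Ideal (𝓞 K)) ≠ 0 := Ideal.absNorm_ne_zero_iff_mem_nonZeroDivisors.2 I.2
  exact_mod_cast Nat.one_le_iff_ne_zero.2 this

instance : Countable (HeightOneSpectrum (𝓞 K)) := (injective_heightOneSpectrum (𝓞 K)).countable

theorem bijective_multiset_heightOneSpectrum :
    Function.Bijective fun M : Multiset (HeightOneSpectrum (𝓞 K)) ↦
      (M.map fun P ↦
        (⟨P.asIdeal, mem_nonZeroDivisors_of_ne_zero P.ne_bot⟩ : (Ideal (𝓞 K))⁰)).prod := by
  classical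
  have hcoe (M : Multiset (HeightOneSpectrum (𝓞 K))) :
      (((M.map fun P ↦ (⟨P.asIdeal, mem_nonZeroDivisors_of_ne_zero P.ne_bot⟩ :
        (Ideal (𝓞 K))⁰)).prod : (Ideal (𝓞 K))⁰) : Ideal (𝓞 K)) =
        (M.map HeightOneSpectrum.asIdeal).prod := by
    rw [Submonoid.coe_multiset_prod, Multiset.map_map]; rfl
  constructor
  · intro M M' h
    have h' := congrArg (fun I : (Ideal (𝓞 K))⁰ ↦
      UniqueFactorizationMonoid.normalizedFactors (I : Ideal (𝓞 K))) h
    simp only [hcoe] at h'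
    rw [UniqueFactorizationMonoid.normalizedFactors_prod_of_prime,
      UniqueFactorizationMonoid.normalizedFactors_prod_of_prime] at h'
    · exact Multiset.map_injective (fun _ _ ↦ HeightOneSpectrum.ext) h'
    all_goals
      intro p hp
      obtain ⟨P, -, rfl⟩ := Multiset.mem_map.1 hp
      exact P.prime
  · intro I
    have hI : (I : Ideal (𝓞 K)) ≠ 0 := nonZeroDivisors.ne_zero I.2
    have hall : ∀ q ∈ UniqueFactorizationMonoid.normalizedFactors (I : Ideal (𝓞 K)),
        ∃ P : HeightOneSpectrum (𝓞 K), P.asIdeal = q := fun q hq ↦ by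
      have := UniqueFactorizationMonoid.prime_of_normalized_factor q hq
      exact ⟨⟨q, Ideal.isPrime_of_prime this, this.ne_zero⟩, rfl⟩
    choose g hg using hall
    refine ⟨(UniqueFactorizationMonoid.normalizedFactors (I : Ideal (𝓞 K))).pmap
      (fun q hq ↦ g q hq) fun _ h ↦ h, Subtype.ext ?_⟩
    simp only [hcoe]
    rw [Multiset.map_pmap]
    simp only [hg, Multiset.pmap_eq_map, Multiset.map_id']
    exact Ideal.prod_normalizedFactors_eq_self hI

theorem exp_tsum_log_eq_tsum_absNorm {s : ℂ}
    (hs : Summable fun I : (Ideal (𝓞 K))⁰ ↦ ((Ideal.absNorm (I : Ideal (𝓞 K)) : ℝ) : ℂ) ^ (-s)) :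
    Complex.exp (∑' P : HeightOneSpectrum (𝓞 K),
      -Complex.log (1 - ((Ideal.absNorm P.asIdeal : ℝ) : ℂ) ^ (-s))) =
      ∑' I : (Ideal (𝓞 K))⁰, ((Ideal.absNorm (I : Ideal (𝓞 K)) : ℝ) : ℂ) ^ (-s) := by
  set b := Equiv.ofBijective _ (bijective_multiset_heightOneSpectrum K) with hb
  have key (M : Multiset (HeightOneSpectrum (𝓞 K))) :
      ((Ideal.absNorm (b M : Ideal (𝓞 K)) : ℝ) : ℂ) ^ (-s) =
        (M.map fun P : HeightOneSpectrum (𝓞 K) ↦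
          ((Ideal.absNorm P.asIdeal : ℝ) : ℂ) ^ (-s)).prod := by
    rw [hb, Equiv.ofBijective_apply]
    induction M using Multiset.induction_on with
    | empty => simp
    | cons P M ih =>
      rw [Multiset.map_cons, Multiset.prod_cons, Multiset.map_cons, Multiset.prod_cons, ← ih,
        Submonoid.coe_mul, map_mul, Nat.cast_mul, Complex.ofReal_mul,
        Complex.mul_cpow_ofReal_nonneg (Nat.cast_nonneg _) (Nat.cast_nonneg _)]
  rw [exp_tsum_log_eq_tsum_multiset, ← b.tsum_eq]
  · simp only [key]
  · simp only [← key]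
    exact (b.summable_iff (f := fun I : (Ideal (𝓞 K))⁰ ↦
      ‖((Ideal.absNorm (I : Ideal (𝓞 K)) : ℝ) : ℂ) ^ (-s)‖)).2 hs.norm

theorem exists_continuation_zeta :
    ∃ a : ℝ, 0 < a ∧ a ≤ 1 ∧ ∃ G : ℂ → ℂ, DifferentiableOn ℂ G {s | 1 - a < s.re} ∧ G 1 ≠ 0 ∧
      ∀ s : ℂ, 1 < s.re →
        HasSum (fun I : (Ideal (𝓞 K))⁰ ↦ ((Ideal.absNorm (I : Ideal (𝓞 K)) : ℝ) : ℂ) ^ (-s))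
          (G s / (s - 1)) := by
  obtain ⟨c, D, δ, hc, hδ, h⟩ := tsum_ideal K
  have hr : 0 < Module.finrank ℚ K := Module.finrank_pos
  have ha : (0 : ℝ) < (Module.finrank ℚ K : ℝ)⁻¹ := inv_pos.2 (Nat.cast_pos.2 hr)
  have ha1 : (Module.finrank ℚ K : ℝ)⁻¹ ≤ 1 := inv_le_one_of_one_le₀ (Nat.one_le_cast.2 hr)
  exact ⟨_, ha, ha1, exists_continuation_tsum_cpow (one_le_absNorm K) (finite_absNorm_le K) ha ha1
    hc hδ h⟩

end

end

section

open NumberField nonZeroDivisors IsDedekindDomain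

theorem summable_comp_of_card_fiber_le {ι : Type*} {f : ι → ℕ} {n : ℕ}
    (hf : ∀ (m : ℕ) (T : Finset ι), (∀ i ∈ T, f i = m) → T.card ≤ n) {u : ℕ → ℝ} (hu : Summable u)
    (hu0 : ∀ m, 0 ≤ u m) : Summable fun i ↦ u (f i) := by
  classical
  refine summable_of_sum_le (c := n * ∑' m, u m) (fun i ↦ hu0 _) fun s ↦ ?_
  rw [Finset.sum_comp, ← tsum_mul_left]
  refine (Finset.sum_le_sum fun m _ ↦ ?_).trans
    ((hu.mul_left (n : ℝ)).sum_le_tsum (s.image f) fun m _ ↦ mul_nonneg n.cast_nonneg (hu0 m))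
  rw [nsmul_eq_mul]
  have := hf m {i ∈ s | f i = m} fun i hi ↦ (Finset.mem_filter.1 hi).2
  gcongr
  exact hu0 m

section

variable {K : Type*} [Field K] [NumberField K]

theorem absNorm_dvd_of_natCast_mem (P : HeightOneSpectrum (𝓞 K)) {q : ℕ}
    (hP : (q : 𝓞 K) ∈ P.asIdeal) :
    Ideal.absNorm P.asIdeal ∣ q ^ Module.finrank ℚ K := by
  have h := Ideal.absNorm_dvd_absNorm_of_le ((Ideal.span_singleton_le_iff_mem _).2 hP)
  rw [Ideal.absNorm_span_singleton] at h
  have hn : Algebra.norm ℤ (q : 𝓞 K) = (q : ℤ) ^ Module.finrank ℚ K := by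
    rw [← RingOfIntegers.rank]
    simpa using Algebra.norm_algebraMap (S := 𝓞 K) (q : ℤ)
  rw [hn] at h
  simpa [Int.natAbs_pow] using h

theorem exists_prime_natCast_mem (P : HeightOneSpectrum (𝓞 K)) :
    ∃ q k : ℕ, q.Prime ∧ (q : 𝓞 K) ∈ P.asIdeal ∧ k ≠ 0 ∧ Ideal.absNorm P.asIdeal = q ^ k := by
  have hne : Ideal.absNorm P.asIdeal ≠ 0 := by
    simpa [Ideal.absNorm_eq_zero_iff] using P.ne_bot
  have h1 : Ideal.absNorm P.asIdeal ≠ 1 := by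
    simpa [Ideal.absNorm_eq_one_iff] using P.isPrime.ne_top
  have hmem : (((Ideal.absNorm P.asIdeal).primeFactorsList : Multiset ℕ).map
      (Nat.cast : ℕ → 𝓞 K)).prod ∈ P.asIdeal := by
    rw [Multiset.map_coe, Multiset.prod_coe, ← Nat.cast_list_prod, Nat.prod_primeFactorsList hne]
    exact Ideal.absNorm_mem _
  obtain ⟨x, hx, hxP⟩ := (P.isPrime.multiset_prod_mem_iff_exists_mem _).1 hmem
  obtain ⟨q, hq, rfl⟩ := Multiset.mem_map.1 hx
  have hqp := Nat.prime_of_mem_primeFactorsList hq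
  obtain ⟨k, -, hk⟩ := (Nat.dvd_prime_pow hqp).1 (absNorm_dvd_of_natCast_mem P hxP)
  exact ⟨q, k, hqp, hxP, fun h ↦ h1 (by rw [hk, h, pow_zero]), hk⟩

/-- The rational prime below a nonzero prime ideal. -/
noncomputable def primeBelow (P : HeightOneSpectrum (𝓞 K)) : ℕ :=
  (exists_prime_natCast_mem P).choose

theorem primeBelow_spec (P : HeightOneSpectrum (𝓞 K)) :
    ∃ k : ℕ, (primeBelow P).Prime ∧ (primeBelow P : 𝓞 K) ∈ P.asIdeal ∧ k ≠ 0 ∧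
      Ideal.absNorm P.asIdeal = primeBelow P ^ k :=
  (exists_prime_natCast_mem P).choose_spec

theorem card_le_of_primeBelow_eq (q : ℕ) (T : Finset (HeightOneSpectrum (𝓞 K)))
    (hT : ∀ P ∈ T, primeBelow P = q) : T.card ≤ Module.finrank ℚ K := by
  rcases T.eq_empty_or_nonempty with rfl | ⟨P₀, hP₀⟩
  · simp
  have hq : q.Prime := by
    obtain ⟨k, h, -⟩ := primeBelow_spec P₀
    rwa [hT P₀ hP₀] at h
  have hdvd : ∏ P ∈ T, P.asIdeal ∣ Ideal.span {(q : 𝓞 K)} := by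
    refine Finset.prod_dvd_of_isRelPrime ?_ ?_
    · intro P hP Q hQ hPQ
      exact (P.irreducible.isRelPrime_iff_not_dvd).2 fun h ↦ hPQ <| HeightOneSpectrum.ext <|
        associated_iff_eq.1 ((Irreducible.dvd_irreducible_iff_associated P.irreducible
          Q.irreducible).1 h)
    · intro P hP
      obtain ⟨k, -, h, -⟩ := primeBelow_spec P
      rw [Ideal.dvd_span_singleton]
      rwa [hT P hP] at h
  have h := Ideal.absNorm_dvd_absNorm_of_le (Ideal.le_of_dvd hdvd)
  rw [Ideal.absNorm_span_singleton, map_prod] at h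
  have hn : Algebra.norm ℤ (q : 𝓞 K) = (q : ℤ) ^ Module.finrank ℚ K := by
    rw [← RingOfIntegers.rank]
    simpa using Algebra.norm_algebraMap (S := 𝓞 K) (q : ℤ)
  rw [hn, Int.natAbs_pow, Int.natAbs_natCast] at h
  have h2 : q ^ T.card ∣ ∏ P ∈ T, Ideal.absNorm P.asIdeal := by
    rw [← Finset.prod_const]
    refine Finset.prod_dvd_prod_of_dvd _ _ fun P hP ↦ ?_
    obtain ⟨k, -, -, hk, h⟩ := primeBelow_spec P
    rw [h, hT P hP]
    exact dvd_pow_self _ hk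
  exact (Nat.pow_dvd_pow_iff_le_right hq.one_lt).1 (h2.trans h)

theorem primeBelow_eq_of_prime {P : HeightOneSpectrum (𝓞 K)} (h : (Ideal.absNorm P.asIdeal).Prime) :
    primeBelow P = Ideal.absNorm P.asIdeal := by
  obtain ⟨k, hq, -, hk, e⟩ := primeBelow_spec P
  rw [e] at h ⊢
  rw [Nat.Prime.eq_one_of_pow h, pow_one]

variable (K) in
/-- Prime ideals of degree one over the rationals. -/
abbrev DegreeOnePrime : Type _ :=
  {P : HeightOneSpectrum (𝓞 K) // (Ideal.absNorm P.asIdeal).Prime}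

theorem card_degreeOnePrime_le (q : ℕ) (T : Finset (DegreeOnePrime K))
    (hT : ∀ P ∈ T, Ideal.absNorm P.1.asIdeal = q) : T.card ≤ Module.finrank ℚ K := by
  rw [← Finset.card_map (Function.Embedding.subtype _)]
  refine card_le_of_primeBelow_eq q _ fun P hP ↦ ?_
  obtain ⟨Q, hQ, rfl⟩ := Finset.mem_map.1 hP
  exact (primeBelow_eq_of_prime Q.2).trans (hT Q hQ)

theorem norm_absNorm_cpow (P : HeightOneSpectrum (𝓞 K)) (s : ℂ) :
    ‖((Ideal.absNorm P.asIdeal : ℝ) : ℂ) ^ (-s)‖ = (Ideal.absNorm P.asIdeal : ℝ) ^ (-s.re) := by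
  have : (0 : ℝ) < Ideal.absNorm P.asIdeal := by
    obtain ⟨k, hq, -, -, h⟩ := primeBelow_spec P
    rw [h]
    exact_mod_cast pow_pos hq.pos k
  rw [Complex.norm_cpow_eq_rpow_re_of_pos this, Complex.neg_re]

/-- Contribution to the logarithm of the Euler factor beyond the linear term at a
degree one prime. -/
noncomputable def eulerRemainder (P : HeightOneSpectrum (𝓞 K)) (s : ℂ) : ℂ :=
  -Complex.log (1 - ((Ideal.absNorm P.asIdeal : ℝ) : ℂ) ^ (-s)) -
    {P : HeightOneSpectrum (𝓞 K) | (Ideal.absNorm P.asIdeal).Prime}.indicator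
      (fun P ↦ ((Ideal.absNorm P.asIdeal : ℝ) : ℂ) ^ (-s)) P

theorem two_rpow_neg_lt_one : (2 : ℝ) ^ (-(3 / 4) : ℝ) < 1 :=
  Real.rpow_lt_one_of_one_lt_of_neg one_lt_two (by norm_num)

theorem norm_absNorm_cpow_le (P : HeightOneSpectrum (𝓞 K)) {s : ℂ} (hs : 3 / 4 < s.re) :
    ‖((Ideal.absNorm P.asIdeal : ℝ) : ℂ) ^ (-s)‖ ≤ (2 : ℝ) ^ (-(3 / 4) : ℝ) := by
  obtain ⟨k, hq, -, hk, h⟩ := primeBelow_spec P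
  have h2 : (2 : ℝ) ≤ Ideal.absNorm P.asIdeal := by
    rw [h]
    exact_mod_cast hq.two_le.trans (Nat.le_self_pow hk _)
  rw [norm_absNorm_cpow]
  calc (Ideal.absNorm P.asIdeal : ℝ) ^ (-s.re) ≤ (Ideal.absNorm P.asIdeal : ℝ) ^ (-(3 / 4) : ℝ) :=
        Real.rpow_le_rpow_of_exponent_le (by linarith) (by linarith)
    _ ≤ _ := Real.rpow_le_rpow_of_nonpos two_pos h2 (by norm_num)

theorem norm_eulerRemainder_le (P : HeightOneSpectrum (𝓞 K)) {s : ℂ} (hs : 3 / 4 < s.re) :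
    ‖eulerRemainder P s‖ ≤
      (1 + (1 - (2 : ℝ) ^ (-(3 / 4) : ℝ))⁻¹ / 2) * (primeBelow P : ℝ) ^ (-(3 / 2) : ℝ) := by
  set C := (1 - (2 : ℝ) ^ (-(3 / 4) : ℝ))⁻¹
  have hz' := norm_absNorm_cpow_le P hs
  have hn := norm_absNorm_cpow P s
  obtain ⟨k, hq, -, hk, h⟩ := primeBelow_spec P
  unfold eulerRemainder
  set z := ((Ideal.absNorm P.asIdeal : ℝ) : ℂ) ^ (-s) with hz_def
  have hz : ‖-z‖ < 1 := by rw [norm_neg]; exact hz'.trans_lt two_rpow_neg_lt_one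
  have hC : (1 - ‖-z‖)⁻¹ ≤ C := by
    rw [norm_neg]
    exact inv_anti₀ (sub_pos.2 two_rpow_neg_lt_one) (by linarith)
  have hC0 : 0 < C := inv_pos.2 (sub_pos.2 two_rpow_neg_lt_one)
  have hq1 : (1 : ℝ) < primeBelow P := by exact_mod_cast hq.one_lt
  have hq0 : (0 : ℝ) < primeBelow P := by linarith
  have hpow : (0 : ℝ) < (primeBelow P : ℝ) ^ (-(3 / 2) : ℝ) := Real.rpow_pos_of_pos hq0 _
  have hnk : ‖z‖ = (primeBelow P : ℝ) ^ (-(k * s.re)) := by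
    rw [hn, h]
    push_cast
    rw [← Real.rpow_natCast, ← Real.rpow_mul hq0.le, mul_neg]
  by_cases hk1 : k = 1
  · subst hk1
    have hP : P ∈ {P : HeightOneSpectrum (𝓞 K) | (Ideal.absNorm P.asIdeal).Prime} := by
      rw [Set.mem_ofPred_eq, h, pow_one]; exact hq
    rw [Set.indicator_of_mem hP, ← hz_def]
    have e := Complex.norm_log_one_add_sub_self_le hz
    rw [← norm_neg]
    have e1 : -(-Complex.log (1 - z) - z) = Complex.log (1 + -z) - -z := by ring_nf
    rw [e1]
    have e2 : ‖z‖ ^ 2 ≤ (primeBelow P : ℝ) ^ (-(3 / 2) : ℝ) := by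
      rw [hnk, ← Real.rpow_natCast, ← Real.rpow_mul hq0.le]
      exact Real.rpow_le_rpow_of_exponent_le hq1.le (by push_cast; linarith)
    rw [norm_neg z] at e hC
    have hz0 : 0 ≤ (1 - ‖z‖)⁻¹ := inv_nonneg.2 (by linarith [norm_neg z])
    calc _ ≤ ‖z‖ ^ 2 * (1 - ‖z‖)⁻¹ / 2 := e
      _ ≤ (primeBelow P : ℝ) ^ (-(3 / 2) : ℝ) * C / 2 := by gcongr
      _ ≤ _ := by nlinarith
  · have hP : P ∉ {P : HeightOneSpectrum (𝓞 K) | (Ideal.absNorm P.asIdeal).Prime} := by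
      rw [Set.mem_ofPred_eq, h]
      exact fun hh ↦ hk1 (Nat.Prime.eq_one_of_pow hh)
    rw [Set.indicator_of_notMem hP, sub_zero, norm_neg, sub_eq_add_neg]
    have e := Complex.norm_log_one_add_le hz
    rw [norm_neg z] at e hC hz
    have hk2 : (2 : ℝ) ≤ k := by exact_mod_cast (by omega : 2 ≤ k)
    have e2 : ‖z‖ ≤ (primeBelow P : ℝ) ^ (-(3 / 2) : ℝ) := by
      rw [hnk]
      exact Real.rpow_le_rpow_of_exponent_le hq1.le (by nlinarith)
    have e3 : ‖z‖ ^ 2 ≤ ‖z‖ := by nlinarith [norm_nonneg z]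
    calc _ ≤ ‖z‖ ^ 2 * (1 - ‖z‖)⁻¹ / 2 + ‖z‖ := e
      _ ≤ (primeBelow P : ℝ) ^ (-(3 / 2) : ℝ) * C / 2 + (primeBelow P : ℝ) ^ (-(3 / 2) : ℝ) := by
        gcongr
        exact e3.trans e2
      _ = _ := by ring

theorem summable_primeBelow_rpow :
    Summable fun P : HeightOneSpectrum (𝓞 K) ↦ (primeBelow P : ℝ) ^ (-(3 / 2) : ℝ) :=
  summable_comp_of_card_fiber_le (card_le_of_primeBelow_eq (K := K))
    (Real.summable_nat_rpow.2 (by norm_num)) fun m ↦ by positivity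

theorem differentiableAt_absNorm_cpow (P : HeightOneSpectrum (𝓞 K)) (s : ℂ) :
    DifferentiableAt ℂ (fun s : ℂ ↦ ((Ideal.absNorm P.asIdeal : ℝ) : ℂ) ^ (-s)) s := by
  refine DifferentiableAt.const_cpow (by fun_prop) (Or.inl ?_)
  obtain ⟨k, hq, -, -, h⟩ := primeBelow_spec P
  rw [h]
  exact_mod_cast (pow_pos hq.pos k).ne'

theorem differentiableOn_tsum_eulerRemainder :
    DifferentiableOn ℂ (fun s ↦ ∑' P : HeightOneSpectrum (𝓞 K), eulerRemainder P s)
      {s | 3 / 4 < s.re} := by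
  refine Complex.differentiableOn_tsum_of_summable_norm
    (summable_primeBelow_rpow.mul_left (1 + (1 - (2 : ℝ) ^ (-(3 / 4) : ℝ))⁻¹ / 2)) ?_
    (isOpen_lt continuous_const Complex.continuous_re) fun P s hs ↦ norm_eulerRemainder_le P hs
  intro P s (hs : 3 / 4 < s.re)
  refine DifferentiableAt.differentiableWithinAt ?_
  have hd := differentiableAt_absNorm_cpow P s
  unfold eulerRemainder
  refine DifferentiableAt.sub ((DifferentiableAt.clog (hd.const_sub 1) ?_).neg) ?_
  · rw [sub_eq_add_neg]
    refine Complex.mem_slitPlane_of_norm_lt_one ?_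
    rw [norm_neg]
    exact (norm_absNorm_cpow_le P hs).trans_lt two_rpow_neg_lt_one
  · by_cases hP : P ∈ {P : HeightOneSpectrum (𝓞 K) | (Ideal.absNorm P.asIdeal).Prime}
    · simpa only [Set.indicator_of_mem hP] using hd
    · simp only [Set.indicator_of_notMem hP]
      exact differentiableAt_const _

variable (K) in
theorem exists_exp_tsum_degreeOnePrime :
    ∃ σ : ℝ, σ < 1 ∧ ∃ F : ℂ → ℂ, DifferentiableOn ℂ F {s | σ < s.re} ∧ F 1 ≠ 0 ∧
      ∀ s : ℂ, 1 < s.re →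
        Summable (fun P : DegreeOnePrime K ↦ ((Ideal.absNorm P.1.asIdeal : ℝ) : ℂ) ^ (-s)) ∧
        Complex.exp (∑' P : DegreeOnePrime K, ((Ideal.absNorm P.1.asIdeal : ℝ) : ℂ) ^ (-s)) =
          F s / (s - 1) := by
  obtain ⟨a, ha, -, G, hG, hG1, h⟩ := exists_continuation_zeta K
  refine ⟨max (3 / 4) (1 - a), max_lt (by norm_num) (by linarith),
    fun s ↦ G s * Complex.exp (-∑' P : HeightOneSpectrum (𝓞 K), eulerRemainder P s), ?_, ?_, ?_⟩
  · refine (hG.mono fun s (hs : max _ _ < s.re) ↦ ?_).mul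
      ((differentiableOn_tsum_eulerRemainder (K := K)).mono fun s (hs : max _ _ < s.re) ↦ ?_).neg.cexp
    · exact (le_max_right _ _).trans_lt hs
    · exact (le_max_left _ _).trans_lt hs
  · exact mul_ne_zero hG1 (Complex.exp_ne_zero _)
  · intro s hs
    have hI := h s hs
    have hP : Summable fun P : HeightOneSpectrum (𝓞 K) ↦
        ((Ideal.absNorm P.asIdeal : ℝ) : ℂ) ^ (-s) := by
      have := hI.summable.comp_injective (injective_heightOneSpectrum (𝓞 K))
      simpa only [Function.comp_def] using this
    have hD := hP.subtype {P : HeightOneSpectrum (𝓞 K) | (Ideal.absNorm P.asIdeal).Prime}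
    refine ⟨hD, ?_⟩
    have hlog := hP.clog_one_sub.neg
    have hind := hP.indicator {P : HeightOneSpectrum (𝓞 K) | (Ideal.absNorm P.asIdeal).Prime}
    have hts : ∑' P : HeightOneSpectrum (𝓞 K), eulerRemainder P s =
        (∑' P : HeightOneSpectrum (𝓞 K),
          -Complex.log (1 - ((Ideal.absNorm P.asIdeal : ℝ) : ℂ) ^ (-s))) -
        ∑' P : DegreeOnePrime K, ((Ideal.absNorm P.1.asIdeal : ℝ) : ℂ) ^ (-s) := by
      unfold eulerRemainder
      rw [hlog.tsum_sub hind]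
      congr 1
      exact (tsum_subtype {P : HeightOneSpectrum (𝓞 K) | (Ideal.absNorm P.asIdeal).Prime} _).symm
    have hexp := exp_tsum_log_eq_tsum_absNorm K hI.summable
    rw [hI.tsum_eq] at hexp
    dsimp only
    rw [hts, neg_sub, Complex.exp_sub, hexp]
    have hs1 : s - 1 ≠ 0 := fun h0 ↦ by
      have := congrArg Complex.re h0
      simp at this
      linarith
    have hG0 : G s ≠ 0 := fun h0 ↦ by
      rw [h0, zero_div] at hexp
      exact Complex.exp_ne_zero _ hexp
    field_simp

end

end

section

open Filter Topology Set

theorem re_ofReal_cpow_neg {x : ℝ} (hx : 0 < x) (s : ℂ) :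
    ((x : ℂ) ^ (-s)).re = x ^ (-s.re) * Real.cos (s.im * Real.log x) := by
  rw [Complex.cpow_def_of_ne_zero (by exact_mod_cast hx.ne'), ← Complex.ofReal_log hx.le,
    Complex.exp_re, Real.rpow_def_of_pos hx]
  simp only [Complex.mul_re, Complex.mul_im, Complex.neg_re, Complex.neg_im, Complex.ofReal_re,
    Complex.ofReal_im, zero_mul, sub_zero, add_zero]
  rw [← Real.cos_neg (s.im * Real.log x)]
  ring_nf

theorem zero_le_three_add_four_cos (θ : ℝ) : 0 ≤ 3 + 4 * Real.cos θ + Real.cos (2 * θ) := by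
  rw [Real.cos_two_mul]
  nlinarith [sq_nonneg (1 + Real.cos θ)]

section

variable {ι : Type*} {N : ι → ℝ} {σ : ℝ} {F : ℂ → ℂ}

theorem one_le_norm_exp_tsum_cpow (hN : ∀ i, 1 ≤ N i) {x : ℝ} (t : ℝ)
    (hs : ∀ s : ℂ, s.re = x → Summable fun i ↦ (N i : ℂ) ^ (-s)) :
    1 ≤ ‖Complex.exp (∑' i, (N i : ℂ) ^ (-(x : ℂ)))‖ ^ 3 *
      ‖Complex.exp (∑' i, (N i : ℂ) ^ (-(x + t * Complex.I)))‖ ^ 4 *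
      ‖Complex.exp (∑' i, (N i : ℂ) ^ (-(x + (2 * t : ℝ) * Complex.I)))‖ := by
  have h0 := hs x (by simp)
  have h1 := hs (x + t * Complex.I) (by simp)
  have h2 := hs (x + (2 * t : ℝ) * Complex.I) (by simp)
  simp only [Complex.norm_exp, ← Real.exp_nat_mul, ← Real.exp_add]
  rw [Real.one_le_exp_iff]
  have e0 := Complex.hasSum_re h0.hasSum
  have e1 := Complex.hasSum_re h1.hasSum
  have e2 := Complex.hasSum_re h2.hasSum
  refine ((e0.mul_left ((3 : ℕ) : ℝ)).add (e1.mul_left ((4 : ℕ) : ℝ)) |>.add e2).nonneg fun i ↦ ?_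
  have hi : 0 < N i := one_pos.trans_le (hN i)
  have e (u : ℝ) : ((N i : ℂ) ^ (-(x + u * Complex.I))).re =
      N i ^ (-x) * Real.cos (u * Real.log (N i)) := by
    simpa using re_ofReal_cpow_neg hi (x + u * Complex.I)
  have e' : ((N i : ℂ) ^ (-(x : ℂ))).re = N i ^ (-x) := by simpa using e 0
  rw [e, e, e']
  have := mul_nonneg (Real.rpow_nonneg hi.le (-x)) (zero_le_three_add_four_cos (t * Real.log (N i)))
  push_cast
  rw [mul_assoc]
  linarith

theorem ne_zero_of_exp_tsum_cpow (hN : ∀ i, 1 ≤ N i) (hσ : σ < 1)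
    (hF : DifferentiableOn ℂ F {s | σ < s.re}) (hF1 : F 1 ≠ 0)
    (h : ∀ s : ℂ, 1 < s.re → Summable (fun i ↦ (N i : ℂ) ^ (-s)) ∧
      Complex.exp (∑' i, (N i : ℂ) ^ (-s)) = F s / (s - 1)) {s : ℂ} (hs : 1 ≤ s.re) :
    F s ≠ 0 := by
  have hopen : IsOpen {s : ℂ | σ < s.re} := isOpen_lt continuous_const Complex.continuous_re
  have hdiff : ∀ s : ℂ, 1 ≤ s.re → DifferentiableAt ℂ F s := fun s hs ↦
    hF.differentiableAt (hopen.mem_nhds (hσ.trans_le hs))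
  rcases hs.lt_or_eq with hs | hs
  · intro h0
    have := (h s hs).2
    rw [h0, zero_div] at this
    exact Complex.exp_ne_zero _ this
  obtain ⟨t, rfl⟩ : ∃ t : ℝ, s = 1 + t * Complex.I :=
    ⟨s.im, Complex.ext (by simpa using hs.symm) (by simp)⟩
  rcases eq_or_ne t 0 with rfl | ht
  · simpa using hF1
  intro h0
  have hline (u : ℝ) : HasDerivAt (fun x : ℝ ↦ F (x + u * Complex.I))
      (deriv F (1 + u * Complex.I)) 1 := by
    have h1 : HasDerivAt (fun z : ℂ ↦ F (z + u * Complex.I)) (deriv F (1 + u * Complex.I))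
        ((1 : ℝ) : ℂ) := by
      have := (hdiff (1 + u * Complex.I) (by simp)).hasDerivAt
      rw [Complex.ofReal_one]
      exact this.comp_add_const 1 (u * Complex.I)
    exact h1.comp_ofReal
  have hcont (u : ℝ) : Tendsto (fun x : ℝ ↦ F (x + u * Complex.I)) (𝓝[>] 1)
      (𝓝 (F (1 + u * Complex.I))) := by
    have := (hline u).continuousAt.tendsto
    simp only [Complex.ofReal_one] at this
    exact this.mono_left nhdsWithin_le_nhds
  have hslope : Tendsto (fun x : ℝ ↦ F (x + t * Complex.I) / (x - 1)) (𝓝[>] 1)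
      (𝓝 (deriv F (1 + t * Complex.I))) := by
    have := (hasDerivAt_iff_tendsto_slope.1 (hline t)).mono_left
      (nhdsWithin_mono _ fun x (hx : 1 < x) ↦ hx.ne')
    refine this.congr fun x ↦ ?_
    simp only [slope, Complex.ofReal_one, h0, vsub_eq_sub, sub_zero, Complex.real_smul]
    push_cast
    rw [div_eq_inv_mul]
  have hden (u : ℝ) : Tendsto (fun x : ℝ ↦ (x : ℂ) + u * Complex.I - 1) (𝓝[>] 1)
      (𝓝 (u * Complex.I)) := by
    have : Continuous fun x : ℝ ↦ (x : ℂ) + u * Complex.I - 1 := by fun_prop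
    have := this.tendsto 1
    simp only [Complex.ofReal_one, add_sub_cancel_left] at this
    exact this.mono_left nhdsWithin_le_nhds
  have hx1 : Tendsto (fun x : ℝ ↦ ‖(x : ℂ) - 1‖) (𝓝[>] 1) (𝓝 0) := by
    simpa using (hden 0).norm
  have hF1' : Tendsto (fun x : ℝ ↦ F x) (𝓝[>] 1) (𝓝 (F 1)) := by simpa using hcont 0
  have hlim := (((hF1'.norm.pow 3).mul (hslope.norm.pow 4)).mul hx1).mul
    (((hden t).norm.pow 4).inv₀ (by simpa using ht)) |>.mul
    (((hcont (2 * t)).div (hden (2 * t)) (by simpa using ht)).norm)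
  simp only [mul_zero, zero_mul] at hlim
  have hge : ∀ᶠ x : ℝ in 𝓝[>] 1, 1 ≤ ‖F x‖ ^ 3 * ‖F (x + t * Complex.I) / (x - 1)‖ ^ 4 *
      ‖(x : ℂ) - 1‖ * (‖(x : ℂ) + t * Complex.I - 1‖ ^ 4)⁻¹ *
      ‖F (x + (2 * t : ℝ) * Complex.I) / (x + (2 * t : ℝ) * Complex.I - 1)‖ := by
    filter_upwards [self_mem_nhdsWithin] with x (hx : 1 < x)
    have hx0 : ‖(x : ℂ) - 1‖ ≠ 0 := norm_ne_zero_iff.2 <| sub_ne_zero.2 <| by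
      exact_mod_cast hx.ne'
    have key := one_le_norm_exp_tsum_cpow hN t fun s hs ↦ (h s (hs ▸ hx)).1
    rw [(h x (by simpa using hx)).2, (h (x + t * Complex.I) (by simpa using hx)).2,
      (h (x + (2 * t : ℝ) * Complex.I) (by simpa using hx)).2] at key
    refine key.trans_eq ?_
    rw [norm_div (F x), norm_div (F (x + t * Complex.I)), norm_div (F (x + t * Complex.I))]
    field_simp
  exact absurd (ge_of_tendsto hlim hge) (by norm_num)

theorem exists_hasSum_log_mul_cpow (hN : ∀ i, 1 ≤ N i) (hσ : σ < 1)
    (hF : DifferentiableOn ℂ F {s | σ < s.re}) (hF1 : F 1 ≠ 0)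
    (h : ∀ s : ℂ, 1 < s.re → Summable (fun i ↦ (N i : ℂ) ^ (-s)) ∧
      Complex.exp (∑' i, (N i : ℂ) ^ (-s)) = F s / (s - 1)) :
    ∃ R : ℂ → ℂ, ContinuousOn R {s | 1 ≤ s.re} ∧ ∀ s : ℂ, 1 < s.re →
      HasSum (fun i ↦ Real.log (N i) * (N i : ℂ) ^ (-s)) (1 / (s - 1) + R s) := by
  have hopen : IsOpen {s : ℂ | σ < s.re} := isOpen_lt continuous_const Complex.continuous_re
  have hdiff : ∀ s : ℂ, 1 ≤ s.re → DifferentiableAt ℂ F s := fun s hs ↦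
    hF.differentiableAt (hopen.mem_nhds (hσ.trans_le hs))
  refine ⟨fun s ↦ -(deriv F s / F s), ?_, fun s hs ↦ ?_⟩
  · have hsub : {s : ℂ | 1 ≤ s.re} ⊆ {s | σ < s.re} := fun s (hs : 1 ≤ s.re) ↦ hσ.trans_le hs
    refine (ContinuousOn.div ((hF.deriv hopen).continuousOn.mono hsub) (hF.continuousOn.mono hsub)
      fun s hs ↦ ne_zero_of_exp_tsum_cpow hN hσ hF hF1 h hs).neg
  · obtain ⟨x, hx1, hxs⟩ := exists_between hs
    have hU : IsOpen {s : ℂ | x < s.re} := isOpen_lt continuous_const Complex.continuous_re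
    have hpos (i : ι) : 0 < N i := one_pos.trans_le (hN i)
    have hd (i : ι) (z : ℂ) : HasDerivAt (fun s : ℂ ↦ (N i : ℂ) ^ (-s))
        (-(Real.log (N i) * (N i : ℂ) ^ (-z))) z := by
      have := (hasDerivAt_neg z).const_cpow (c := (N i : ℂ))
        (Or.inl (by exact_mod_cast (hpos i).ne'))
      refine this.congr_deriv ?_
      rw [Complex.ofReal_log (hpos i).le]
      ring
    have hu : Summable fun i ↦ ‖(N i : ℂ) ^ (-(x : ℂ))‖ := (h x (by simpa using hx1)).1.norm
    have hle (i : ι) (w : ℂ) (hw : w ∈ {s : ℂ | x < s.re}) :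
        ‖(N i : ℂ) ^ (-w)‖ ≤ ‖(N i : ℂ) ^ (-(x : ℂ))‖ := by
      rw [Complex.norm_cpow_eq_rpow_re_of_pos (hpos i),
      Complex.norm_cpow_eq_rpow_re_of_pos (hpos i)]
      refine Real.rpow_le_rpow_of_exponent_le (hN i) ?_
      simpa using le_of_lt hw
    have hdO (i : ι) : DifferentiableOn ℂ (fun s : ℂ ↦ (N i : ℂ) ^ (-s)) {s : ℂ | x < s.re} :=
      fun z _ ↦ (hd i z).differentiableAt.differentiableWithinAt
    have hsum := Complex.hasSum_deriv_of_summable_norm hu hdO hU hle hxs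
    have hPd := ((Complex.differentiableOn_tsum_of_summable_norm hu hdO hU hle).differentiableAt
      (hU.mem_nhds hxs)).hasDerivAt
    set P' := deriv (fun w : ℂ ↦ ∑' i, (N i : ℂ) ^ (-w)) s
    have hs1 : s - 1 ≠ 0 := fun h0 ↦ by
      have := congrArg Complex.re h0
      simp at this
      linarith
    have hFs := ne_zero_of_exp_tsum_cpow hN hσ hF hF1 h hs.le
    have e1 := hPd.cexp
    have e2 := (hdiff s hs.le).hasDerivAt.div ((hasDerivAt_id s).sub_const 1) hs1
    have e3 := e1.congr_of_eventuallyEq (f₁ := F / fun z ↦ id z - 1) <| by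
      filter_upwards [(isOpen_lt continuous_const Complex.continuous_re).mem_nhds hs] with z hz
      exact (h z hz).2.symm
    have e4 := e3.unique e2
    rw [(h s hs).2] at e4
    have e5 : 1 / (s - 1) + -(deriv F s / F s) = -P' := by
      simp only [id] at e4
      field_simp at e4 ⊢
      linear_combination e4
    rw [e5]
    simp_rw [(hd _ s).deriv] at hsum
    simpa using hsum.neg

end

end

section

open MeasureTheory Filter Topology Set

/-- The Fejér kernel, as the cosine transform of the triangle function on `[-1, 1]`. -/
noncomputable def fejerKernel (t : ℝ) : ℝ := ∫ ξ in (0 : ℝ)..1, 2 * (1 - ξ) * Real.cos (ξ * t)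

theorem continuous_fejerKernel : Continuous fejerKernel := by
  unfold fejerKernel
  apply intervalIntegral.continuous_parametric_intervalIntegral_of_continuous'
  fun_prop

theorem fejerKernel_of_ne_zero {t : ℝ} (ht : t ≠ 0) :
    fejerKernel t = 2 * (1 - Real.cos t) / t ^ 2 := by
  have h : ∀ ξ : ℝ, HasDerivAt
      (fun ξ : ℝ ↦ 2 * (1 - ξ) * Real.sin (ξ * t) / t - 2 * Real.cos (ξ * t) / t ^ 2)
      (2 * (1 - ξ) * Real.cos (ξ * t)) ξ := by
    intro ξ
    have h1 : HasDerivAt (fun ξ : ℝ ↦ ξ * t) t ξ := by simpa using (hasDerivAt_id ξ).mul_const t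
    have h2 : HasDerivAt (fun ξ : ℝ ↦ 2 * (1 - ξ)) (-2) ξ := by
      simpa using ((hasDerivAt_id ξ).const_sub 1).const_mul 2
    have h3 := ((h2.mul h1.sin).div_const t).sub ((h1.cos.const_mul 2).div_const (t ^ 2))
    refine h3.congr_deriv ?_
    field_simp
    ring
  rw [fejerKernel, intervalIntegral.integral_eq_sub_of_hasDerivAt (fun ξ _ ↦ h ξ)
    (Continuous.intervalIntegrable (by fun_prop) _ _)]
  simp
  field_simp
  ring

theorem fejerKernel_zero : fejerKernel 0 = 1 := by
  simp only [fejerKernel, mul_zero, Real.cos_zero, mul_one]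
  rw [intervalIntegral.integral_const_mul, intervalIntegral.integral_sub (by simp) (by simp)]
  norm_num

theorem fejerKernel_nonneg (t : ℝ) : 0 ≤ fejerKernel t := by
  rcases eq_or_ne t 0 with rfl | ht
  · simp [fejerKernel_zero]
  · rw [fejerKernel_of_ne_zero ht]
    have := Real.cos_le_one t
    have : 0 ≤ 1 - Real.cos t := by linarith
    positivity

theorem fejerKernel_le (t : ℝ) : fejerKernel t ≤ 8 * (1 + t ^ 2)⁻¹ := by
  rcases eq_or_ne t 0 with rfl | ht
  · simp [fejerKernel_zero]
  rw [fejerKernel_of_ne_zero ht, div_le_iff₀ (by positivity), ← div_eq_mul_inv, div_mul_eq_mul_div,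
    le_div_iff₀ (by positivity)]
  have h1 := Real.one_sub_sq_div_two_le_cos (x := t)
  have h2 := Real.neg_one_le_cos t
  have h3 := Real.cos_le_one t
  nlinarith [sq_nonneg t, mul_nonneg (sq_nonneg t) (by linarith : 0 ≤ 1 + Real.cos t)]

theorem integrable_fejerKernel : Integrable fejerKernel := by
  refine Integrable.mono' (integrable_inv_one_add_sq.const_mul 8)
    continuous_fejerKernel.aestronglyMeasurable (.of_forall fun t ↦ ?_)
  rw [Real.norm_of_nonneg (fejerKernel_nonneg t)]
  exact fejerKernel_le t

theorem integral_fejerKernel_pos : 0 < ∫ t, fejerKernel t := by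
  rw [integral_pos_iff_support_of_nonneg fejerKernel_nonneg integrable_fejerKernel]
  exact continuous_fejerKernel.isOpen_support.measure_pos _
    ⟨0, by simp [fejerKernel_zero]⟩

theorem integral_exp_eq_fejerKernel (t : ℝ) :
    ∫ ξ in (-1 : ℝ)..1, ((1 - |ξ| : ℝ) : ℂ) * Complex.exp (Complex.I * (ξ * t : ℝ)) =
      fejerKernel t := by
  have hc : Continuous fun ξ : ℝ ↦
      ((1 - |ξ| : ℝ) : ℂ) * Complex.exp (Complex.I * (ξ * t : ℝ)) := by fun_prop
  rw [← intervalIntegral.integral_add_adjacent_intervals (b := 0) (hc.intervalIntegrable _ _)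
    (hc.intervalIntegrable _ _)]
  have h0 := intervalIntegral.integral_comp_neg (a := 0) (b := 1) fun ξ : ℝ ↦
      ((1 - |ξ| : ℝ) : ℂ) * Complex.exp (Complex.I * (ξ * t : ℝ))
  rw [neg_zero] at h0
  rw [← h0, ← intervalIntegral.integral_add
    (Continuous.intervalIntegrable (by fun_prop) _ _) (hc.intervalIntegrable _ _), fejerKernel,
    ← intervalIntegral.integral_ofReal]
  refine intervalIntegral.integral_congr fun ξ hξ ↦ ?_
  rw [uIcc_of_le zero_le_one] at hξ
  have h1 := Complex.two_cos (ξ * t : ℝ)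
  simp only [abs_neg, abs_of_nonneg hξ.1]
  push_cast at h1 ⊢
  rw [mul_right_comm, h1]
  ring_nf

theorem integral_fejerKernel_mul_laplace {h : ℝ → ℝ} {M : ℝ} (hm : Measurable h)
    (hM : ∀ u, |h u| ≤ M) {ε : ℝ} (hε : 0 < ε) (l y : ℝ) :
    ∫ ξ in (-1 : ℝ)..1, ((1 - |ξ| : ℝ) : ℂ) * Complex.exp (Complex.I * (ξ * (l * y) : ℝ)) *
        ∫ u in Ioi (0 : ℝ), h u * Complex.exp (-(ε + (l * ξ : ℝ) * Complex.I) * u) =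
      ((∫ u in Ioi (0 : ℝ), h u * Real.exp (-ε * u) * fejerKernel (l * (y - u)) : ℝ) : ℂ) := by
  rw [intervalIntegral.integral_of_le (by norm_num)]
  simp_rw [← integral_const_mul]
  rw [integral_integral_swap, ← integral_complex_ofReal]
  · congr 1
    ext u
    push_cast
    rw [← integral_exp_eq_fejerKernel, intervalIntegral.integral_of_le (by norm_num),
      ← integral_const_mul]
    congr 1
    ext ξ
    have e : Complex.exp (Complex.I * (ξ * (l * y))) *
        Complex.exp (-(ε + l * ξ * Complex.I) * u) =
        Complex.exp (-ε * u) * Complex.exp (Complex.I * (ξ * (l * (y - u)))) := by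
      rw [← Complex.exp_add, ← Complex.exp_add]
      ring_nf
    push_cast
    linear_combination (1 - ((|ξ| : ℝ) : ℂ)) * h u * e
  · have hM0 : 0 ≤ M := (abs_nonneg _).trans (hM 0)
    have h1 : Integrable (fun _ : ℝ ↦ (1 : ℝ)) (volume.restrict (Ioc (-1 : ℝ) 1)) :=
      integrable_const _
    have h2 : Integrable (fun u : ℝ ↦ M * Real.exp (-ε * u)) (volume.restrict (Ioi (0 : ℝ))) :=
      (exp_neg_integrableOn_Ioi 0 hε).const_mul M
    refine (h1.mul_prod h2).mono' ?_ ?_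
    · apply Measurable.aestronglyMeasurable
      unfold Function.uncurry
      fun_prop
    · have hmem : ∀ᵐ z ∂((volume.restrict (Ioc (-1 : ℝ) 1)).prod
          (volume.restrict (Ioi (0 : ℝ)))), z.1 ∈ Ioc (-1 : ℝ) 1 := by
        rw [Measure.prod_restrict]
        filter_upwards [ae_restrict_mem (measurableSet_Ioc.prod measurableSet_Ioi)] with z hz
        exact hz.1
      filter_upwards [hmem] with z hz
      have h3 : |z.1| ≤ 1 := abs_le.2 ⟨hz.1.le, hz.2⟩
      simp only [Function.uncurry, norm_mul, Complex.norm_exp, Complex.norm_real, Real.norm_eq_abs]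
      simp
      have h4 : abs (1 - |z.1|) ≤ 1 := abs_le.2 ⟨by linarith, by linarith [abs_nonneg z.1]⟩
      calc abs (1 - |z.1|) * (|h z.2| * Real.exp (-(ε * z.2))) ≤ 1 * (M * Real.exp (-(ε * z.2))) := by
            gcongr
            exact hM _
        _ = _ := by ring

theorem integrable_fejerKernel_comp {l : ℝ} (hl : l ≠ 0) (y : ℝ) :
    Integrable fun u ↦ fejerKernel (l * (y - u)) :=
  (integrable_fejerKernel.comp_mul_left' hl).comp_sub_left y

theorem integral_fejerKernel_mul_boundary {h : ℝ → ℝ} {M : ℝ} (hm : Measurable h)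
    (hM : ∀ u, |h u| ≤ M) {R : ℂ → ℂ} (hR : ContinuousOn R {s | 0 ≤ s.re})
    (hL : ∀ s : ℂ, 0 < s.re → ∫ u in Ioi (0 : ℝ), h u * Complex.exp (-s * u) = R s)
    {l : ℝ} (hl : l ≠ 0) (y : ℝ) :
    ∫ ξ in (-1 : ℝ)..1, ((1 - |ξ| : ℝ) : ℂ) * Complex.exp (Complex.I * (ξ * (l * y) : ℝ)) *
        R ((l * ξ : ℝ) * Complex.I) =
      ((∫ u in Ioi (0 : ℝ), h u * fejerKernel (l * (y - u)) : ℝ) : ℂ) := by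
  have hR' : Continuous fun p : ℝ × ℝ ↦ R ((max p.1 0 : ℝ) + (l * p.2 : ℝ) * Complex.I) :=
    hR.comp_continuous (by fun_prop) fun p ↦ by simp
  have hJ : Continuous fun ε : ℝ ↦ ∫ ξ in (-1 : ℝ)..1, ((1 - |ξ| : ℝ) : ℂ) *
      Complex.exp (Complex.I * (ξ * (l * y) : ℝ)) *
        R ((max ε 0 : ℝ) + (l * ξ : ℝ) * Complex.I) := by
    apply intervalIntegral.continuous_parametric_intervalIntegral_of_continuous'
    unfold Function.uncurry
    exact Continuous.mul (by fun_prop) hR'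
  have h1 := (hJ.tendsto 0).mono_left (nhdsWithin_le_nhds (s := Ioi 0))
  have h2 : Tendsto (fun ε : ℝ ↦ ∫ u in Ioi (0 : ℝ),
      h u * Real.exp (-ε * u) * fejerKernel (l * (y - u))) (𝓝[>] 0)
      (𝓝 (∫ u in Ioi (0 : ℝ), h u * fejerKernel (l * (y - u)))) := by
    refine tendsto_integral_filter_of_dominated_convergence
      (fun u ↦ M * fejerKernel (l * (y - u))) (.of_forall fun ε ↦ ?_) ?_
      ((integrable_fejerKernel_comp hl y).const_mul M).integrableOn (.of_forall fun u ↦ ?_)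
    · have := continuous_fejerKernel.measurable
      exact Measurable.aestronglyMeasurable (by fun_prop)
    · filter_upwards [self_mem_nhdsWithin] with ε hε
      filter_upwards [ae_restrict_mem measurableSet_Ioi] with u hu
      rw [norm_mul, norm_mul, Real.norm_eq_abs, Real.norm_of_nonneg (Real.exp_nonneg _),
        Real.norm_of_nonneg (fejerKernel_nonneg _)]
      have h3 : Real.exp (-ε * u) ≤ 1 := by
        rw [Real.exp_le_one_iff]
        have : 0 < ε * u := mul_pos hε hu
        linarith
      have h4 : |h u| * Real.exp (-ε * u) ≤ M * 1 := by
        gcongr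
        · exact (abs_nonneg _).trans (hM 0)
        · exact hM u
      simpa using mul_le_mul_of_nonneg_right h4 (fejerKernel_nonneg (l * (y - u)))
    · have : Continuous fun ε : ℝ ↦ h u * Real.exp (-ε * u) * fejerKernel (l * (y - u)) := by
        fun_prop
      simpa using (this.tendsto 0).mono_left nhdsWithin_le_nhds
  have h3 := (Complex.continuous_ofReal.tendsto _).comp h2
  simp only [max_self, Complex.ofReal_zero, zero_add] at h1
  refine tendsto_nhds_unique (h1.congr' ?_) h3
  filter_upwards [self_mem_nhdsWithin] with ε hε
  rw [Function.comp_apply, ← integral_fejerKernel_mul_laplace hm hM hε]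
  refine intervalIntegral.integral_congr fun ξ _ ↦ ?_
  have hε' : 0 < ε := hε
  simp only [max_eq_left hε'.le]
  rw [← hL _ (by simpa using hε')]

theorem tendsto_integral_mul_exp_atTop (f : ℝ → ℂ) {l : ℝ} (hl : 0 < l) :
    Tendsto (fun y : ℝ ↦ ∫ ξ in (-1 : ℝ)..1, f ξ * Complex.exp (Complex.I * (ξ * (l * y) : ℝ)))
      atTop (𝓝 0) := by
  have h1 := Real.tendsto_integral_exp_smul_cocompact ((Ioc (-1 : ℝ) 1).indicator f)
  have h2 : Tendsto (fun y : ℝ ↦ -(l / (2 * Real.pi)) * y) atTop (cocompact ℝ) :=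
    (tendsto_id.const_mul_atTop_of_neg (by have := Real.pi_pos; simp; positivity)).mono_right
      atBot_le_cocompact
  refine (h1.comp h2).congr fun y ↦ ?_
  rw [intervalIntegral.integral_of_le (by norm_num), ← integral_indicator measurableSet_Ioc]
  simp only [Function.comp_apply]
  congr 1
  ext ξ
  by_cases hξ : ξ ∈ Ioc (-1 : ℝ) 1
  · simp only [indicator_of_mem hξ]
    rw [Real.fourierChar_apply', Circle.smul_def, Circle.coe_exp, smul_eq_mul, mul_comm]
    congr 2
    have := Real.pi_pos.ne'
    push_cast
    field_simp
  · simp [indicator_of_notMem hξ]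

theorem tendsto_integral_mul_fejerKernel {h : ℝ → ℝ} {M : ℝ} (hm : Measurable h)
    (hM : ∀ u, |h u| ≤ M) (h0 : ∀ u ≤ 0, h u = 0) {R : ℂ → ℂ}
    (hR : ContinuousOn R {s | 0 ≤ s.re})
    (hL : ∀ s : ℂ, 0 < s.re → ∫ u in Ioi (0 : ℝ), h u * Complex.exp (-s * u) = R s)
    {l : ℝ} (hl : 0 < l) :
    Tendsto (fun y ↦ ∫ t, h (y - t / l) * fejerKernel t) atTop (𝓝 0) := by
  have h1 := tendsto_integral_mul_exp_atTop
    (fun ξ ↦ ((1 - |ξ| : ℝ) : ℂ) * R ((l * ξ : ℝ) * Complex.I)) hl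
  have h2 := ((Complex.continuous_re.tendsto _).comp h1).const_mul l
  simp only [Complex.zero_re, mul_zero] at h2
  refine h2.congr fun y ↦ ?_
  simp only [Function.comp_apply, mul_right_comm _ (R _)]
  rw [integral_fejerKernel_mul_boundary hm hM hR hL hl.ne', Complex.ofReal_re,
    setIntegral_eq_integral_of_forall_compl_eq_zero fun u hu ↦ by
      rw [h0 u (not_lt.1 hu), zero_mul]]
  have h3 := integral_sub_left_eq_self (fun u ↦ h u * fejerKernel (l * (y - u))) volume y
  have h4 := Measure.integral_comp_div (fun u ↦ h (y - u) * fejerKernel (l * u)) l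
  rw [← h3]
  simp only [sub_sub_cancel]
  rw [abs_of_pos hl, smul_eq_mul] at h4
  rw [← h4]
  congr 1
  ext t
  rw [mul_div_cancel₀ _ hl.ne']

/-- A Wiener–Ikehara type theorem: a bounded slowly decreasing function `φ` on `(0, ∞)` whose
Laplace transform differs from that of `1` by a function extending continuously to `0 ≤ re s`
tends to `1`. -/
theorem tendsto_one_of_laplace {φ : ℝ → ℝ} {C : ℝ} (hm : Measurable φ)
    (h0 : ∀ u, 0 ≤ φ u) (hC : ∀ u, φ u ≤ C)
    (hφ : ∀ u v, u ≤ v → φ u * Real.exp (u - v) ≤ φ v) {R : ℂ → ℂ}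
    (hR : ContinuousOn R {s | 0 ≤ s.re})
    (hL : ∀ s : ℂ, 0 < s.re →
      ∫ u in Ioi (0 : ℝ), ((φ u - 1 : ℝ) : ℂ) * Complex.exp (-s * u) = R s) :
    Tendsto φ atTop (𝓝 1) := by
  set h : ℝ → ℝ := (Ioi 0).indicator fun u ↦ φ u - 1 with hh
  have hhm : Measurable h := (hm.sub_const 1).indicator measurableSet_Ioi
  have hh0 : ∀ u ≤ 0, h u = 0 := fun u hu ↦ indicator_of_notMem (by simpa using hu) _
  have hh1 : ∀ u, 0 < u → h u = φ u - 1 := fun u hu ↦ indicator_of_mem (by simpa using hu) _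
  have hC0 : 0 ≤ C := (h0 0).trans (hC 0)
  set M := C + 1
  have hhM : ∀ u, |h u| ≤ M := by
    intro u
    rcases le_or_gt u 0 with hu | hu
    · rw [hh0 u hu, abs_zero]
      positivity
    · rw [hh1 u hu, abs_le]
      constructor <;> linarith [h0 u, hC u]
  have hhL : ∀ s : ℂ, 0 < s.re → ∫ u in Ioi (0 : ℝ), h u * Complex.exp (-s * u) = R s := by
    intro s hs
    rw [← hL s hs]
    refine setIntegral_congr_fun measurableSet_Ioi fun u hu ↦ ?_
    simp only [hh1 u hu]
  set k := fejerKernel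
  set c := ∫ t, k t
  have hc : 0 < c := integral_fejerKernel_pos
  have hk0 : ∀ t, 0 ≤ k t := fejerKernel_nonneg
  have hki : Integrable k := integrable_fejerKernel
  have hhki (y l : ℝ) : Integrable fun t ↦ h (y - t / l) * k t := by
    refine hki.bdd_mul (c := M) ?_ (.of_forall fun t ↦ hhM _)
    exact Measurable.aestronglyMeasurable (by fun_prop)
  have key : ∀ ε > 0, ∀ᶠ y in atTop, (1 - ε) * Real.exp (-(2 * ε)) ≤ φ y ∧
      φ y ≤ (1 + ε) * Real.exp (2 * ε) := by
    intro ε hε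
    set η := min (c / 2) (ε * c / (4 * M)) with hη
    have hη0 : 0 < η := by positivity
    have hηc : η ≤ c / 2 := min_le_left _ _
    have hMη : M * η ≤ ε * c / 4 := by
      have : η ≤ ε * c / (4 * M) := min_le_right _ _
      rw [le_div_iff₀ (by positivity)] at this
      linarith
    obtain ⟨T, hT0, hT⟩ : ∃ T > 0, c - η ≤ ∫ t in Icc (-T) T, k t := by
      have h1 : Tendsto (fun T : ℝ ↦ ∫ t in (-T)..T, k t) atTop (𝓝 c) :=
        intervalIntegral_tendsto_integral hki tendsto_neg_atTop_atBot tendsto_id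
      obtain ⟨T, hT, hT0⟩ := ((h1.eventually (lt_mem_nhds (sub_lt_self c hη0))).and
        (eventually_gt_atTop 0)).exists
      refine ⟨T, hT0, hT.le.trans_eq ?_⟩
      rw [intervalIntegral.integral_of_le (by linarith), integral_Icc_eq_integral_Ioc]
    set I := Icc (-T) T
    set J := ∫ t in I, k t
    have hJ : c / 2 ≤ J := by linarith
    have hJ0 : 0 < J := by linarith
    have hcompl : ∫ t in Iᶜ, k t ≤ η := by
      have := integral_add_compl (s := I) measurableSet_Icc hki
      linarith
    set l := T / ε with hl
    have hl0 : 0 < l := by positivity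
    have htl : ∀ t ∈ I, |t / l| ≤ ε := by
      intro t ht
      rw [abs_div, abs_of_pos hl0, div_le_iff₀ hl0, hl, mul_div_cancel₀ _ hε.ne']
      exact abs_le.2 ht
    have hrest (y : ℝ) : |∫ t in Iᶜ, h (y - t / l) * k t| ≤ M * η := by
      rw [← Real.norm_eq_abs]
      calc ‖∫ t in Iᶜ, h (y - t / l) * k t‖ ≤ ∫ t in Iᶜ, M * k t :=
            norm_integral_le_of_norm_le (hki.const_mul M).integrableOn (.of_forall fun t ↦ by
              rw [norm_mul, Real.norm_of_nonneg (hk0 t)]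
              exact mul_le_mul_of_nonneg_right (hhM _) (hk0 t))
        _ ≤ M * η := by
            rw [integral_const_mul]
            gcongr
    have hlim := tendsto_integral_mul_fejerKernel hhm hhM hh0 hR hhL hl0
    have hmain : ∀ᶠ y in atTop, |∫ t, h (y - t / l) * k t| < ε * c / 4 := by
      have := hlim.abs
      rw [abs_zero] at this
      exact this.eventually (gt_mem_nhds (by positivity))
    have hsplit (y : ℝ) : ∫ t, h (y - t / l) * k t =
        (∫ t in I, h (y - t / l) * k t) + ∫ t in Iᶜ, h (y - t / l) * k t :=
      (integral_add_compl measurableSet_Icc (hhki y l)).symm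
    have hI : ∀ᶠ y in atTop, |∫ t in I, h (y - t / l) * k t| ≤ ε * J := by
      filter_upwards [hmain] with y hy
      have h1 := hrest y
      have h2 := hsplit y
      rw [abs_lt] at hy
      rw [abs_le] at h1 ⊢
      have : ε * (c / 2) ≤ ε * J := by gcongr
      constructor <;> linarith [hy.1, hy.2, h1.1, h1.2]
    filter_upwards [(tendsto_atTop_add_const_right _ ε tendsto_id).eventually hI,
      (tendsto_atTop_add_const_right _ (-ε) tendsto_id).eventually hI,
      eventually_gt_atTop (2 * ε)] with y hy1 hy2 hy3
    simp only [id_eq, abs_le] at hy1 hy2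
    constructor
    · have h1 : ∫ t in I, h (y + -ε - t / l) * k t ≤
          ∫ t in I, (φ y * Real.exp (2 * ε) - 1) * k t := by
        refine setIntegral_mono_on (hhki _ l).integrableOn (hki.const_mul _).integrableOn
          measurableSet_Icc fun t ht ↦ mul_le_mul_of_nonneg_right ?_ (hk0 t)
        have h2 := abs_le.1 (htl t ht)
        rw [hh1 _ (by linarith [h2.1, h2.2])]
        have h3 := hφ (y + -ε - t / l) y (by linarith [h2.1, h2.2])
        have h4 : φ (y + -ε - t / l) * Real.exp (-(2 * ε)) ≤ φ y := by
          refine le_trans (mul_le_mul_of_nonneg_left ?_ (h0 _)) h3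
          rw [Real.exp_le_exp]
          linarith [h2.1, h2.2]
        rw [Real.exp_neg, ← div_eq_mul_inv, div_le_iff₀ (Real.exp_pos _)] at h4
        linarith
      rw [integral_const_mul] at h1
      have h2 : -ε ≤ φ y * Real.exp (2 * ε) - 1 := by
        by_contra! h3
        have := mul_lt_mul_of_pos_right h3 hJ0
        linarith [hy2.1]
      rw [Real.exp_neg, ← div_eq_mul_inv, div_le_iff₀ (Real.exp_pos _)]
      linarith
    · have h1 : ∫ t in I, (φ y * Real.exp (-(2 * ε)) - 1) * k t ≤
          ∫ t in I, h (y + ε - t / l) * k t := by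
        refine setIntegral_mono_on (hki.const_mul _).integrableOn (hhki _ l).integrableOn
          measurableSet_Icc fun t ht ↦ mul_le_mul_of_nonneg_right ?_ (hk0 t)
        have h2 := abs_le.1 (htl t ht)
        rw [hh1 _ (by linarith [h2.1, h2.2])]
        have h3 := hφ y (y + ε - t / l) (by linarith [h2.1, h2.2])
        have h4 : φ y * Real.exp (-(2 * ε)) ≤ φ (y + ε - t / l) := by
          refine le_trans (mul_le_mul_of_nonneg_left ?_ (h0 _)) h3
          rw [Real.exp_le_exp]
          linarith [h2.1, h2.2]
        linarith
      rw [integral_const_mul] at h1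
      have h2 : φ y * Real.exp (-(2 * ε)) - 1 ≤ ε := by
        by_contra! h3
        have := mul_lt_mul_of_pos_right h3 hJ0
        linarith [hy1.2]
      rw [Real.exp_neg, tsub_le_iff_right, ← div_eq_mul_inv, div_le_iff₀ (Real.exp_pos _)] at h2
      linarith
  have hlow : Tendsto (fun ε : ℝ ↦ (1 - ε) * Real.exp (-(2 * ε))) (𝓝[>] 0) (𝓝 1) := by
    have : Continuous fun ε : ℝ ↦ (1 - ε) * Real.exp (-(2 * ε)) := by fun_prop
    simpa using (this.tendsto 0).mono_left nhdsWithin_le_nhds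
  have hup : Tendsto (fun ε : ℝ ↦ (1 + ε) * Real.exp (2 * ε)) (𝓝[>] 0) (𝓝 1) := by
    have : Continuous fun ε : ℝ ↦ (1 + ε) * Real.exp (2 * ε) := by fun_prop
    simpa using (this.tendsto 0).mono_left nhdsWithin_le_nhds
  rw [tendsto_order]
  constructor
  · intro a ha
    obtain ⟨ε, h1, h2⟩ := ((hlow.eventually (lt_mem_nhds ha)).and self_mem_nhdsWithin).exists
    filter_upwards [key ε h2] with y hy using h1.trans_le hy.1
  · intro a ha
    obtain ⟨ε, h1, h2⟩ := ((hup.eventually (gt_mem_nhds ha)).and self_mem_nhdsWithin).exists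
    filter_upwards [key ε h2] with y hy using hy.2.trans_lt h1

end

section

open MeasureTheory Filter Topology Set

section

variable {ι : Type*} {N : ι → ℝ}

/-- The Chebyshev function `x ↦ ∑_{N i ≤ x} log (N i)` of a family of norms. -/
noncomputable def normTheta (N : ι → ℝ) (x : ℝ) : ℝ :=
  ∑' i, {i | N i ≤ x}.indicator (fun i ↦ Real.log (N i)) i

theorem hasFiniteSupport_normTheta (hfin : ∀ x, {i | N i ≤ x}.Finite) (x : ℝ) :
    (Function.support ({i | N i ≤ x}.indicator fun i ↦ Real.log (N i))).Finite :=
  (hfin x).subset support_indicator_subset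

theorem normTheta_mono (hN : ∀ i, 1 ≤ N i) (hfin : ∀ x, {i | N i ≤ x}.Finite) :
    Monotone (normTheta N) := by
  intro x y hxy
  refine Summable.tsum_le_tsum (fun i ↦ ?_)
    (summable_of_hasFiniteSupport (hasFiniteSupport_normTheta hfin x))
    (summable_of_hasFiniteSupport (hasFiniteSupport_normTheta hfin y))
  exact indicator_le_indicator_of_subset (fun i hi ↦ le_trans hi hxy)
    (fun i ↦ Real.log_nonneg (hN i)) i

theorem normTheta_nonneg (hN : ∀ i, 1 ≤ N i) (x : ℝ) : 0 ≤ normTheta N x :=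
  tsum_nonneg fun i ↦ indicator_nonneg (fun i _ ↦ Real.log_nonneg (hN i)) i

theorem setIntegral_Ioi_indicator_Ici_exp {a : ℝ} (ha : 0 ≤ a) {z : ℂ} (hz : 0 < z.re) :
    ∫ u in Ioi (0 : ℝ), (Ici a).indicator (fun u : ℝ ↦ a * Complex.exp (-z * u)) u =
      a * Complex.exp (-z * a) / z := by
  rcases ha.eq_or_lt with rfl | ha
  · simp
  rw [setIntegral_indicator measurableSet_Ici,
    inter_eq_right.2 (Ici_subset_Ioi.2 ha), integral_Ici_eq_integral_Ioi,
    integral_const_mul, integral_exp_mul_complex_Ioi (by simpa using hz)]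
  rw [neg_div_neg_eq, mul_div_assoc]

theorem integrable_indicator_Ici_exp (a : ℝ) {z : ℂ} (hz : 0 < z.re) :
    IntegrableOn (fun u ↦ (Ici a).indicator (fun u : ℝ ↦ a * Complex.exp (-z * u)) u)
      (Ioi (0 : ℝ)) :=
  ((integrableOn_exp_mul_complex_Ioi (by simpa using hz) 0).const_mul (a : ℂ)).indicator
    measurableSet_Ici

theorem setIntegral_normTheta_mul_exp [Countable ι] (hN : ∀ i, 1 ≤ N i) {z w : ℂ} (hz : 0 < z.re)
    (h : HasSum (fun i ↦ Real.log (N i) * (N i : ℂ) ^ (-z)) w) :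
    ∫ u in Ioi (0 : ℝ), (normTheta N (Real.exp u) : ℂ) * Complex.exp (-z * u) = w / z := by
  have ha (i : ι) : 0 ≤ Real.log (N i) := Real.log_nonneg (hN i)
  have hexp (i : ι) (z : ℂ) : (N i : ℂ) ^ (-z) = Complex.exp (-z * Real.log (N i)) := by
    have : 0 < N i := one_pos.trans_le (hN i)
    rw [Complex.cpow_def_of_ne_zero (by exact_mod_cast this.ne'), Complex.ofReal_log this.le,
      mul_comm]
  simp only [hexp] at h
  have h1 := hasSum_integral_of_summable_integral_norm
    (fun i ↦ integrable_indicator_Ici_exp (Real.log (N i)) hz) ?_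
  · simp only [setIntegral_Ioi_indicator_Ici_exp (ha _) hz] at h1
    rw [(h.div_const z).unique h1]
    congr 1
    ext u
    rw [normTheta, Complex.ofReal_tsum, ← tsum_mul_right]
    refine tsum_congr fun i ↦ ?_
    have hiff : N i ≤ Real.exp u ↔ Real.log (N i) ≤ u :=
      (Real.log_le_iff_le_exp (one_pos.trans_le (hN i))).symm
    by_cases hi : Real.log (N i) ≤ u <;> simp [indicator, hiff, hi]
  · have h2 : ∀ i, ∫ u in Ioi (0 : ℝ), ‖(Ici (Real.log (N i))).indicator
        (fun u : ℝ ↦ Real.log (N i) * Complex.exp (-z * u)) u‖ =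
        ‖Real.log (N i) * Complex.exp (-z * Real.log (N i))‖ / z.re := by
      intro i
      have h3 := setIntegral_Ioi_indicator_Ici_exp (ha i) (z := (z.re : ℂ)) (by simpa using hz)
      apply Complex.ofReal_injective
      rw [← integral_complex_ofReal]
      have h4 (u : ℝ) : ((‖(Real.log (N i) : ℂ) * Complex.exp (-z * u)‖ : ℝ) : ℂ) =
          Real.log (N i) * Complex.exp (-(z.re : ℂ) * u) := by
        rw [norm_mul, Complex.norm_real, Real.norm_of_nonneg (ha i), Complex.norm_exp]
        simp
      rw [Complex.ofReal_div, h4, ← h3]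
      congr 1
      ext u
      by_cases hu : u ∈ Ici (Real.log (N i))
      · rw [indicator_of_mem hu, indicator_of_mem hu, h4]
      · rw [indicator_of_notMem hu, indicator_of_notMem hu]
        simp
    simp only [h2]
    exact h.summable.norm.div_const _

theorem tendsto_normTheta_div [Countable ι] (hN : ∀ i, 1 ≤ N i)
    (hfin : ∀ x, {i | N i ≤ x}.Finite) {C : ℝ} (hC : ∀ x, 0 < x → normTheta N x ≤ C * x)
    {R : ℂ → ℂ} (hR : ContinuousOn R {s | 1 ≤ s.re})
    (h : ∀ s : ℂ, 1 < s.re →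
      HasSum (fun i ↦ Real.log (N i) * (N i : ℂ) ^ (-s)) (1 / (s - 1) + R s)) :
    Tendsto (fun x ↦ normTheta N x / x) atTop (𝓝 1) := by
  set φ : ℝ → ℝ := fun u ↦ normTheta N (Real.exp u) / Real.exp u with hφ
  have hφm : Measurable φ :=
    ((normTheta_mono hN hfin).measurable.comp Real.measurable_exp).div Real.measurable_exp
  have hφ0 (u : ℝ) : 0 ≤ φ u := div_nonneg (normTheta_nonneg hN _) (Real.exp_nonneg _)
  have hφC (u : ℝ) : φ u ≤ C := (div_le_iff₀ (Real.exp_pos u)).2 (hC _ (Real.exp_pos u))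
  have hlim : Tendsto φ atTop (𝓝 1) := by
    refine tendsto_one_of_laplace (R := fun s ↦ (R (1 + s) - 1) / (1 + s)) hφm hφ0 hφC ?_ ?_ ?_
    · intro u v huv
      rw [hφ]
      dsimp only
      rw [Real.exp_sub, div_mul_div_cancel₀ (Real.exp_pos u).ne']
      gcongr
      exact normTheta_mono hN hfin (Real.exp_le_exp.2 huv)
    · refine ContinuousOn.div (ContinuousOn.sub (hR.comp (by fun_prop) fun s hs ↦ ?_)
        continuousOn_const) (by fun_prop) fun s hs h0 ↦ ?_
      · simpa using hs
      · have := congrArg Complex.re h0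
        simp at this hs
        linarith
    · intro s hs
      have hs1 : 0 < (1 + s).re := by simp; linarith
      have hs0 : s ≠ 0 := fun h0 ↦ by simp [h0] at hs
      have hs10 : 1 + s ≠ 0 := fun h0 ↦ by simp [h0] at hs1
      have h1 := setIntegral_normTheta_mul_exp hN hs1 (h (1 + s) (by simpa using hs))
      have h2 : ∫ u in Ioi (0 : ℝ), Complex.exp (-s * u) = 1 / s := by
        rw [integral_exp_mul_complex_Ioi (by simpa using hs)]
        simp
      have h3 (u : ℝ) : (normTheta N (Real.exp u) : ℂ) * Complex.exp (-(1 + s) * u) =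
          φ u * Complex.exp (-s * u) := by
        rw [hφ]
        push_cast
        rw [neg_add, add_mul, Complex.exp_add, neg_mul, one_mul, Complex.exp_neg]
        ring
      simp only [h3] at h1
      have hint : IntegrableOn (fun u : ℝ ↦ Complex.exp (-s * u)) (Ioi 0) :=
        integrableOn_exp_mul_complex_Ioi (by simpa using hs) 0
      have hint' : IntegrableOn (fun u : ℝ ↦ (φ u : ℂ) * Complex.exp (-s * u)) (Ioi 0) := by
        refine hint.bdd_mul (c := C) (by fun_prop) (.of_forall fun u ↦ ?_)
        rw [Complex.norm_real, Real.norm_of_nonneg (hφ0 u)]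
        exact hφC u
      push_cast
      simp only [sub_mul, one_mul]
      rw [integral_sub hint' hint, h1, h2]
      rw [add_sub_cancel_left]
      field_simp
      ring
  refine (hlim.comp Real.tendsto_log_atTop).congr' ?_
  filter_upwards [eventually_gt_atTop 0] with x hx
  simp only [Function.comp_apply, hφ, Real.exp_log hx]

end

end

section

open NumberField IsDedekindDomain Filter Topology

section

variable (K : Type*) [Field K] [NumberField K]

theorem finite_degreeOnePrime_absNorm_le (n : ℕ) :
    {P : DegreeOnePrime K | Ideal.absNorm P.1.asIdeal ≤ n}.Finite :=
  Set.Finite.of_finite_image (f := fun P : DegreeOnePrime K ↦ P.1.asIdeal)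
    ((Ideal.finite_setOfPred_absNorm_le n).subset (by rintro _ ⟨P, hP, rfl⟩; exact hP))
    fun P _ Q _ h ↦ Subtype.ext (HeightOneSpectrum.ext h)

/-- The number of prime ideals of norm `q`. -/
noncomputable def degreeOneCount (q : ℕ) : ℕ :=
  {P : DegreeOnePrime K | Ideal.absNorm P.1.asIdeal = q}.ncard

theorem finite_degreeOnePrime_absNorm_eq (q : ℕ) :
    {P : DegreeOnePrime K | Ideal.absNorm P.1.asIdeal = q}.Finite :=
  (finite_degreeOnePrime_absNorm_le K q).subset fun _ h ↦ le_of_eq h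

theorem degreeOneCount_le (q : ℕ) : degreeOneCount K q ≤ Module.finrank ℚ K := by
  rw [degreeOneCount, Set.ncard_eq_toFinset_card _ (finite_degreeOnePrime_absNorm_eq K q)]
  exact card_degreeOnePrime_le q _ fun P hP ↦ by simpa using hP

theorem normTheta_degreeOnePrime (x : ℝ) :
    normTheta (fun P : DegreeOnePrime K ↦ (Ideal.absNorm P.1.asIdeal : ℝ)) x =
      ∑ p ∈ (Finset.range (⌊x⌋₊ + 1)).filter Nat.Prime, degreeOneCount K p * Real.log p := by
  classical
  set T := (finite_degreeOnePrime_absNorm_le K ⌊x⌋₊).toFinset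
  have hT (P : DegreeOnePrime K) : P ∈ T ↔ (Ideal.absNorm P.1.asIdeal : ℝ) ≤ x := by
    rw [Set.Finite.mem_toFinset, Set.mem_ofPred_eq, Nat.le_floor_iff' P.2.ne_zero]
  rw [normTheta, tsum_eq_sum (s := T) fun P hP ↦
    Set.indicator_of_notMem (by simpa using mt (hT P).2 hP) _]
  rw [Finset.sum_congr rfl fun P hP ↦ Set.indicator_of_mem (by simpa using (hT P).1 hP) _,
    ← Finset.sum_fiberwise_of_maps_to (g := fun P : DegreeOnePrime K ↦ Ideal.absNorm P.1.asIdeal)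
      (t := (Finset.range (⌊x⌋₊ + 1)).filter Nat.Prime) fun P hP ↦ ?_]
  · refine Finset.sum_congr rfl fun p hp ↦ ?_
    rw [Finset.sum_congr rfl fun P hP ↦ by rw [(Finset.mem_filter.1 hP).2], Finset.sum_const,
      nsmul_eq_mul, degreeOneCount, ← Set.ncard_coe_finset]
    congr 3
    ext P
    rw [Finset.mem_filter, Finset.mem_range] at hp
    simp only [Finset.coe_filter, Set.mem_ofPred_eq, T, Set.Finite.mem_toFinset]
    omega
  · rw [Finset.mem_filter, Finset.mem_range]
    exact ⟨Nat.lt_succ_of_le (by simpa [T] using hP), P.2⟩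

theorem normTheta_degreeOnePrime_le {x : ℝ} (hx : 0 < x) :
    normTheta (fun P : DegreeOnePrime K ↦ (Ideal.absNorm P.1.asIdeal : ℝ)) x ≤
      Module.finrank ℚ K * Real.log 4 * x := by
  rw [normTheta_degreeOnePrime, mul_assoc]
  refine le_trans ?_ (mul_le_mul_of_nonneg_left (Chebyshev.theta_le_log4_mul_x hx.le)
    (Nat.cast_nonneg _))
  have hIcc : Finset.range (⌊x⌋₊ + 1) = Finset.Icc 0 ⌊x⌋₊ := by
    ext
    simp
  rw [Chebyshev.theta_eq_sum_Icc, Finset.mul_sum, hIcc]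
  refine Finset.sum_le_sum fun p _ ↦ ?_
  gcongr
  exact degreeOneCount_le K p

theorem tendsto_sum_degreeOneCount_mul_log :
    Tendsto (fun n : ℕ ↦ (∑ p ∈ (Finset.range (n + 1)).filter Nat.Prime,
      degreeOneCount K p * Real.log p) / n) atTop (𝓝 1) := by
  obtain ⟨σ, hσ, F, hF, hF1, h⟩ := exists_exp_tsum_degreeOnePrime K
  have hN (P : DegreeOnePrime K) : (1 : ℝ) ≤ Ideal.absNorm P.1.asIdeal := by
    exact_mod_cast P.2.one_le
  obtain ⟨R, hR, hRs⟩ := exists_hasSum_log_mul_cpow hN hσ hF hF1 h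
  have := tendsto_normTheta_div hN (fun x ↦ ?_) (fun x hx ↦ normTheta_degreeOnePrime_le K hx) hR hRs
  · refine (this.comp tendsto_natCast_atTop_atTop).congr fun n ↦ ?_
    simp [normTheta_degreeOnePrime]
  · refine (finite_degreeOnePrime_absNorm_le K ⌊x⌋₊).subset fun P hP ↦ ?_
    rwa [Set.mem_ofPred_eq, Nat.le_floor_iff' P.2.ne_zero]

end

theorem tendsto_sum_mul_log_div {f : ℕ → ℝ} {D : ℝ} (h0 : ∀ p, 0 ≤ f p) (hD : ∀ p, f p ≤ D)
    (h : Tendsto (fun n : ℕ ↦ (∑ p ∈ (Finset.range (n + 1)).filter Nat.Prime,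
      f p * Real.log p) / n) atTop (𝓝 1)) :
    Tendsto (fun n : ℕ ↦ (∑ p ∈ (Finset.range (n + 1)).filter Nat.Prime, f p) * (Real.log n / n))
      atTop (𝓝 1) := by
  set S : ℕ → Finset ℕ := fun n ↦ (Finset.range (n + 1)).filter Nat.Prime with hS
  have hpos : ∀ n, ∀ p ∈ S n, 1 ≤ p ∧ p ≤ n := fun n p hp ↦ by
    rw [hS, Finset.mem_filter, Finset.mem_range] at hp
    exact ⟨hp.2.one_le, by omega⟩
  have hlow (n : ℕ) : (∑ p ∈ S n, f p * Real.log p) / n ≤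
      (∑ p ∈ S n, f p) * (Real.log n / n) := by
    rw [← mul_div_assoc, Finset.sum_mul]
    gcongr with p hp
    · exact h0 p
    · exact_mod_cast (hpos n p hp).1
    · exact (hpos n p hp).2
  have hD0 : 0 ≤ D := (h0 0).trans (hD 0)
  have hup (α : ℝ) (hα0 : 0 < α) (n : ℕ) (hn : 2 ≤ n) :
      (∑ p ∈ S n, f p) * (Real.log n / n) ≤
        D * ((n : ℝ) ^ α * (Real.log n / n)) + α⁻¹ * ((∑ p ∈ S n, f p * Real.log p) / n) := by
    have hn0 : (0 : ℝ) < n := by positivity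
    have hlog : 0 < Real.log n := Real.log_pos (by exact_mod_cast hn)
    have h1 : ∀ p ∈ S n, f p ≤ (if (p : ℝ) ≤ (n : ℝ) ^ α then D else 0) +
        (α * Real.log n)⁻¹ * (f p * Real.log p) := by
      intro p hp
      have h1p : (1 : ℝ) ≤ p := by exact_mod_cast (hpos n p hp).1
      have := Real.log_nonneg h1p
      have := h0 p
      split_ifs with h2
      · have : 0 ≤ (α * Real.log n)⁻¹ * (f p * Real.log p) := by positivity
        linarith [hD p]
      · rw [zero_add, inv_mul_eq_div, le_div_iff₀ (by positivity)]
        gcongr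
        rw [← Real.log_rpow hn0]
        exact Real.log_le_log (by positivity) (not_le.1 h2).le
    have h2 : ∑ p ∈ S n, (if (p : ℝ) ≤ (n : ℝ) ^ α then D else 0) ≤ D * (n : ℝ) ^ α := by
      rw [← Finset.sum_filter, Finset.sum_const, nsmul_eq_mul, mul_comm]
      gcongr
      have h3 : ((S n).filter fun p : ℕ ↦ (p : ℝ) ≤ (n : ℝ) ^ α) ⊆ Finset.Icc 1 ⌊(n : ℝ) ^ α⌋₊ := by
        intro p hp
        rw [Finset.mem_filter] at hp
        exact Finset.mem_Icc.2 ⟨(hpos n p hp.1).1, Nat.le_floor hp.2⟩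
      refine le_trans (Nat.cast_le.2 (Finset.card_le_card h3)) ?_
      simpa using Nat.floor_le (by positivity : 0 ≤ (n : ℝ) ^ α)
    have h3 := Finset.sum_le_sum h1
    rw [Finset.sum_add_distrib, ← Finset.mul_sum] at h3
    refine (mul_le_mul_of_nonneg_right (h3.trans (add_le_add h2 le_rfl))
      (by positivity)).trans_eq ?_
    field_simp
  have hlim (α : ℝ) (hα : α < 1) :
      Tendsto (fun n : ℕ ↦ (n : ℝ) ^ α * (Real.log n / n)) atTop (𝓝 0) := by
    have h1 := (isLittleO_log_rpow_atTop (sub_pos.2 hα)).tendsto_div_nhds_zero.comp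
      tendsto_natCast_atTop_atTop
    refine h1.congr' ?_
    filter_upwards [eventually_gt_atTop 0] with n hn
    have hn0 : (0 : ℝ) < n := by exact_mod_cast hn
    rw [Function.comp_apply, Real.rpow_sub hn0, Real.rpow_one]
    field_simp
  rw [tendsto_order]
  constructor
  · intro a ha
    filter_upwards [h.eventually (lt_mem_nhds ha)] with n hn using hn.trans_le (hlow n)
  · intro a ha
    obtain ⟨α, hα0, hα1, hαa⟩ : ∃ α : ℝ, 0 < α ∧ α < 1 ∧ α⁻¹ < a := by
      have ha0 : 0 < a := one_pos.trans ha
      obtain ⟨α, h1, h2⟩ := exists_between (inv_lt_one_of_one_lt₀ ha)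
      have : 0 < α := (inv_pos.2 ha0).trans h1
      exact ⟨α, this, h2, inv_lt_of_inv_lt₀ ha0 h1⟩
    have h1 := ((hlim α hα1).const_mul D).add (h.const_mul α⁻¹)
    rw [mul_zero, zero_add, mul_one] at h1
    filter_upwards [h1.eventually (gt_mem_nhds hαa), eventually_ge_atTop 2] with n hn hn2
    exact (hup α hα0 n hn2).trans_lt hn

end

section

open NumberField IsDedekindDomain Polynomial RingOfIntegers UniqueFactorizationMonoid

section

variable {K : Type*} [Field K] [NumberField K]

theorem exponent_ne_zero_of_adjoin_eq_top {θ : 𝓞 K}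
    (hθ : IntermediateField.adjoin ℚ {(θ : K)} = ⊤) : exponent θ ≠ 0 := by
  have hint : IsIntegral ℚ (θ : K) := .of_finite ℚ _
  let B : PowerBasis ℚ K := (IntermediateField.adjoin.powerBasis hint).map
    ((IntermediateField.equivOfEq hθ).trans IntermediateField.topEquiv)
  have hgen : B.gen = θ := by simp [B]
  have hgenint : IsIntegral ℤ B.gen := hgen ▸ θ.isIntegral_coe
  obtain ⟨d, hd⟩ : ∃ d : ℤ, (d : ℚ) = Algebra.discr ℚ B.basis :=
    IsIntegrallyClosed.isIntegral_iff.1 (Algebra.discr_isIntegral ℚ fun i ↦ by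
      rw [B.basis_eq_pow]
      exact hgenint.pow _)
  have hd0 : d ≠ 0 := fun h ↦
    Algebra.discr_not_zero_of_basis ℚ B.basis (by rw [← hd, h, Int.cast_zero])
  have hmem : (d : 𝓞 K) ∈ conductor ℤ θ := by
    rw [mem_conductor_iff]
    intro b
    have h := Algebra.discr_mul_isIntegral_mem_adjoin (R := ℤ) ℚ hgenint b.isIntegral_coe
    rw [← hd, hgen] at h
    have h2 : (algebraMap (𝓞 K) K) (d * b) ∈
        (Algebra.adjoin ℤ {θ}).map (Algebra.algHom ℤ (𝓞 K) K) := by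
      rw [AlgHom.map_adjoin_singleton]
      convert h using 1
      · rfl
      · simp [Algebra.smul_def]
    obtain ⟨c, hc, hcb⟩ := h2
    have : c = d * b := RingOfIntegers.coe_injective hcb
    exact this ▸ hc
  rw [exponent, Ne, Ideal.absNorm_eq_zero_iff]
  intro h0
  have : d ∈ Ideal.under ℤ (conductor ℤ θ) := by
    rw [Ideal.under_def, Ideal.mem_comap]
    simpa using hmem
  rw [h0] at this
  exact hd0 (by simpa using this)

theorem degreeOneCount_eq_card_roots {θ : 𝓞 K} {p : ℕ} [hp : Fact p.Prime]
    (hpθ : ¬ p ∣ exponent θ) :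
    degreeOneCount K p =
      Nat.card {x : ZMod p // ((minpoly ℤ θ).map (Int.castRingHom (ZMod p))).eval x = 0} := by
  set f := (minpoly ℤ θ).map (Int.castRingHom (ZMod p)) with hf
  have hf0 : f ≠ 0 := ((minpoly.monic θ.isIntegral).map _).ne_zero
  set e := NumberField.Ideal.primesOverSpanEquivMonicFactorsMod hpθ
  have hmem (x : ZMod p) (hx : f.eval x = 0) : X - C x ∈ monicFactorsMod θ p := by
    rw [Multiset.mem_toFinset, mem_normalizedFactors_iff' hf0]
    exact ⟨irreducible_X_sub_C x, (monic_X_sub_C x).normalize_eq_self, dvd_iff_isRoot.2 hx⟩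
  have hnorm (P : Ideal.primesOver (Ideal.span {(p : ℤ)}) (𝓞 K)) :
      Ideal.absNorm P.1 = p ^ (e P : (ZMod p)[X]).natDegree := by
    have := P.2.2
    have := P.2.1
    rw [Ideal.absNorm_eq_pow_inertiaDeg' P.1 hp.out, Ideal.inertiaDeg'_eq_inertiaDeg,
      ← Ideal.inertiaDeg_primesOverSpanEquivMonicFactorsMod_symm_apply' hpθ (e P).2]
    simp [e]
  have hnorm' (x : ZMod p) (hx : f.eval x = 0) :
      Ideal.absNorm (e.symm ⟨X - C x, hmem x hx⟩).1 = p := by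
    rw [hnorm, Equiv.apply_symm_apply, natDegree_X_sub_C, pow_one]
  have hbot (P : Ideal.primesOver (Ideal.span {(p : ℤ)}) (𝓞 K)) (h : Ideal.absNorm P.1 = p) :
      P.1 ≠ ⊥ := fun h0 ↦ hp.out.ne_zero (by rw [← h, h0, Ideal.absNorm_bot])
  let g : {x : ZMod p // f.eval x = 0} →
      {P : DegreeOnePrime K | Ideal.absNorm P.1.asIdeal = p} := fun x ↦
    ⟨⟨⟨_, (e.symm ⟨X - C x.1, hmem x x.2⟩).2.1, hbot _ (hnorm' x x.2)⟩,
      (hnorm' x x.2).symm ▸ hp.out⟩, hnorm' x x.2⟩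
  rw [degreeOneCount, ← Nat.card_coe_set_eq]
  refine (Nat.card_congr (Equiv.ofBijective g ⟨fun x y hxy ↦ ?_, fun P ↦ ?_⟩)).symm
  · have h1 := congrArg (fun P ↦ P.1.1.asIdeal) hxy
    have h2 := congrArg Subtype.val (e.symm.injective (Subtype.ext h1))
    exact Subtype.ext (C_injective (sub_right_injective h2))
  · obtain ⟨⟨P, hP⟩, hPp⟩ := P
    have hPp' : Ideal.absNorm P.asIdeal = p := hPp
    have hover : P.asIdeal ∈ Ideal.primesOver (Ideal.span {(p : ℤ)}) (𝓞 K) := by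
      refine ⟨P.isPrime, ⟨?_⟩⟩
      refine (Int.ideal_span_isMaximal_of_prime p).eq_of_le
        (Ideal.IsPrime.under ℤ P.asIdeal).ne_top ?_
      rw [Ideal.span_singleton_le_iff_mem, Ideal.under_def, Ideal.mem_comap]
      simpa [hPp'] using Ideal.absNorm_mem P.asIdeal
    have hQ := hnorm ⟨_, hover⟩
    set Q := e ⟨_, hover⟩ with hQe
    rw [hPp'] at hQ
    have hdeg : (Q : (ZMod p)[X]).natDegree = 1 := by
      have := Nat.pow_right_injective hp.out.two_le (hQ.symm.trans (pow_one p).symm)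
      exact this
    have hQm := (mem_normalizedFactors_iff' hf0).1 (Multiset.mem_toFinset.1 Q.2)
    have hmonic : (Q : (ZMod p)[X]).Monic := by
      rw [← hQm.2.1]
      exact monic_normalize hQm.1.ne_zero
    have hQX : (Q : (ZMod p)[X]) = X - C (-(Q : (ZMod p)[X]).coeff 0) := by
      conv_lhs => rw [hmonic.eq_X_add_C hdeg]
      simp
    refine ⟨⟨-(Q : (ZMod p)[X]).coeff 0, dvd_iff_isRoot.1 (hQX ▸ hQm.2.2)⟩, ?_⟩
    refine Subtype.ext (Subtype.ext (HeightOneSpectrum.ext ?_))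
    change (e.symm ⟨_, _⟩).1 = P.asIdeal
    have : (⟨X - C (-(Q : (ZMod p)[X]).coeff 0), hQX ▸ Q.2⟩ : monicFactorsMod θ p) = Q :=
      Subtype.ext hQX.symm
    rw [this, hQe, Equiv.symm_apply_apply]

end

section

/-- The number of roots of `m` modulo `p`. -/
noncomputable def rootCount (m : ℤ[X]) (p : ℕ) : ℕ :=
  ((Finset.range p).filter (fun x : ℕ ↦
    (m.map (Int.castRingHom (ZMod p))).eval ((x : ℕ) : ZMod p) = 0)).card

theorem rootCount_eq_card (m : ℤ[X]) (p : ℕ) [NeZero p] :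
    rootCount m p = Nat.card {x : ZMod p // (m.map (Int.castRingHom (ZMod p))).eval x = 0} := by
  rw [Nat.card_eq_fintype_card, Fintype.card_subtype, rootCount]
  refine Finset.card_bij (fun x _ ↦ (x : ZMod p)) (fun x hx ↦ ?_) (fun x hx y hy h ↦ ?_)
    fun x hx ↦ ⟨x.val, ?_, ZMod.natCast_zmod_val x⟩
  · simpa using (Finset.mem_filter.1 hx).2
  · rw [Finset.mem_filter, Finset.mem_range] at hx hy
    rw [← ZMod.val_cast_of_lt hx.1, h, ZMod.val_cast_of_lt hy.1]
  · rw [Finset.mem_filter, Finset.mem_range, ZMod.natCast_zmod_val]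
    exact ⟨ZMod.val_lt x, (Finset.mem_filter.1 hx).2⟩

theorem rootCount_integralNormalization {m : ℤ[X]} (hdeg : 1 ≤ m.natDegree) {p : ℕ}
    [Fact p.Prime] (hp : ¬ (p : ℤ) ∣ m.leadingCoeff) :
    rootCount m.integralNormalization p = rootCount m p := by
  have ha : (Int.castRingHom (ZMod p)) m.leadingCoeff ≠ 0 := by
    rwa [eq_intCast, Ne, ZMod.intCast_zmod_eq_zero_iff_dvd]
  rw [rootCount_eq_card, rootCount_eq_card]
  refine (Nat.card_congr ((Equiv.mulLeft₀ _ ha).subtypeEquiv fun x ↦ ?_)).symm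
  simp only [Equiv.mulLeft₀_apply, eval_map]
  rw [integralNormalization_eval₂_leadingCoeff_mul hdeg, mul_eq_zero,
    or_iff_right (pow_ne_zero _ ha)]

theorem exists_rootCount_eq_degreeOneCount {K : Type*} [Field K] [NumberField K] {m : ℤ[X]}
    (hm : Irreducible m) (hdeg : 1 ≤ m.natDegree) {α : K} (hroot : aeval α m = 0)
    (hα : IntermediateField.adjoin ℚ {α} = ⊤) :
    ∃ B : ℕ, ∀ p, p.Prime → B < p → rootCount m p = degreeOneCount K p := by
  have hm0 : m ≠ 0 := hm.ne_zero
  have hf : Irreducible (m.map (algebraMap ℤ ℚ)) :=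
    (IsPrimitive.Int.irreducible_iff_irreducible_map_cast (hm.isPrimitive (by lia))).1 hm
  have ha0 : (m.leadingCoeff : ℚ) ≠ 0 := by simpa using hm0
  have haα := integralNormalization_aeval_eq_zero hroot fun x hx ↦ by simpa using hx
  set N := m.integralNormalization with hN
  have hNmonic : N.Monic := monic_integralNormalization hm0
  set β : K := algebraMap ℤ K m.leadingCoeff * α with hβ
  let θ : 𝓞 K := ⟨β, N, hNmonic, haα⟩
  have hgen : IntermediateField.adjoin ℚ {(θ : K)} = ⊤ := by
    rw [eq_top_iff, ← hα, IntermediateField.adjoin_simple_le_iff]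
    have h1 : α = (m.leadingCoeff : ℚ)⁻¹ • β := by
      rw [hβ, ← Algebra.smul_def, ← Int.cast_smul_eq_zsmul ℚ, smul_smul,
        inv_mul_cancel₀ ha0, one_smul]
    rw [h1]
    exact IntermediateField.smul_mem _ (IntermediateField.mem_adjoin_simple_self ℚ β)
  have hfin : Module.finrank ℚ K = m.natDegree := by
    rw [← IntermediateField.finrank_top', ← hα, IntermediateField.adjoin.finrank (.of_finite ℚ _),
      ← minpoly.eq_of_irreducible hf ((aeval_map_algebraMap ℚ α m).trans hroot),
      natDegree_mul_C (inv_ne_zero (leadingCoeff_ne_zero.2 hf.ne_zero)),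
      natDegree_map_eq_of_injective (RingHom.injective_int (algebraMap ℤ ℚ))]
  have hmin : minpoly ℤ θ = N := by
    have hθ0 : aeval θ N = 0 := RingOfIntegers.coe_injective (by
      rw [← aeval_algebraMap_apply, map_zero]
      exact haα)
    refine (eq_of_monic_of_dvd_of_natDegree_le (minpoly.monic θ.isIntegral) hNmonic
      (minpoly.isIntegrallyClosed_dvd θ.isIntegral hθ0) ?_).symm
    rw [natDegree_integralNormalization, ← hfin, ← IntermediateField.finrank_top', ← hgen,
      IntermediateField.adjoin.finrank (.of_finite ℚ _),
      minpoly.isIntegrallyClosed_eq_field_fractions' ℚ θ.isIntegral_coe,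
      minpoly.algebraMap_eq RingOfIntegers.coe_injective]
    exact natDegree_map_le
  refine ⟨max m.leadingCoeff.natAbs (exponent θ), fun p hp hpB ↦ ?_⟩
  have := Fact.mk hp
  have hpm : ¬ (p : ℤ) ∣ m.leadingCoeff := fun h ↦
    (Nat.le_of_dvd (by simpa [Nat.pos_iff_ne_zero] using hm0) (Int.natCast_dvd.1 h)).not_gt
      ((le_max_left _ _).trans_lt hpB)
  have hpθ : ¬ p ∣ exponent θ := fun h ↦
    (Nat.le_of_dvd (Nat.pos_of_ne_zero (exponent_ne_zero_of_adjoin_eq_top hgen)) h).not_gt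
      ((le_max_right _ _).trans_lt hpB)
  rw [degreeOneCount_eq_card_roots hpθ, hmin, ← rootCount_eq_card,
    rootCount_integralNormalization hdeg hpm]

theorem exists_numberField_rootCount_eq {m : ℤ[X]} (hm : Irreducible m) (hdeg : 1 ≤ m.natDegree) :
    ∃ (K : Type) (_ : Field K) (_ : NumberField K) (B : ℕ),
      ∀ p, p.Prime → B < p → rootCount m p = degreeOneCount K p := by
  have hf : Irreducible (m.map (algebraMap ℤ ℚ)) :=
    (IsPrimitive.Int.irreducible_iff_irreducible_map_cast (hm.isPrimitive (by lia))).1 hm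
  set f := m.map (algebraMap ℤ ℚ) with hfdef
  have := Fact.mk hf
  have hfin : FiniteDimensional ℚ (AdjoinRoot f) := (AdjoinRoot.powerBasis hf.ne_zero).finite
  have hK : NumberField (AdjoinRoot f) := { }
  have hroot : aeval (AdjoinRoot.root f) m = 0 := by
    rw [← aeval_map_algebraMap ℚ]
    exact (AdjoinRoot.aeval_eq f).trans AdjoinRoot.mk_self
  have htop := (AdjoinRoot.powerBasis hf.ne_zero).adjoin_gen_eq_top
  rw [AdjoinRoot.powerBasis_gen] at htop
  have htop' := IntermediateField.adjoin_eq_top_of_algebra ℚ {AdjoinRoot.root f} htop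
  refine ⟨AdjoinRoot f, inferInstance, hK,
    exists_rootCount_eq_degreeOneCount hm hdeg (α := AdjoinRoot.root f) hroot ?_⟩
  convert htop'

end

end

section

open Filter Topology Polynomial

section

theorem tendsto_sum_mul_log_div_of_eventually_eq {f g : ℕ → ℝ} {B : ℕ} {l : ℝ}
    (hfg : ∀ p, p.Prime → B < p → f p = g p)
    (hg : Tendsto (fun n : ℕ ↦ (∑ p ∈ (Finset.range (n + 1)).filter Nat.Prime, g p) *
      (Real.log n / n)) atTop (𝓝 l)) :
    Tendsto (fun n : ℕ ↦ (∑ p ∈ (Finset.range (n + 1)).filter Nat.Prime, f p) *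
      (Real.log n / n)) atTop (𝓝 l) := by
  have hlog : Tendsto (fun n : ℕ ↦ Real.log n / n) atTop (𝓝 0) :=
    Real.isLittleO_log_id_atTop.tendsto_div_nhds_zero.comp tendsto_natCast_atTop_atTop
  set c := ∑ p ∈ (Finset.range (B + 1)).filter Nat.Prime, (f p - g p) with hc
  have h := hg.add (hlog.const_mul c)
  rw [mul_zero, add_zero] at h
  refine h.congr' ?_
  filter_upwards [eventually_ge_atTop B] with n hn
  have hsub : (Finset.range (B + 1)).filter Nat.Prime ⊆ (Finset.range (n + 1)).filter Nat.Prime :=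
    Finset.filter_subset_filter _ (Finset.range_mono (by lia))
  rw [← add_mul, hc, Finset.sum_subset hsub, ← Finset.sum_add_distrib]
  · simp
  · intro p hp hpB
    rw [Finset.mem_filter] at hp hpB
    rw [hfg p hp.2 (by by_contra hlt; exact hpB ⟨Finset.mem_range.2 (by lia), hp.2⟩), sub_self]

theorem tendsto_sum_rootCount_mul_log_div {m : ℤ[X]} (hm : Irreducible m)
    (hdeg : 1 ≤ m.natDegree) :
    Tendsto (fun n : ℕ ↦ (∑ p ∈ (Finset.range (n + 1)).filter Nat.Prime, (rootCount m p : ℝ)) *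
      (Real.log n / n)) atTop (𝓝 1) := by
  obtain ⟨K, _, _, B, hB⟩ := exists_numberField_rootCount_eq hm hdeg
  exact tendsto_sum_mul_log_div_of_eventually_eq (B := B)
    (fun p hp hpB ↦ congrArg Nat.cast (hB p hp hpB))
    (tendsto_sum_mul_log_div (fun _ ↦ Nat.cast_nonneg _)
      (fun p ↦ Nat.cast_le.2 (degreeOneCount_le K p)) (tendsto_sum_degreeOneCount_mul_log K))

theorem tendsto_card_primes_mul_log_div :
    Tendsto (fun n : ℕ ↦ (((Finset.range (n + 1)).filter Nat.Prime).card : ℝ) *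
      (Real.log n / n)) atTop (𝓝 1) := by
  refine (tendsto_sum_rootCount_mul_log_div (m := X) irreducible_X (by simp)).congr fun n ↦ ?_
  rw [Finset.card_eq_sum_ones, Nat.cast_sum]
  congr 1
  refine Finset.sum_congr rfl fun p hp ↦ congrArg Nat.cast ?_
  have := Fact.mk (Finset.mem_filter.1 hp).2
  simp [rootCount_eq_card]

end

end

open Polynomial in
theorem stmt16 (m : Polynomial ℤ) (hm : Irreducible m) (hdeg : 1 ≤ m.natDegree) :
    Filter.Tendsto
      (fun X : ℕ =>
        (1 / (((Finset.range (X + 1)).filter Nat.Prime).card : ℝ)) *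
          ∑ p ∈ (Finset.range (X + 1)).filter Nat.Prime,
            (((Finset.range p).filter (fun x : ℕ =>
              (m.map (Int.castRingHom (ZMod p))).eval ((x : ℕ) : ZMod p) = 0)).card : ℝ))
      Filter.atTop (nhds 1) := by
  have h := (tendsto_sum_rootCount_mul_log_div hm hdeg).div tendsto_card_primes_mul_log_div
    one_ne_zero
  rw [div_one] at h
  refine h.congr' ?_
  filter_upwards [Filter.eventually_ge_atTop 2] with n hn
  have hn0 : (0 : ℝ) < n := by positivity
  have hlog : 0 < Real.log n := Real.log_pos (by exact_mod_cast hn)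
  rw [Pi.div_apply, mul_div_mul_right _ _ (div_pos hlog hn0).ne', div_eq_inv_mul, ← one_div]
  rfl
end

section
/- Let p > 2 be prime and let f(x) ∈ 𝔽_p[x] be a cubic polynomial with no repeated root. Then ∑_{x ∈ 𝔽_p} φ_p(f(x)) = −a_p(E), where E is the elliptic curve y² = f(x) over 𝔽_p and a_p(E) = p + 1 − #E(𝔽_p) is the trace of Frobenius; consequently |∑_{x ∈ 𝔽_p} φ_p(f(x))| ≤ 2√p. -/
namespace HasseBound

open Polynomial WeierstrassCurve WeierstrassCurve.Affine

/-- The Weierstrass curve `y² = x³ + a x² + b x + c`. -/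
abbrev cubicCurve {R : Type*} [CommRing R] (a b c : R) : WeierstrassCurve R := ⟨0, a, 0, b, c⟩

section AddSub

variable {K : Type*} [Field K] [DecidableEq K] {a b c : K}

lemma eval_addSubMap {R : Type*} [CommRing R] (a b c : R) (v : Fin 3 → R) (i : Fin 3) :
    (addSubMap (cubicCurve a b c) i).eval v =
      ![v 0 ^ 2 - 2 * b * v 0 * v 2 - 4 * c * v 1 * v 2 - (4 * a * c - b ^ 2) * v 2 ^ 2,
        2 * v 1 * v 0 + 4 * a * v 0 * v 2 + 2 * b * v 1 * v 2 + 4 * c * v 2 ^ 2,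
        v 1 ^ 2 - 4 * v 0 * v 2] i := by
  fin_cases i <;> simp [addSubMap, b₂, b₄, b₆, b₈]

/-- `addSubMap` sends `(x(P) x(Q) : x(P) + x(Q) : 1)` to
`(x(P+Q) x(P-Q) : x(P+Q) + x(P-Q) : 1)`. -/
lemma exists_eval_addSubMap_sym2x (P Q : (cubicCurve a b c).toAffine.Point) :
    ∃ k : K, ∀ i, (addSubMap (cubicCurve a b c) i).eval (P.sym2x Q) =
      k * (P + Q).sym2x (P - Q) i := by
  simp only [eval_addSubMap]
  rcases P with _ | ⟨x₁, y₁, h₁⟩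
  · refine ⟨1, fun i ↦ ?_⟩
    rcases Q with _ | ⟨x₂, y₂, h₂⟩
    · rw [← Point.zero_def]
      fin_cases i <;> simp
    · rw [← Point.zero_def, zero_add, zero_sub, Point.sym2x_neg_right]
      fin_cases i <;> simp <;> ring
  rcases Q with _ | ⟨x₂, y₂, h₂⟩
  · refine ⟨1, fun i ↦ ?_⟩
    rw [← Point.zero_def, add_zero, sub_zero]
    fin_cases i <;> simp <;> ring
  have e₁ := (equation_iff _ _).mp h₁.1
  have e₂ := (equation_iff _ _).mp h₂.1
  simp only [zero_mul, add_zero] at e₁ e₂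
  rw [sub_eq_add_neg (Point.some _ _ h₁), Point.neg_some]
  by_cases hx : x₁ = x₂
  · subst hx
    have hy : y₁ = y₂ ∨ y₁ = -y₂ := sq_eq_sq_iff_eq_or_eq_neg.mp (e₁.trans e₂.symm)
    by_cases h0 : y₁ = -y₁
    · have h12 : y₁ = y₂ := by
        rcases hy with h | h
        · exact h
        · rw [h0, h, neg_neg]
      subst h12
      have h4 : 4 * y₁ ^ 2 = 0 := by linear_combination 2 * y₁ * h0
      rw [Point.add_of_Y_eq rfl (by simpa [negY] using h0),
        Point.add_of_Y_eq rfl (by simp [negY]), Point.sym2x_zero_zero, Point.sym2x_some_some]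
      refine ⟨x₁ ^ 4 - 2 * b * x₁ ^ 2 - 8 * c * x₁ - (4 * a * c - b ^ 2), fun i ↦ ?_⟩
      fin_cases i
      · simp
        ring
      · simp
        linear_combination h4 - 4 * e₁
      · simp
        ring
    · have hd : 2 * y₁ ≠ 0 := fun h ↦ h0 (by linear_combination h)
      have h2 : (2 : K) ≠ 0 := left_ne_zero_of_mul hd
      have hy0 : y₁ ≠ 0 := right_ne_zero_of_mul hd
      refine ⟨(2 * y₁) ^ 2, ?_⟩
      rcases hy with rfl | rfl
      · rw [Point.add_of_Y_ne (by simpa [negY] using h0),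
          Point.add_of_Y_eq rfl (by simp [negY]), Point.sym2x_some_zero, Point.sym2x_some_some]
        intro i
        have hs : (cubicCurve a b c).toAffine.slope x₁ x₁ y₁ y₁ =
            (3 * x₁ ^ 2 + 2 * a * x₁ + b) / (2 * y₁) := by
          rw [slope_of_Y_ne rfl (by simpa [negY] using h0)]
          simp [negY, two_mul]
        rw [hs]
        fin_cases i
        · simp [addX]
          field_simp
          linear_combination 4 * (a + 2 * x₁) * e₁
        · simp
          linear_combination - 4 * e₁
        · simp
          ring
      · rw [Point.add_of_Y_eq rfl (by simp [negY]),
          Point.add_of_Y_ne (by simpa [negY] using h0),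
          Point.sym2x_zero_some, Point.sym2x_some_some]
        intro i
        have hs : (cubicCurve a b c).toAffine.slope x₁ x₁ (-y₂)
            ((cubicCurve a b c).toAffine.negY x₁ y₂) =
            (3 * x₁ ^ 2 + 2 * a * x₁ + b) / (2 * -y₂) := by
          rw [slope_of_Y_ne rfl (by simpa [negY] using h0)]
          simp [negY, two_mul, sub_eq_add_neg]
        rw [hs]
        fin_cases i
        · have hy2 : y₂ ≠ 0 := neg_ne_zero.mp hy0
          simp [addX]
          field_simp
          linear_combination 4 * (a + 2 * x₁) * e₁
        · simp
          linear_combination - 4 * e₁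
        · simp
          ring
  · have hd : x₁ - x₂ ≠ 0 := sub_ne_zero.mpr hx
    refine ⟨(x₁ - x₂) ^ 2, ?_⟩
    rw [Point.add_of_X_ne hx, Point.add_of_X_ne hx, Point.sym2x_some_some, Point.sym2x_some_some,
      slope_of_X_ne hx, slope_of_X_ne hx]
    intro i
    fin_cases i
    · simp [addX, negY]
      field_simp
      linear_combination (- (y₁ ^ 2 - y₂ ^ 2 + (x₁ ^ 3 + a * x₁ ^ 2 + b * x₁) -
        (x₂ ^ 3 + a * x₂ ^ 2 + b * x₂))) * (e₁ - e₂) +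
        2 * (a + x₁ + x₂) * (x₁ - x₂) ^ 2 * (e₁ + e₂)
    · simp [addX, negY]
      field_simp
      linear_combination -2 * e₁ - 2 * e₂
    · simp
      ring

end AddSub

section Unimodular

variable {R ι : Type*} [CommRing R]

/-- A vector whose entries generate the unit ideal. -/
def IsUnimodular (v : ι → R) : Prop := Ideal.span (Set.range v) = ⊤

lemma isUnimodular_iff {v : ι → R} :
    IsUnimodular v ↔ ∀ M : Ideal R, M.IsPrime → ∃ i, v i ∉ M := by
  constructor
  · intro h M hM
    by_contra! hv
    refine hM.ne_top (top_le_iff.mp (h ▸ Ideal.span_le.mpr ?_))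
    rintro _ ⟨i, rfl⟩
    exact hv i
  · intro h
    by_contra hv
    obtain ⟨M, hM, hle⟩ := Ideal.exists_le_maximal _ hv
    obtain ⟨i, hi⟩ := h M hM.isPrime
    exact hi (hle (Ideal.subset_span ⟨i, rfl⟩))

lemma isUnimodular_of_isCoprime {x y : R} (h : IsCoprime x y) : IsUnimodular ![x, y] := by
  rw [IsUnimodular, Matrix.range_cons_cons_empty]
  exact (Ideal.isCoprime_span_singleton_iff x y).mpr h |>.sup_eq ▸ Ideal.span_insert x {y}

/-- If `u` and `v` are the coefficient vectors of binary linear forms, `symProd u v` is that of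
their product. -/
def symProd (u v : Fin 2 → R) : Fin 3 → R :=
  ![u 0 * v 0, u 0 * v 1 + u 1 * v 0, u 1 * v 1]

lemma symProd_ne_zero [IsDomain R] {u v : Fin 2 → R} (hu : ∃ i, u i ≠ 0) (hv : ∃ i, v i ≠ 0) :
    ∃ i, symProd u v i ≠ 0 := by
  by_contra! h
  have h0 := h 0
  have h1 := h 1
  have h2 := h 2
  simp only [symProd, Matrix.cons_val] at h0 h1 h2
  simp only [Fin.exists_fin_two] at hu hv
  rw [mul_eq_zero] at h0 h2
  rcases h0 with h0 | h0 <;> rcases h2 with h2 | h2 <;> simp_all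

lemma IsUnimodular.symProd {u v : Fin 2 → R} (hu : IsUnimodular u) (hv : IsUnimodular v) :
    IsUnimodular (symProd u v) := by
  rw [isUnimodular_iff] at hu hv ⊢
  intro M hM
  obtain ⟨i, hi⟩ := symProd_ne_zero (u := Ideal.Quotient.mk M ∘ u) (v := Ideal.Quotient.mk M ∘ v)
    (by simpa [Ideal.Quotient.eq_zero_iff_mem] using hu M hM)
    (by simpa [Ideal.Quotient.eq_zero_iff_mem] using hv M hM)
  refine ⟨i, fun h ↦ hi ?_⟩
  rw [← Ideal.Quotient.eq_zero_iff_mem] at h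
  rw [← h]
  fin_cases i <;> simp [HasseBound.symProd]

lemma IsUnimodular.addSubMap (W : WeierstrassCurve R) [W.IsElliptic] {v : Fin 3 → R}
    (hv : IsUnimodular v) : IsUnimodular fun i ↦ (W.addSubMap i).eval v := by
  rw [isUnimodular_iff] at hv ⊢
  intro M hM
  obtain ⟨i, hi⟩ := hv M hM
  by_contra! h
  refine hi (hM.mem_of_pow_mem 4 ?_)
  rw [← W.addSubMapCoeff_condition v i]
  exact M.sum_mem fun j _ ↦ M.mul_mem_left _ (h j)

/-- Two proportional unimodular vectors divide each other. -/
lemma IsUnimodular.dvd [Finite ι] {u v : ι → R} (hu : IsUnimodular u)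
    (h : ∀ i j, u i * v j = u j * v i) (j : ι) : u j ∣ v j := by
  have h1 : (1 : R) ∈ Ideal.span (Set.range u) := hu ▸ Submodule.mem_top
  have := Fintype.ofFinite ι
  obtain ⟨c, hc⟩ := (Ideal.mem_span_range_iff_exists_fun).mp h1
  refine ⟨∑ i, c i * v i, ?_⟩
  rw [Finset.mul_sum, ← one_mul (v j), ← hc, Finset.sum_mul]
  exact Finset.sum_congr rfl fun i _ ↦ by linear_combination c i * h i j

end Unimodular

section MaxDegree

variable {F ι : Type*} [Field F]

/-- The maximum of the degrees of the entries of `v` is `m`, and `v ≠ 0`. -/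
def HasMaxDegree (v : ι → F[X]) (m : ℕ) : Prop :=
  (∀ i, (v i).natDegree ≤ m) ∧ ∃ i, (v i).coeff m ≠ 0

lemma HasMaxDegree.symProd {u v : Fin 2 → F[X]} {m n : ℕ} (hu : HasMaxDegree u m)
    (hv : HasMaxDegree v n) : HasMaxDegree (symProd u v) (m + n) := by
  have hd (i j) : (u i * v j).natDegree ≤ m + n := natDegree_mul_le_of_le (hu.1 i) (hv.1 j)
  have hc (i j) : (u i * v j).coeff (m + n) = (u i).coeff m * (v j).coeff n :=
    coeff_mul_add_eq_of_natDegree_le (hu.1 i) (hv.1 j)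
  constructor
  · intro i
    fin_cases i
    · exact hd 0 0
    · exact natDegree_add_le_of_degree_le (hd 0 1) (hd 1 0)
    · exact hd 1 1
  · obtain ⟨i, hi⟩ := symProd_ne_zero (u := fun i ↦ (u i).coeff m) (v := fun i ↦ (v i).coeff n)
      hu.2 hv.2
    refine ⟨i, fun h ↦ hi ?_⟩
    rw [← h]
    fin_cases i <;> simp [HasseBound.symProd, hc]

lemma HasMaxDegree.addSubMap (a b c : F) [(cubicCurve a b c).IsElliptic] {v : Fin 3 → F[X]}
    {m : ℕ} (hv : HasMaxDegree v m) :
    HasMaxDegree (fun i ↦ ((cubicCurve (C a) (C b) (C c)).addSubMap i).eval v) (2 * m) := by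
  have hd (r : F) (i j) : (C r * (v i * v j)).natDegree ≤ 2 * m :=
    (natDegree_C_mul_le _ _).trans (two_mul m ▸ natDegree_mul_le_of_le (hv.1 i) (hv.1 j))
  have hc (r : F) (i j) : (C r * (v i * v j)).coeff (2 * m) =
      r * ((v i).coeff m * (v j).coeff m) := by
    rw [coeff_C_mul, two_mul, coeff_mul_add_eq_of_natDegree_le (hv.1 i) (hv.1 j)]
  have h2 : (C 2 : F[X]) = 2 := map_ofNat C 2
  have h4 : (C 4 : F[X]) = 4 := map_ofNat C 4
  have e0 : ((cubicCurve (C a) (C b) (C c)).addSubMap 0).eval v =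
      C 1 * (v 0 * v 0) + C (-2 * b) * (v 0 * v 2) + C (-4 * c) * (v 1 * v 2) +
        C (-(4 * a * c - b ^ 2)) * (v 2 * v 2) := by
    simp [eval_addSubMap, h2, h4]
    ring
  have e1 : ((cubicCurve (C a) (C b) (C c)).addSubMap 1).eval v =
      C 2 * (v 1 * v 0) + C (4 * a) * (v 0 * v 2) + C (2 * b) * (v 1 * v 2) +
        C (4 * c) * (v 2 * v 2) := by
    simp [eval_addSubMap, h2, h4]
    ring
  have e2 : ((cubicCurve (C a) (C b) (C c)).addSubMap 2).eval v =
      C 1 * (v 1 * v 1) + C (-4) * (v 0 * v 2) := by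
    simp [eval_addSubMap, h4]
    ring
  constructor
  · intro i
    fin_cases i
    · refine (congrArg natDegree e0).trans_le <|
        natDegree_add_le_of_degree_le (natDegree_add_le_of_degree_le
        (natDegree_add_le_of_degree_le (hd _ _ _) (hd _ _ _)) (hd _ _ _)) (hd _ _ _)
    · refine (congrArg natDegree e1).trans_le <|
        natDegree_add_le_of_degree_le (natDegree_add_le_of_degree_le
        (natDegree_add_le_of_degree_le (hd _ _ _) (hd _ _ _)) (hd _ _ _)) (hd _ _ _)
    · refine (congrArg natDegree e2).trans_le <| natDegree_add_le_of_degree_le (hd _ _ _) (hd _ _ _)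
  · obtain ⟨i, hi⟩ := Function.ne_iff.mp <| addSubMap_ne_zero (cubicCurve a b c)
      (x := fun i ↦ (v i).coeff m) (Function.ne_iff.mpr hv.2)
    refine ⟨i, fun h ↦ hi ?_⟩
    simp only [Pi.zero_apply]
    rw [← h, eval_addSubMap]
    fin_cases i
    · simp only [Fin.zero_eta, e0, coeff_add, hc, Matrix.cons_val]
      ring
    · simp only [Fin.mk_one, e1, coeff_add, hc, Matrix.cons_val]
      ring
    · simp only [Fin.reduceFinMk, e2, coeff_add, hc, Matrix.cons_val]
      ring

lemma HasMaxDegree.le_of_dvd {u v : ι → F[X]} {m n : ℕ} (hu : HasMaxDegree u m)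
    (hv : HasMaxDegree v n) (huv : ∀ i, u i ∣ v i) (hvu : ∀ i, v i ∣ u i) : m ≤ n := by
  obtain ⟨i, hi⟩ := hu.2
  have hu0 : u i ≠ 0 := fun h ↦ hi (by simp [h])
  have hv0 : v i ≠ 0 := fun h ↦ hu0 (zero_dvd_iff.mp (h ▸ hvu i))
  exact (le_natDegree_of_ne_zero hi).trans ((natDegree_le_of_dvd (huv i) hv0).trans (hv.1 i))

lemma IsUnimodular.exists_hasMaxDegree [Finite ι] {v : ι → F[X]} (hv : IsUnimodular v) :
    ∃ m, HasMaxDegree v m := by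
  obtain ⟨i₀, h₀⟩ := isUnimodular_iff.mp hv ⊥ Ideal.isPrime_bot
  have : Nonempty ι := ⟨i₀⟩
  obtain ⟨i, hi⟩ := Finite.exists_max fun i ↦ (v i).natDegree
  by_cases h : v i = 0
  · refine ⟨(v i₀).natDegree, fun j ↦ ?_, i₀, by simpa using h₀⟩
    exact (hi j).trans (by simp [h])
  · exact ⟨(v i).natDegree, hi, i, by simpa using h⟩

lemma IsUnimodular.maxDegree_eq [Finite ι] {u v : ι → F[X]} {m n : ℕ} (hu : IsUnimodular u)
    (hv : IsUnimodular v) (hum : HasMaxDegree u m) (hvn : HasMaxDegree v n)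
    (h : ∀ i j, u i * v j = u j * v i) : m = n := by
  have huv := hu.dvd h
  have hvu := hv.dvd (fun i j ↦ by rw [mul_comm, h, mul_comm] : ∀ i j, v i * u j = v j * u i)
  exact le_antisymm (hum.le_of_dvd hvn huv hvu) (hvn.le_of_dvd hum hvu huv)

end MaxDegree

section Height

variable {F K : Type*} [Field F] [Field K] [Algebra F[X] K] {a b c : F} {D : F[X]}

variable (K a b c D) in
/-- The quadratic twist by `D` of the curve `y² = x³ + a x² + b x + c`. -/
noncomputable abbrev twist : WeierstrassCurve K :=
  cubicCurve (algebraMap F[X] K (D * C a)) (algebraMap F[X] K (D ^ 2 * C b))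
    (algebraMap F[X] K (D ^ 3 * C c))

/-- The rational function `x(P) / D` is a quotient of coprime polynomials whose maximal degree
is `n`. -/
def HasHeight (P : (twist K a b c D).toAffine.Point) (n : ℕ) : Prop :=
  ∃ u : Fin 2 → F[X], IsUnimodular u ∧ HasMaxDegree u n ∧
    ∃ k : K, k ≠ 0 ∧ P.xRep = ![k * algebraMap F[X] K (D * u 0), k * algebraMap F[X] K (u 1)]

lemma hasHeight_zero [IsFractionRing F[X] K] (hD : D ≠ 0) :
    HasHeight (0 : (twist K a b c D).toAffine.Point) 0 := by
  have hD' : algebraMap F[X] K D ≠ 0 := by simpa using hD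
  refine ⟨![1, 0], isUnimodular_of_isCoprime isCoprime_one_left, ⟨?_, 0, by simp⟩,
    (algebraMap F[X] K D)⁻¹, inv_ne_zero hD', by simp [hD']⟩
  intro i
  fin_cases i <;> simp

lemma exists_hasHeight [IsFractionRing F[X] K] (hD : D ≠ 0)
    (P : (twist K a b c D).toAffine.Point) : ∃ n, HasHeight P n := by
  rcases P with _ | ⟨x, y, h⟩
  · exact ⟨0, hasHeight_zero hD⟩
  have hD' : algebraMap F[X] K D ≠ 0 := by simpa using hD
  obtain ⟨r, s, hrs, hx⟩ := IsFractionRing.exists_reduced_fraction (A := F[X])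
    (x / algebraMap F[X] K D)
  have hs : algebraMap F[X] K s ≠ 0 := by simp
  have hu := isUnimodular_of_isCoprime hrs.isCoprime
  obtain ⟨n, hn⟩ := hu.exists_hasMaxDegree
  refine ⟨n, _, hu, hn, (algebraMap F[X] K s)⁻¹, inv_ne_zero hs, ?_⟩
  rw [IsFractionRing.mk'_eq_div, eq_div_iff hD'] at hx
  rw [Point.xRep_some, ← hx]
  simp only [Matrix.cons_val, map_mul, inv_mul_cancel₀ hs]
  congr 1
  field_simp

variable [DecidableEq K]

/-- The parallelogram law. -/
lemma HasHeight.add_sub [IsFractionRing F[X] K] [(cubicCurve a b c).IsElliptic] (hD : D ≠ 0)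
    {P Q : (twist K a b c D).toAffine.Point} {m n r s : ℕ} (hP : HasHeight P m)
    (hQ : HasHeight Q n) (hr : HasHeight (P + Q) r) (hs : HasHeight (P - Q) s) :
    r + s = 2 * (m + n) := by
  obtain ⟨u₁, hu₁, hm, k₁, hk₁, e₁⟩ := hP
  obtain ⟨u₂, hu₂, hn, k₂, hk₂, e₂⟩ := hQ
  obtain ⟨u₃, hu₃, hr, k₃, hk₃, e₃⟩ := hr
  obtain ⟨u₄, hu₄, hs, k₄, hk₄, e₄⟩ := hs
  have : (cubicCurve (C a) (C b) (C c)).IsElliptic := by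
    have := (cubicCurve a b c).isUnit_Δ.map (C : F →+* F[X])
    refine ⟨?_⟩
    convert this
    rw [← map_Δ]
    simp [WeierstrassCurve.map]
  refine ((hu₃.symProd hu₄).maxDegree_eq ((hu₁.symProd hu₂).addSubMap _) (hr.symProd hs)
    ((hm.symProd hn).addSubMap a b c) ?_)
  obtain ⟨k, hk⟩ := exists_eval_addSubMap_sym2x P Q
  have hD' : algebraMap F[X] K D ≠ 0 := by simpa using hD
  set v := HasseBound.symProd u₁ u₂ with hv
  have h2 : algebraMap F[X] K 2 = 2 := map_ofNat _ 2
  have h4 : algebraMap F[X] K 4 = 4 := map_ofNat _ 4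
  have hl (i) : (addSubMap (twist K a b c D) i).eval (P.sym2x Q) =
      (k₁ * k₂ * algebraMap F[X] K D) ^ 2 * (![algebraMap F[X] K D ^ 2, algebraMap F[X] K D, 1] i *
        algebraMap F[X] K (((cubicCurve (C a) (C b) (C c)).addSubMap i).eval v)) := by
    simp only [eval_addSubMap, Point.sym2x, e₁, e₂, hv, HasseBound.symProd]
    fin_cases i <;> simp [h2, h4] <;> ring
  have hrr (i) : (P + Q).sym2x (P - Q) i = k₃ * k₄ *
      (![algebraMap F[X] K D ^ 2, algebraMap F[X] K D, 1] i *
        algebraMap F[X] K (HasseBound.symProd u₃ u₄ i)) := by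
    simp only [Point.sym2x, e₃, e₄, HasseBound.symProd]
    fin_cases i <;> simp <;> ring
  simp only [hl, hrr] at hk
  have hd : ∀ i : Fin 3, ![algebraMap F[X] K D ^ 2, algebraMap F[X] K D, 1] i ≠ 0 := by
    intro i
    fin_cases i <;> simp [hD']
  intro i j
  apply IsFractionRing.injective F[X] K
  have hne : (k₁ * k₂ * algebraMap F[X] K D) ^ 2 ≠ 0 :=
    pow_ne_zero _ (mul_ne_zero (mul_ne_zero hk₁ hk₂) hD')
  rw [map_mul, map_mul]
  refine mul_left_cancel₀ (mul_ne_zero hne (mul_ne_zero (hd i) (hd j))) ?_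
  linear_combination ![algebraMap F[X] K D ^ 2, algebraMap F[X] K D, 1] i *
    algebraMap F[X] K (HasseBound.symProd u₃ u₄ i) * hk j -
    ![algebraMap F[X] K D ^ 2, algebraMap F[X] K D, 1] j *
    algebraMap F[X] K (HasseBound.symProd u₃ u₄ j) * hk i

lemma HasHeight.unique [IsFractionRing F[X] K] [(cubicCurve a b c).IsElliptic] (hD : D ≠ 0)
    {P : (twist K a b c D).toAffine.Point} {m n : ℕ} (hm : HasHeight P m) (hn : HasHeight P n) :
    m = n := by
  have h := hm.add_sub hD (hasHeight_zero hD) (r := n) (s := n) (by simpa using hn)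
    (by simpa using hn)
  omega

/-- Heights along an arithmetic progression in the group of points are quadratic. -/
lemma HasHeight.add_zsmul [IsFractionRing F[X] K] [(cubicCurve a b c).IsElliptic] (hD : D ≠ 0)
    {P Q : (twist K a b c D).toAffine.Point} {l m r : ℕ} (hP : HasHeight P l)
    (hQ : HasHeight Q m) (hr : HasHeight (Q - P) r) {n : ℤ} {d : ℕ}
    (hd : HasHeight (Q + n • P) d) : (d : ℤ) = l * n ^ 2 + (m + l - r) * n + m := by
  choose h hh using fun n : ℤ ↦ exists_hasHeight hD (Q + n • P)
  have h0 : h 0 = m := (hh 0).unique hD (by simpa using hQ)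
  have h1 : h (-1) = r := (hh (-1)).unique hD (by simpa [sub_eq_add_neg] using hr)
  have hadd (n : ℤ) : Q + (n + 1) • P = Q + n • P + P := by
    rw [_root_.add_zsmul, one_zsmul, add_assoc]
  have hsub (n : ℤ) : Q + (n - 1) • P = Q + n • P - P := by
    rw [sub_zsmul, one_zsmul, add_sub_assoc, sub_eq_add_neg]
  have hstep (n : ℤ) : (h (n + 1) : ℤ) + h (n - 1) = 2 * (h n + l) := by
    exact_mod_cast (hh n).add_sub hD hP
      (hadd n ▸ hh (n + 1))
      (hsub n ▸ hh (n - 1))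
  rw [hd.unique hD (hh n)]
  have key (n : ℤ) : (h n : ℤ) = l * n ^ 2 + (m + l - r) * n + m ∧
      (h (n - 1) : ℤ) = l * (n - 1) ^ 2 + (m + l - r) * (n - 1) + m := by
    induction n using Int.induction_on with
    | zero =>
      simp only [zero_sub, h0, h1]
      constructor <;> ring
    | succ i ih =>
      rw [add_sub_cancel_right]
      refine ⟨?_, ih.1⟩
      linear_combination hstep i - ih.2 + 2 * ih.1
    | pred i ih =>
      refine ⟨ih.2, ?_⟩
      have := hstep (-i - 1)
      rw [sub_add_cancel] at this
      linear_combination this - ih.1 + 2 * ih.2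
  exact (key n).1

end Height

section Numerator

/-- The polynomial `x³ + a x² + b x + c`. -/
noncomputable def cubicPoly {R : Type*} [CommRing R] (a b c : R) : R[X] :=
  X ^ 3 + C a * X ^ 2 + C b * X + C c

lemma natDegree_cubicPoly {F : Type*} [Field F] (a b c : F) : (cubicPoly a b c).natDegree = 3 := by
  rw [cubicPoly]
  compute_degree!

lemma card_eq_two_mul_add_one {F : Type*} [Field F] [Fintype F] (hF : ringChar F ≠ 2) :
    Fintype.card F = 2 * (Fintype.card F / 2) + 1 := by
  have := FiniteField.odd_card_of_char_ne_two hF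
  omega

lemma one_le_card_div_two {F : Type*} [Field F] [Fintype F] : 1 ≤ Fintype.card F / 2 := by
  have := Fintype.one_lt_card (α := F)
  omega

variable {F : Type*} [Field F] [Fintype F]

lemma prod_X_sub_C_eq : ∏ α : F, (X - C α) = X ^ Fintype.card F - X := by
  have h := FiniteField.X_pow_card_sub_X_natDegree_eq F (Fintype.one_lt_card (α := F))
  have hm : (X ^ Fintype.card F - X : F[X]).Monic :=
    monic_X_pow_sub (by simpa using Fintype.one_lt_card (α := F))
  have hr := FiniteField.roots_X_pow_card_sub_X F
  have := prod_multiset_X_sub_C_of_monic_of_roots_card_eq hm (by rw [hr, h]; rfl)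
  rw [hr] at this
  exact this

variable (a b c : F)

/-- With `q = #F` and `D = x³ + a x² + b x + c`, the numerator of the `x`-coordinate, divided by
`D`, of the difference of the points `(D x^q, D ^ ((q + 3) / 2))` and `(D x, D ^ 2)`. -/
noncomputable def numerator : F[X] :=
  cubicPoly a b c * (cubicPoly a b c ^ (Fintype.card F / 2) + 1) ^ 2 -
    (C a + X + X ^ Fintype.card F) * (X ^ Fintype.card F - X) ^ 2

lemma cubicPoly_pow_card : cubicPoly a b c ^ Fintype.card F =
    X ^ (3 * Fintype.card F) + C a * X ^ (2 * Fintype.card F) + C b * X ^ Fintype.card F + C c := by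
  rw [← FiniteField.expand_card]
  simp only [cubicPoly, map_add, map_mul, map_pow, expand_X, expand_C]
  ring

variable {a b c}

lemma numerator_eq (hF : ringChar F ≠ 2) : numerator a b c = X ^ (2 * Fintype.card F + 1) +
    (C b * X ^ Fintype.card F + C c + cubicPoly a b c +
      C 2 * (cubicPoly a b c * cubicPoly a b c ^ (Fintype.card F / 2)) +
      C (2 * a) * X ^ (Fintype.card F + 1) + C (-a) * X ^ 2 + X ^ (Fintype.card F + 2) +
      C (-1) * X ^ 3) := by
  have h : cubicPoly a b c * (cubicPoly a b c ^ (Fintype.card F / 2)) ^ 2 =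
      cubicPoly a b c ^ Fintype.card F := by
    conv_rhs => rw [card_eq_two_mul_add_one hF]
    ring
  have h2 : (C 2 : F[X]) = 2 := map_ofNat C 2
  rw [cubicPoly_pow_card] at h
  rw [numerator]
  simp only [C_mul, C_neg, C_1, h2]
  linear_combination h

lemma monic_numerator_and_natDegree (hF : ringChar F ≠ 2) :
    (numerator a b c).Monic ∧ (numerator a b c).natDegree = 2 * Fintype.card F + 1 := by
  have hq := card_eq_two_mul_add_one hF
  have hq' := one_le_card_div_two (F := F)
  set q := Fintype.card F with hq0
  have hC (r : F) (n : ℕ) (hn : n ≤ 2 * q) : (C r * X ^ n : F[X]).natDegree ≤ 2 * q :=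
    (natDegree_C_mul_X_pow_le r n).trans hn
  have hD := natDegree_cubicPoly a b c
  have hDE : (C 2 * (cubicPoly a b c * cubicPoly a b c ^ (q / 2))).natDegree ≤ 2 * q := by
    refine (natDegree_C_mul_le _ _).trans ?_
    rw [← pow_succ']
    refine natDegree_pow_le.trans ?_
    rw [hD]
    omega
  have hL : (C b * X ^ q + C c + cubicPoly a b c +
      C 2 * (cubicPoly a b c * cubicPoly a b c ^ (q / 2)) +
      C (2 * a) * X ^ (q + 1) + C (-a) * X ^ 2 + X ^ (q + 2) +
      C (-1) * X ^ 3).natDegree ≤ 2 * q := by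
    iterate 7 refine natDegree_add_le_of_degree_le ?_ ?_
    · exact hC _ _ (by omega)
    · simp
    · omega
    · exact hDE
    · exact hC _ _ (by omega)
    · exact hC _ _ (by omega)
    · rw [natDegree_X_pow]
      omega
    · exact hC _ _ (by omega)
  rw [numerator_eq hF]
  have hlt : _ < ((2 * q + 1 : ℕ) : WithBot ℕ) :=
    (natDegree_le_iff_degree_le.mp hL).trans_lt (by exact_mod_cast Nat.lt_succ_self _)
  refine ⟨monic_X_pow_add hlt, ?_⟩
  rw [natDegree_add_eq_left_of_degree_lt (by simpa using hlt), natDegree_X_pow]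

variable [DecidableEq F]

lemma eval_cubicPoly_pow (hF : ringChar F ≠ 2) (α : F) :
    (cubicPoly a b c ^ (Fintype.card F / 2)).eval α =
      (quadraticChar F ((cubicPoly a b c).eval α) : F) := by
  rw [eval_pow, quadraticChar_eq_pow_of_char_ne_two' hF]

lemma exists_numerator_eq_mul (hF : ringChar F ≠ 2)
    (hsq : ∀ α : F, ¬ (X - C α) ^ 2 ∣ cubicPoly a b c) :
    ∃ A B G : F[X], numerator a b c = G * A ∧ (X ^ Fintype.card F - X) ^ 2 = G * B ∧
      IsCoprime A B ∧
      (A.natDegree : ℤ) =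
        Fintype.card F + 1 + ∑ x : F, quadraticChar F ((cubicPoly a b c).eval x) ∧
      (B.natDegree : ℤ) = Fintype.card F + ∑ x : F, quadraticChar F ((cubicPoly a b c).eval x) := by
  set χ : F → ℤ := fun x ↦ quadraticChar F ((cubicPoly a b c).eval x) with hχ
  have htri (α : F) : χ α = 0 ∨ χ α = 1 ∨ χ α = -1 := quadraticChar_isQuadratic F _
  have hE (α : F) : (cubicPoly a b c ^ (Fintype.card F / 2)).eval α = (χ α : F) :=
    eval_cubicPoly_pow hF α
  have h0 {α : F} (h : χ α = 0) : X - C α ∣ cubicPoly a b c :=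
    dvd_iff_isRoot.mpr (quadraticChar_eq_zero_iff.mp h)
  have hT (α : F) : X - C α ∣ X ^ Fintype.card F - X :=
    prod_X_sub_C_eq (F := F) ▸ Finset.dvd_prod_of_mem _ (Finset.mem_univ α)
  have hdeg (w : F → ℕ) : (∏ α, (X - C α) ^ w α).natDegree = ∑ α, w α := by
    rw [natDegree_prod_of_monic _ _ fun α _ ↦ (monic_X_sub_C α).pow _]
    simp
  have hco : Pairwise fun α β : F ↦ IsCoprime (X - C α) (X - C β) :=
    pairwise_coprime_X_sub_C Function.injective_id
  set w : F → ℕ := fun α ↦ (1 - χ α).toNat with hw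
  set w' : F → ℕ := fun α ↦ (1 + χ α).toNat with hw'
  have hwχ (α : F) : (w α : ℤ) = 1 - χ α := by
    rcases htri α with h | h | h <;> simp [hw, h]
  have hwχ' (α : F) : (w' α : ℤ) = 1 + χ α := by
    rcases htri α with h | h | h <;> simp [hw', h]
  set G : F[X] := ∏ α, (X - C α) ^ w α with hG
  have hGm : G.Monic := monic_prod_of_monic _ _ fun α _ ↦ (monic_X_sub_C α).pow _
  obtain ⟨A, hA⟩ : G ∣ numerator a b c := by
    refine Fintype.prod_dvd_of_coprime (fun α β h ↦ (hco h).pow) fun α ↦ ?_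
    rw [numerator]
    rcases htri α with h | h | h
    · have : w α = 1 := by simp [hw, h]
      rw [this, pow_one]
      exact dvd_sub ((h0 h).mul_right _) (((hT α).pow two_ne_zero).mul_left _)
    · have : w α = 0 := by simp [hw, h]
      simp [this]
    · have : w α = 2 := by simp [hw, h]
      rw [this]
      refine dvd_sub ((pow_dvd_pow_of_dvd ?_ 2).mul_left _)
        ((pow_dvd_pow_of_dvd (hT α) 2).mul_left _)
      rw [dvd_iff_isRoot, IsRoot.def, eval_add, hE, h]
      simp
  refine ⟨A, ∏ α, (X - C α) ^ w' α, G, hA, ?_, ?_, ?_, ?_⟩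
  · rw [← prod_X_sub_C_eq, hG, ← Finset.prod_mul_distrib, ← Finset.prod_pow]
    refine Finset.prod_congr rfl fun α _ ↦ ?_
    rw [← pow_add]
    congr 1
    have := hwχ α
    have := hwχ' α
    omega
  · refine IsCoprime.prod_right fun α _ ↦ ?_
    rcases htri α with h | h | h
    · refine IsCoprime.pow_right (((irreducible_X_sub_C α).coprime_iff_not_dvd.mpr ?_).symm)
      intro hdvd
      refine hsq α ?_
      have hw1 : w α = 1 := by simp [hw, h]
      have h1 : (X - C α) ^ 2 ∣ numerator a b c := by
        rw [hA, sq]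
        refine mul_dvd_mul ?_ hdvd
        have := Finset.dvd_prod_of_mem (fun α ↦ (X - C α) ^ w α) (Finset.mem_univ α)
        simpa only [hw1, pow_one] using this
      rw [numerator, dvd_sub_left ((pow_dvd_pow_of_dvd (hT α) 2).mul_left _)] at h1
      refine IsCoprime.dvd_of_dvd_mul_right (IsCoprime.pow ?_) h1
      refine (irreducible_X_sub_C α).coprime_iff_not_dvd.mpr ?_
      rw [dvd_iff_isRoot, IsRoot.def, eval_add, hE, h]
      simp
    · refine IsCoprime.pow_right (((irreducible_X_sub_C α).coprime_iff_not_dvd.mpr ?_).symm)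
      intro hdvd
      have h1 : (numerator a b c).eval α = 0 := dvd_iff_isRoot.mp (hA ▸ hdvd.mul_left G)
      have h2 : (2 : F) ≠ 0 := Ring.two_ne_zero hF
      have h3 : (X ^ Fintype.card F - X : F[X]).eval α = 0 := dvd_iff_isRoot.mp (hT α)
      have h4 : (cubicPoly a b c).eval α = 0 := by
        rw [numerator, eval_sub, eval_mul, eval_mul, eval_pow, eval_add, hE, h,
          eval_pow (p := X ^ Fintype.card F - X), h3, eval_one, Int.cast_one, one_add_one_eq_two,
          zero_pow two_ne_zero, mul_zero, sub_zero] at h1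
        exact (mul_eq_zero.mp h1).resolve_right (pow_ne_zero 2 h2)
      have : χ α = 0 := quadraticChar_eq_zero_iff.mpr h4
      omega
    · have : w' α = 0 := by simp [hw', h]
      rw [this, pow_zero]
      exact isCoprime_one_right
  · have hN := (monic_numerator_and_natDegree (a := a) (b := b) (c := c) hF)
    have hA0 : A ≠ 0 := by
      rintro rfl
      exact hN.1.ne_zero (by rw [hA, mul_zero])
    have := hN.2
    rw [hA, natDegree_mul hGm.ne_zero hA0, hdeg] at this
    zify at this
    simp only [hwχ, Finset.sum_sub_distrib, Finset.sum_const, Finset.card_univ] at this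
    simp at this
    linarith
  · rw [hdeg]
    push_cast
    simp only [hwχ', Finset.sum_add_distrib, Finset.sum_const, Finset.card_univ]
    simp

end Numerator

section Points

variable {F K : Type*} [Field F] [Field K] [Algebra F[X] K] {a b c : F} {D : F[X]}

lemma hasHeight_some {u : F[X]} {y : K}
    (h : (twist K a b c D).toAffine.Nonsingular (algebraMap F[X] K (D * u)) y) :
    HasHeight (Point.some _ _ h) u.natDegree := by
  refine ⟨![u, 1], isUnimodular_of_isCoprime isCoprime_one_right, ⟨fun i ↦ ?_, ?_⟩,
    1, one_ne_zero, by simp⟩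
  · fin_cases i <;> simp
  · by_cases hu : u = 0
    · exact ⟨1, by simp [hu]⟩
    · exact ⟨0, by simpa using hu⟩

variable [IsFractionRing F[X] K]

lemma nonsingular_twist [(cubicCurve a b c).IsElliptic] (hD : D ≠ 0) {u v : F[X]}
    (h : v ^ 2 = D * (u ^ 3 + C a * u ^ 2 + C b * u + C c)) :
    (twist K a b c D).toAffine.Nonsingular (algebraMap F[X] K (D * u))
      (algebraMap F[X] K (D * v)) := by
  have hΔ : (twist K a b c D).Δ = algebraMap F[X] K (D ^ 6 * C (cubicCurve a b c).Δ) := by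
    rw [← map_Δ]
    simp only [Δ, b₂, b₄, b₆, b₈, WeierstrassCurve.map, map_zero, map_mul, map_pow, map_add,
      map_sub, map_neg, map_ofNat]
    ring
  refine (equation_iff_nonsingular_of_Δ_ne_zero ?_).mp ?_
  · rw [hΔ, Ne, IsFractionRing.to_map_eq_zero_iff]
    exact mul_ne_zero (pow_ne_zero 6 hD) (C_ne_zero.mpr (cubicCurve a b c).isUnit_Δ.ne_zero)
  · rw [equation_iff]
    simp only [zero_mul, add_zero, ← map_mul, ← map_pow, ← map_add]
    congr 1
    linear_combination D ^ 2 * h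

lemma hasHeight_sub [DecidableEq K] (hD : D ≠ 0) {u₁ u₂ v₁ v₂ A B G : F[X]}
    (h₁ : (twist K a b c D).toAffine.Nonsingular (algebraMap F[X] K (D * u₁))
      (algebraMap F[X] K (D * v₁)))
    (h₂ : (twist K a b c D).toAffine.Nonsingular (algebraMap F[X] K (D * u₂))
      (algebraMap F[X] K (D * v₂))) (hu : u₁ ≠ u₂)
    (hA : (v₁ + v₂) ^ 2 - D * (C a + u₁ + u₂) * (u₁ - u₂) ^ 2 = D * (G * A))
    (hB : (u₁ - u₂) ^ 2 = G * B) (hAB : IsCoprime A B) (hdeg : B.natDegree < A.natDegree) :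
    HasHeight (Point.some _ _ h₁ - Point.some _ _ h₂) A.natDegree := by
  have hinj := IsFractionRing.injective F[X] K
  have hu' : u₁ - u₂ ≠ 0 := sub_ne_zero.mpr hu
  have hGB : G * B ≠ 0 := hB ▸ pow_ne_zero 2 hu'
  have hmap {f : F[X]} (hf : f ≠ 0) : algebraMap F[X] K f ≠ 0 := by simpa using hf
  have hx : algebraMap F[X] K (D * u₁) ≠ algebraMap F[X] K (D * u₂) :=
    fun h ↦ hu (mul_left_cancel₀ hD (hinj h))
  refine ⟨![A, B], isUnimodular_of_isCoprime hAB, ⟨fun i ↦ ?_, 0, ?_⟩,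
    (algebraMap F[X] K B)⁻¹, inv_ne_zero (hmap (right_ne_zero_of_mul hGB)), ?_⟩
  · fin_cases i
    · simp
    · simpa using hdeg.le
  · have hA0 : A ≠ 0 := by
      rintro rfl
      simp at hdeg
    simpa using hA0
  have hsub : algebraMap F[X] K u₁ - algebraMap F[X] K u₂ ≠ 0 := by
    rw [← map_sub]
    exact hmap hu'
  have hB0 := hmap (right_ne_zero_of_mul hGB)
  have hD0 := hmap hD
  replace hA := congrArg (algebraMap F[X] K) hA
  replace hB := congrArg (algebraMap F[X] K) hB
  simp only [map_mul, map_add, map_sub, map_pow] at hA hB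
  have hslope : (algebraMap F[X] K (D * v₁) + algebraMap F[X] K (D * v₂)) /
      (algebraMap F[X] K (D * u₁) - algebraMap F[X] K (D * u₂)) =
      (algebraMap F[X] K v₁ + algebraMap F[X] K v₂) /
        (algebraMap F[X] K u₁ - algebraMap F[X] K u₂) := by
    simp only [map_mul, ← mul_sub, ← mul_add, mul_div_mul_left _ _ hD0]
  rw [sub_eq_add_neg, Point.neg_some, Point.add_of_X_ne hx, Point.xRep_some, slope_of_X_ne hx,
    show (twist K a b c D).toAffine.negY (algebraMap F[X] K (D * u₂))
      (algebraMap F[X] K (D * v₂)) = -algebraMap F[X] K (D * v₂) by simp [negY],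
    sub_neg_eq_add, hslope]
  simp only [addX, Matrix.cons_val, map_mul, zero_mul, add_zero, inv_mul_cancel₀ hB0]
  congr 1
  field_simp
  refine mul_left_cancel₀ (hmap (left_ne_zero_of_mul hGB)) ?_
  linear_combination algebraMap F[X] K G * algebraMap F[X] K B * hA -
    algebraMap F[X] K G * algebraMap F[X] K D * algebraMap F[X] K A * hB

end Points

section Bound

variable {F : Type*} [Field F]

lemma Δ_cubicCurve {R : Type*} [CommRing R] (a b c : R) :
    (cubicCurve a b c).Δ = 16 * (Cubic.mk 1 a b c).discr := by
  simp only [Δ, b₂, b₄, b₆, b₈, Cubic.discr]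
  ring

lemma isElliptic_cubicCurve (hF : ringChar F ≠ 2) {a b c : F}
    (h : ∀ z : AlgebraicClosure F,
      ¬ (X - C z) ^ 2 ∣ (cubicPoly a b c).map (algebraMap F (AlgebraicClosure F))) :
    (cubicCurve a b c).IsElliptic := by
  classical
  have h2 : (2 : F) ≠ 0 := Ring.two_ne_zero hF
  have hP : (Cubic.mk 1 a b c).toPoly = cubicPoly a b c := by simp [Cubic.toPoly, cubicPoly]
  have h0 : (cubicPoly a b c).map (algebraMap F (AlgebraicClosure F)) ≠ 0 := by
    intro h0
    exact h 0 (h0 ▸ dvd_zero _)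
  refine ⟨isUnit_iff_ne_zero.mpr ?_⟩
  rw [Δ_cubicCurve]
  refine mul_ne_zero (by rw [show (16 : F) = 2 ^ 4 by norm_num]; exact pow_ne_zero 4 h2) ?_
  rw [Cubic.discr_ne_zero_iff_roots_nodup (φ := algebraMap F (AlgebraicClosure F)) one_ne_zero
    (IsAlgClosed.splits _), Cubic.map_roots, hP]
  refine Multiset.nodup_iff_count_le_one.mpr fun z ↦ ?_
  rw [count_roots]
  by_contra! hz
  exact h z ((le_rootMultiplicity_iff h0).mp hz)

lemma sq_le_of_forall_nonneg {S q : ℤ} (hq : Odd q) (h : ∀ n : ℤ, 0 ≤ n ^ 2 - S * n + q) :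
    S ^ 2 ≤ 4 * q := by
  obtain ⟨k, rfl | rfl⟩ := Int.even_or_odd' S
  · linarith [h k]
  · obtain ⟨m, rfl⟩ := hq
    obtain ⟨j, hj⟩ := Int.even_mul_succ_self k
    have := h k
    have h1 : 2 * j ≤ 2 * m + 1 := by linarith
    have h2 : j ≤ m := by omega
    linarith

variable [Fintype F] [DecidableEq F]

/-- The Hasse bound for the curve `y² = x³ + a x² + b x + c`. -/
lemma sq_sum_quadraticChar_le (hF : ringChar F ≠ 2) {a b c : F}
    (h : ∀ z : AlgebraicClosure F,
      ¬ (X - C z) ^ 2 ∣ (cubicPoly a b c).map (algebraMap F (AlgebraicClosure F))) :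
    (∑ x : F, quadraticChar F ((cubicPoly a b c).eval x)) ^ 2 ≤ 4 * (Fintype.card F : ℤ) := by
  classical
  have := isElliptic_cubicCurve hF h
  have hsq (α : F) : ¬ (X - C α) ^ 2 ∣ cubicPoly a b c := by
    intro hα
    have := Polynomial.map_dvd (algebraMap F (AlgebraicClosure F)) hα
    exact h (algebraMap F _ α) (by simpa using this)
  obtain ⟨A, B, G, hA, hB, hAB, hdA, hdB⟩ := exists_numerator_eq_mul hF hsq
  set D := cubicPoly a b c with hDdef
  have hD : D ≠ 0 := by
    intro hD
    have := natDegree_cubicPoly a b c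
    simp [← hDdef, hD] at this
  have hq := card_eq_two_mul_add_one hF
  set q := Fintype.card F with hq0
  have hX : (X ^ q : F[X]) ≠ X := sub_ne_zero.mp <|
    FiniteField.X_pow_card_sub_X_ne_zero F Fintype.one_lt_card
  have h₁ := nonsingular_twist (K := FractionRing F[X]) hD (a := a) (b := b) (c := c) (D := D)
    (u := X ^ q) (v := D ^ (q / 2 + 1)) <| by
      have := cubicPoly_pow_card a b c
      rw [← hDdef, ← hq0] at this
      have e : (D ^ (q / 2 + 1)) ^ 2 = D * D ^ q := by
        conv_rhs => rw [hq]
        ring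
      rw [e, this]
      ring
  have h₂ := nonsingular_twist (K := FractionRing F[X]) hD (a := a) (b := b) (c := c) (D := D)
    (u := X) (v := D) (by rw [hDdef, cubicPoly]; ring)
  have hsub := hasHeight_sub hD h₁ h₂ hX
    (by rw [← hA, numerator, ← hDdef, ← hq0]; ring) hB hAB (by omega)
  have hP := hasHeight_some h₂
  have hQ := hasHeight_some h₁
  rw [natDegree_X] at hP
  rw [natDegree_X_pow] at hQ
  refine sq_le_of_forall_nonneg (by
    exact_mod_cast Nat.odd_iff.mpr (FiniteField.odd_card_of_char_ne_two hF))
    fun n ↦ ?_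
  obtain ⟨d, hd⟩ := exists_hasHeight hD (Point.some _ _ h₁ + n • Point.some _ _ h₂)
  have := hP.add_zsmul hD hQ hsub hd
  rw [hdA] at this
  have hd0 : (0 : ℤ) ≤ d := d.cast_nonneg
  push_cast at this
  linarith

end Bound

section CubicPolynomial

variable {F : Type*} [Field F]

lemma exists_eq_C_mul_cubicPoly {f : F[X]} (hf : f.degree = 3) :
    ∃ l a b c : F, l ≠ 0 ∧ f = C l * cubicPoly a b c := by
  have hl : f.leadingCoeff ≠ 0 := by
    rw [leadingCoeff_ne_zero]
    rintro rfl
    simp at hf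
  have hn : f.natDegree = 3 := natDegree_eq_of_degree_eq_some hf
  have h3 : f.leadingCoeff = f.coeff 3 := by rw [leadingCoeff, hn]
  rw [h3] at hl
  refine ⟨f.coeff 3, f.coeff 2 / f.coeff 3, f.coeff 1 / f.coeff 3, f.coeff 0 / f.coeff 3, hl, ?_⟩
  conv_lhs => rw [f.as_sum_range_C_mul_X_pow, hn]
  simp only [Finset.sum_range_succ, Finset.sum_range_zero, cubicPoly, mul_add, ← mul_assoc,
    ← C_mul, mul_div_cancel₀ _ hl]
  ring

variable [Fintype F] [DecidableEq F]

theorem sq_sum_quadraticChar_eval_le (hF : ringChar F ≠ 2) {f : F[X]} (hf : f.degree = 3)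
    (h : ∀ z : AlgebraicClosure F,
      ¬ (X - C z) ^ 2 ∣ f.map (algebraMap F (AlgebraicClosure F))) :
    (∑ x : F, quadraticChar F (f.eval x)) ^ 2 ≤ 4 * (Fintype.card F : ℤ) := by
  obtain ⟨l, a, b, c, hl, rfl⟩ := exists_eq_C_mul_cubicPoly hf
  simp only [eval_mul, eval_C, map_mul, ← Finset.mul_sum]
  rw [mul_pow, quadraticChar_sq_one hl, one_mul]
  refine sq_sum_quadraticChar_le hF fun z hz ↦ h z ?_
  rw [Polynomial.map_mul]
  exact hz.mul_left _

lemma card_filter_sq_eq (hF : ringChar F ≠ 2) (g : F → F) :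
    ((Finset.univ.filter fun xy : F × F ↦ xy.2 ^ 2 = g xy.1).card : ℤ) =
      ∑ x : F, quadraticChar F (g x) + Fintype.card F := by
  have h (x : F) : ((Finset.univ.filter fun y : F ↦ y ^ 2 = g x).card : ℤ) =
      quadraticChar F (g x) + 1 := by
    rw [← quadraticChar_card_sqrts hF]
    congr 2
    ext y
    simp
  rw [Finset.card_filter, ← Finset.univ_product_univ, Finset.sum_product]
  simp only [← Finset.card_filter]
  push_cast
  simp [h, Finset.sum_add_distrib]

end CubicPolynomial

end HasseBound

open Polynomial in
theorem stmt18 (p : ℕ) [Fact p.Prime] (hp : 2 < p) (f : Polynomial (ZMod p))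
    (hdeg : f.degree = 3)
    (hsep : ∀ z : AlgebraicClosure (ZMod p),
      ¬ (X - C z) ^ 2 ∣ f.map (algebraMap (ZMod p) (AlgebraicClosure (ZMod p)))) :
    (∑ x : ZMod p, quadraticChar (ZMod p) (f.eval x) =
        -((p : ℤ) + 1 -
          (1 + ((Finset.univ.filter
            (fun xy : ZMod p × ZMod p => xy.2 ^ 2 = f.eval xy.1)).card : ℤ)))) ∧
      (|∑ x : ZMod p, quadraticChar (ZMod p) (f.eval x)| : ℝ) ≤ 2 * Real.sqrt p := by
  have hF : ringChar (ZMod p) ≠ 2 := by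
    rw [ZMod.ringChar_zmod_n]
    exact hp.ne'
  constructor
  · rw [HasseBound.card_filter_sq_eq hF fun x ↦ f.eval x, ZMod.card]
    ring
  · have h := HasseBound.sq_sum_quadraticChar_eval_le hF hdeg hsep
    rw [ZMod.card] at h
    rw [show (2 : ℝ) * √p = √(4 * p) by
      rw [Real.sqrt_mul (by norm_num), show (4 : ℝ) = 2 ^ 2 by norm_num,
        Real.sqrt_sq zero_le_two]]
    refine Real.abs_le_sqrt ?_
    exact_mod_cast h
end
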